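/- Let k, l > 1 be integers and let d = gcd(k,l). Then for every integer r with 1 ≤ r ≤ min(k,l), the (2r−1)-st homotopy group of the matrix Grassmannian Gr^U_{k,l} is isomorphic to ℤ/dℤ. -/

import Mathlib

open Matrix Kronecker Topology

/-- The relation of lying in the same left coset of the subgroup
`H_{k,l} = { A ⊗ B : A ∈ U(k), B ∈ U(l) }` of `U(kl)` (Kronecker products of unitaries),
where `M_{kl}(ℂ)` is realized with index type `Fin k × Fin l`. -/
def kroneckerCosetRel (k l : ℕ) (x y : Matrix.unitaryGroup (Fin k × Fin l) ℂ) : Prop :=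
  ∃ A ∈ Matrix.unitaryGroup (Fin k) ℂ, ∃ B ∈ Matrix.unitaryGroup (Fin l) ℂ,
    (y : Matrix (Fin k × Fin l) (Fin k × Fin l) ℂ) =
      (x : Matrix (Fin k × Fin l) (Fin k × Fin l) ℂ) * (A ⊗ₖ B)

/-- The matrix Grassmannian `Gr^U_{k,l} = U(kl) / (U(k) ⊗ U(l))`, the quotient topological
space of left cosets. -/
def GrU (k l : ℕ) : Type :=
  Quot (kroneckerCosetRel k l)

instance (k l : ℕ) : TopologicalSpace (GrU k l) :=
  inferInstanceAs (TopologicalSpace (Quot (kroneckerCosetRel k l)))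

/-- The base point of `Gr^U_{k,l}`: the coset of the identity matrix. -/
def GrU.pt (k l : ℕ) : GrU k l := Quot.mk _ 1

namespace BottPf
set_option linter.unusedSectionVars false
open scoped unitInterval Topology.Homotopy

/-! ### Basics on generalized loops -/

section Basics
variable {N : Type} {X Y : Type} [TopologicalSpace X] [TopologicalSpace Y]

lemma mkH {x : X} {f g : Ω^ N X x} (H : I × (N → I) → X) (hc : Continuous H)
    (h0 : ∀ y, H (0, y) = f y) (h1 : ∀ y, H (1, y) = g y)
    (hb : ∀ t, ∀ y ∈ Cube.boundary N, H (t, y) = x) : GenLoop.Homotopic f g :=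
  ⟨{ toFun := H
     continuous_toFun := hc
     map_zero_left := h0
     map_one_left := h1
     prop' := fun t y hy => (hb t y hy).trans (f.2 y hy).symm }⟩

lemma exH {x : X} {f g : Ω^ N X x} (h : GenLoop.Homotopic f g) :
    ∃ H : I × (N → I) → X, Continuous H ∧ (∀ y, H (0, y) = f y) ∧ (∀ y, H (1, y) = g y) ∧
      (∀ t, ∀ y ∈ Cube.boundary N, H (t, y) = x) := by
  obtain ⟨H⟩ := h
  exact ⟨H, H.continuous, H.apply_zero, H.apply_one,
    fun t y hy => (H.eq_fst t hy).trans (f.2 y hy)⟩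

/-- Build a generalized loop. -/
def mkL {x : X} (f : (N → I) → X) (hc : Continuous f) (hb : ∀ y ∈ Cube.boundary N, f y = x) :
    Ω^ N X x := ⟨⟨f, hc⟩, hb⟩

@[simp] lemma mkL_apply {x : X} (f : (N → I) → X) (hc : Continuous f)
    (hb : ∀ y ∈ Cube.boundary N, f y = x) (y) : mkL f hc hb y = f y := rfl

lemma contL {x : X} (f : Ω^ N X x) : Continuous f := f.1.2

/-- Postcomposition of a loop. -/
def mapL (φ : X → Y) (hφ : Continuous φ) {x : X} {y : Y} (h : φ x = y) (f : Ω^ N X x) :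
    Ω^ N Y y :=
  mkL (fun t => φ (f t)) (hφ.comp (contL f)) (fun t ht => by rw [GenLoop.boundary f t ht, h])

@[simp] lemma mapL_apply (φ : X → Y) (hφ : Continuous φ) {x : X} {y : Y} (h : φ x = y)
    (f : Ω^ N X x) (t) : mapL φ hφ h f t = φ (f t) := rfl

lemma mapL_homotopic (φ : X → Y) (hφ : Continuous φ) {x : X} {y : Y} (h : φ x = y)
    {f g : Ω^ N X x} (hfg : GenLoop.Homotopic f g) :
    GenLoop.Homotopic (mapL φ hφ h f) (mapL φ hφ h g) := by
  obtain ⟨H, hc, h0, h1, hb⟩ := exH hfg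
  exact mkH (fun p => φ (H p)) (hφ.comp hc) (fun y => by simp [h0]) (fun y => by simp [h1])
    (fun t y hy => by rw [hb t y hy, h])

lemma mapL_transAt [DecidableEq N] (φ : X → Y) (hφ : Continuous φ) {x : X} {y : Y} (h : φ x = y)
    (i : N) (f g : Ω^ N X x) :
    mapL φ hφ h (GenLoop.transAt i f g) =
      GenLoop.transAt i (mapL φ hφ h f) (mapL φ hφ h g) := by
  ext t
  simp only [mapL_apply, GenLoop.transAt, GenLoop.coe_copy]
  split_ifs <;> rfl

/-- The induced homomorphism on homotopy groups. -/
def mapPi [DecidableEq N] [Nonempty N] (φ : X → Y) (hφ : Continuous φ) {x : X} {y : Y}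
    (h : φ x = y) : HomotopyGroup N X x →* HomotopyGroup N Y y where
  toFun := Quotient.map (mapL φ hφ h) (fun _ _ => mapL_homotopic φ hφ h)
  map_one' := by
    rw [HomotopyGroup.one_def, HomotopyGroup.one_def]
    refine congrArg (Quotient.mk _) ?_
    ext t; simp [h]
  map_mul' := by
    intro a b
    induction a using Quotient.inductionOn with | _ f => ?_
    induction b using Quotient.inductionOn with | _ g => ?_
    have i : N := Classical.arbitrary N
    have e1 := HomotopyGroup.mul_spec (i := i) (p := f) (q := g)
    have e2 := HomotopyGroup.mul_spec (i := i) (p := mapL φ hφ h f) (q := mapL φ hφ h g)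
    change Quotient.map _ _ (((· * ·) : _ → _ → HomotopyGroup N X x) ⟦f⟧ ⟦g⟧) =
      ((· * ·) : _ → _ → HomotopyGroup N Y y) ⟦mapL φ hφ h f⟧ ⟦mapL φ hφ h g⟧
    rw [e1, e2]
    refine congrArg (Quotient.mk _) (mapL_transAt φ hφ h i g f)

/-- Class of a loop. -/
def mkPi {x : X} (f : Ω^ N X x) : HomotopyGroup N X x := Quotient.mk _ f

lemma mkPi_eq {x : X} {f g : Ω^ N X x} : mkPi f = mkPi g ↔ GenLoop.Homotopic f g :=
  ⟨fun h => Quotient.exact h, fun h => Quotient.sound h⟩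

lemma mkPi_surj {x : X} : Function.Surjective (mkPi : Ω^ N X x → _) := Quotient.exists_rep

@[simp] lemma mapPi_mk [DecidableEq N] [Nonempty N] (φ : X → Y) (hφ : Continuous φ) {x : X} {y : Y}
    (h : φ x = y) (f : Ω^ N X x) : mapPi φ hφ h (mkPi f) = mkPi (mapL φ hφ h f) := rfl

lemma const_homotopic_of_subsingleton {x : X} [Subsingleton X] (f g : Ω^ N X x) :
    GenLoop.Homotopic f g := by
  have : f = g := by ext; exact Subsingleton.elim _ _
  rw [this]

end Basics

section Grp
variable {N : Type} {G : Type} [TopologicalSpace G] [Group G] [IsTopologicalGroup G]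

instance instOneL : One (Ω^ N G (1 : G)) := ⟨GenLoop.const⟩
instance instMulL : Mul (Ω^ N G (1 : G)) :=
  ⟨fun f g => mkL (fun t => f t * g t) ((contL f).mul (contL g))
    (fun y hy => by rw [GenLoop.boundary f y hy, GenLoop.boundary g y hy, one_mul])⟩
instance instInvL : Inv (Ω^ N G (1 : G)) :=
  ⟨fun f => mkL (fun t => (f t)⁻¹) (contL f).inv (fun y hy => by rw [GenLoop.boundary f y hy, inv_one])⟩

@[simp] lemma oneL_apply (t : N → I) : (1 : Ω^ N G (1 : G)) t = 1 := rfl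
@[simp] lemma mulL_apply (f g : Ω^ N G (1 : G)) (t : N → I) : (f * g) t = f t * g t := rfl
@[simp] lemma invL_apply (f : Ω^ N G (1 : G)) (t : N → I) : (f⁻¹) t = (f t)⁻¹ := rfl

instance instGroupL : Group (Ω^ N G (1 : G)) where
  mul_assoc f g h := by ext t; simp [mul_assoc]
  one_mul f := by ext t; simp
  mul_one f := by ext t; simp
  inv_mul_cancel f := by ext t; simp

lemma hmul {f f' g g' : Ω^ N G (1 : G)} (h1 : GenLoop.Homotopic f f')
    (h2 : GenLoop.Homotopic g g') : GenLoop.Homotopic (f * g) (f' * g') := by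
  obtain ⟨H, hc, h0, h1, hb⟩ := exH h1
  obtain ⟨H', hc', h0', h1', hb'⟩ := exH h2
  exact mkH (fun p => H p * H' p) (hc.mul hc') (fun y => by simp [h0, h0'])
    (fun y => by simp [h1, h1']) (fun t y hy => by rw [hb t y hy, hb' t y hy, one_mul])

lemma hinv {f f' : Ω^ N G (1 : G)} (h1 : GenLoop.Homotopic f f') :
    GenLoop.Homotopic f⁻¹ f'⁻¹ := by
  obtain ⟨H, hc, h0, h1, hb⟩ := exH h1
  exact mkH (fun p => (H p)⁻¹) hc.inv (fun y => by simp [h0])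
    (fun y => by simp [h1]) (fun t y hy => by rw [hb t y hy, inv_one])

lemma hdisj [DecidableEq N] [Nonempty N] (f g : Ω^ N G (1 : G)) :
    ∃ f' g' : Ω^ N G (1 : G), GenLoop.Homotopic f' f ∧ GenLoop.Homotopic g' g ∧
      (∀ t, f' t = 1 ∨ g' t = 1) ∧
      (Quotient.mk _ (f' * g') : HomotopyGroup N G (1 : G)) =
        HMul.hMul (α := HomotopyGroup N G (1 : G)) (β := HomotopyGroup N G (1 : G))
          (Quotient.mk _ f) (Quotient.mk _ g) := by
  have i : N := Classical.arbitrary N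
  refine ⟨GenLoop.transAt i 1 f, GenLoop.transAt i g 1, ?_, ?_, ?_, ?_⟩
  · apply mkPi_eq.1
    unfold mkPi
    have e := HomotopyGroup.mul_spec (i := i) (p := f) (q := (1 : Ω^ N G (1 : G)))
    rw [← e]
    exact mul_one (M := HomotopyGroup N G (1 : G)) _
  · apply mkPi_eq.1
    unfold mkPi
    have e := HomotopyGroup.mul_spec (i := i) (q := g) (p := (1 : Ω^ N G (1 : G)))
    rw [← e]
    exact one_mul (M := HomotopyGroup N G (1 : G)) _
  · intro t
    simp only [GenLoop.transAt, GenLoop.coe_copy]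
    split_ifs
    · left; rfl
    · right; rfl
  · have e := HomotopyGroup.mul_spec (i := i) (p := f) (q := g)
    refine Eq.trans ?_ e.symm
    refine congrArg (Quotient.mk _) ?_
    ext t
    simp only [mulL_apply, GenLoop.transAt, GenLoop.coe_copy]
    split_ifs <;> simp

/-- The class map is a homomorphism for the pointwise product. -/
def cls [DecidableEq N] [Nonempty N] : Ω^ N G (1 : G) →* HomotopyGroup N G (1 : G) where
  toFun := mkPi
  map_one' := rfl
  map_mul' f g := by
    obtain ⟨f', g', hf, hg, -, e⟩ := hdisj f g
    refine Eq.trans (Quotient.sound ?_) e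
    exact (hmul hf hg).symm

lemma cls_eq [DecidableEq N] [Nonempty N] {f g : Ω^ N G (1 : G)} :
    cls f = cls g ↔ GenLoop.Homotopic f g := mkPi_eq

lemma cls_eq_one [DecidableEq N] [Nonempty N] {f : Ω^ N G (1 : G)} :
    cls f = 1 ↔ GenLoop.Homotopic f 1 := mkPi_eq

lemma cls_surj [DecidableEq N] [Nonempty N] :
    Function.Surjective (cls : Ω^ N G (1 : G) → HomotopyGroup N G (1 : G)) := mkPi_surj

variable {G' : Type} [TopologicalSpace G'] [Group G'] [IsTopologicalGroup G']

def homL (φ : G →* G') (hφ : Continuous φ) : Ω^ N G (1 : G) →* Ω^ N G' (1 : G') where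
  toFun := mapL φ hφ (map_one φ)
  map_one' := by ext t; simp
  map_mul' f g := by ext t; simp

@[simp] lemma homL_apply (φ : G →* G') (hφ : Continuous φ) (f : Ω^ N G (1 : G)) (t) :
    homL φ hφ f t = φ (f t) := rfl

lemma homL_homotopic (φ : G →* G') (hφ : Continuous φ) {f g : Ω^ N G (1 : G)}
    (h : GenLoop.Homotopic f g) : GenLoop.Homotopic (homL φ hφ f) (homL φ hφ g) :=
  mapL_homotopic φ hφ (map_one φ) h

/-- Reindexing the cube. -/
lemma congr_homotopic {M : Type} {X : Type} [TopologicalSpace X] {x : X} (e : M ≃ N) {f g : Ω^ M X x}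
    (h : GenLoop.Homotopic f g) :
    GenLoop.Homotopic (GenLoop.congr x e f) (GenLoop.congr x e g) := by
  obtain ⟨H, hc, h0, h1, hb⟩ := exH h
  refine mkH (fun p => H (p.1, fun m => p.2 (e m))) (hc.comp (by fun_prop))
    (fun y => h0 _) (fun y => h1 _) (fun t y ⟨n, hn⟩ => hb _ _ ⟨e.symm n, by simpa using hn⟩)

lemma congr_mul {M : Type} (e : M ≃ N) (f g : Ω^ M G (1 : G)) :
    GenLoop.congr 1 e (f * g) = GenLoop.congr 1 e f * GenLoop.congr 1 e g := rfl

/-- Conjugation along a path. -/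
lemma conj_homotopic [PathConnectedSpace G] (a : G) (f : Ω^ N G (1 : G)) (f' : Ω^ N G (1 : G))
    (h : ∀ t, f' t = a * f t * a⁻¹) : GenLoop.Homotopic f f' := by
  let γ := PathConnectedSpace.somePath (1 : G) a
  refine mkH (fun p => γ p.1 * f p.2 * (γ p.1)⁻¹) ?_ ?_ ?_ ?_
  · have := contL f; fun_prop
  · intro y; simp
  · intro y; simp [h]
  · intro t y hy; simp [GenLoop.boundary f y hy]

lemma homotopic_iff_mul_inv {f g : Ω^ N G (1 : G)} :
    GenLoop.Homotopic f g ↔ GenLoop.Homotopic (f * g⁻¹) 1 := by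
  constructor
  · intro h; simpa using hmul h (GenLoop.Homotopic.refl g⁻¹)
  · intro h; simpa using hmul h (GenLoop.Homotopic.refl g)

end Grp
end BottPf

namespace BottPf
open scoped unitInterval Topology.Homotopy

/-! ### Homotopy lifting -/

theorem HLP {G B Y : Type} [TopologicalSpace G] [Group G] [IsTopologicalGroup G] [CompactSpace G]
    [TopologicalSpace B] [T2Space B] [TopologicalSpace Y] [CompactSpace Y]
    (act : G → B → B) (hact : Continuous (fun p : G × B => act p.1 p.2))
    (act_one : ∀ x, act 1 x = x) (act_mul : ∀ g h x, act (g * h) x = act g (act h x))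
    (b : B) (V O : Set B) (hV : IsOpen V) (hbV : b ∈ V) (s : B → G)
    (hs : ContinuousOn s (V ∩ O)) (hsb : s b = 1) (hsv : ∀ v ∈ V ∩ O, act (s v) b = v)
    (K : Subgroup G) (hsK : ∀ v ∈ V ∩ O, s v ∈ K) (hKO : ∀ g ∈ K, ∀ v ∈ O, act g v ∈ O)
    (F : Y → G) (hF : Continuous F) (hFK : ∀ y, F y ∈ K)
    (H : Y × I → B) (hH : Continuous H) (hHO : ∀ p, H p ∈ O)
    (hH0 : ∀ y, H (y, 0) = act (F y) b) :
    ∃ F' : Y × I → G, Continuous F' ∧ (∀ y, F' (y, 0) = F y) ∧ (∀ p, act (F' p) b = H p) ∧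
      (∀ p, F' p ∈ K) ∧ (∀ y, (∀ t, H (y, t) = H (y, 0)) → ∀ t, F' (y, t) = F y) := by
  have act_inv : ∀ g x, act g⁻¹ (act g x) = x := fun g x => by
    rw [← act_mul, inv_mul_cancel, act_one]
  have act_inv' : ∀ g x, act g (act g⁻¹ x) = x := fun g x => by
    rw [← act_mul, mul_inv_cancel, act_one]
  -- uniform step size
  obtain ⟨n, hn0, hn⟩ : ∃ n : ℕ, 0 < n ∧ ∀ y t t' g, dist (t : I) t' ≤ 1 / (n : ℝ) →
      act g b = H (y, t) → act g⁻¹ (H (y, t')) ∈ V := by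
    let C : Set (Y × I × I × G) :=
      {q | act q.2.2.2 b = H (q.1, q.2.1) ∧ act q.2.2.2⁻¹ (H (q.1, q.2.2.1)) ∉ V}
    have hC : IsClosed C := by
      apply IsClosed.inter
      · apply isClosed_eq
        · exact hact.comp (f := fun q : Y × I × I × G => (q.2.2.2, b)) (by fun_prop)
        · fun_prop
      · have : Continuous (fun q : Y × I × I × G => act q.2.2.2⁻¹ (H (q.1, q.2.2.1))) :=
          hact.comp (f := fun q : Y × I × I × G => (q.2.2.2⁻¹, H (q.1, q.2.2.1))) (by fun_prop)
        exact (hV.isClosed_compl).preimage this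
    have hpos : ∀ q ∈ C, 0 < dist q.2.1 q.2.2.1 := by
      rintro ⟨y, t, t', g⟩ ⟨h1, h2⟩
      apply dist_pos.2
      rintro h
      simp only at h h1 h2
      subst h
      rw [← h1, act_inv] at h2
      exact h2 hbV
    obtain ⟨δ, hδ, hδC⟩ : ∃ δ > 0, ∀ q ∈ C, δ ≤ dist q.2.1 q.2.2.1 := by
      rcases C.eq_empty_or_nonempty with he | hne
      · exact ⟨1, one_pos, by simp [he]⟩
      · obtain ⟨q, hq, hmin⟩ := hC.isCompact.exists_isMinOn hne
          (f := fun q : Y × I × I × G => dist q.2.1 q.2.2.1) (by fun_prop)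
        exact ⟨_, hpos q hq, fun q' hq' => hmin hq'⟩
    obtain ⟨n, hn⟩ := exists_nat_one_div_lt hδ
    refine ⟨n + 1, Nat.succ_pos _, fun y t t' g hd hg => ?_⟩
    by_contra hnot
    have := hδC (y, t, t', g) ⟨hg, hnot⟩
    push_cast at hd
    simp only at this
    linarith
  let c : ℕ → I := fun j => Set.projIcc 0 1 zero_le_one ((j : ℝ) / n)
  have hc0 : c 0 = 0 := by simp [c]
  have hcn : c n = 1 := by
    have : (n : ℝ) ≠ 0 := by positivity
    simp [c, div_self this]
  have hcd : ∀ j (t : I), dist (min t (c j)) (min t (c (j + 1))) ≤ 1 / (n : ℝ) := by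
    intro j t
    have h1 : dist (min t (c j)) (min t (c (j + 1))) ≤ dist (c j) (c (j + 1)) := by
      simp only [Subtype.dist_eq, Real.dist_eq]
      have e : ∀ a b : I, ((min a b : I) : ℝ) = min (a : ℝ) b := by
        intro a b; rcases le_total a b with h | h <;> simp [h]
      rw [e, e]
      refine (abs_min_sub_min_le_max _ _ _ _).trans ?_
      simp
    refine h1.trans ?_
    have h2 : dist (c j) (c (j + 1)) ≤ dist ((j : ℝ) / n) (((j + 1 : ℕ) : ℝ) / n) := by
      have := (LipschitzWith.projIcc (zero_le_one (α := ℝ))).dist_le_mul ((j : ℝ) / n)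
        (((j + 1 : ℕ) : ℝ) / n)
      simpa [c] using this
    refine h2.trans ?_
    rw [Real.dist_eq]
    push_cast
    rw [← sub_div, abs_div]
    simp
  have key : ∀ j : ℕ, ∃ F' : Y × I → G, Continuous F' ∧ (∀ y, F' (y, 0) = F y) ∧
      (∀ p, act (F' p) b = H (p.1, min p.2 (c j))) ∧
      (∀ p, F' p ∈ K) ∧ (∀ y, (∀ t, H (y, t) = H (y, 0)) → ∀ t, F' (y, t) = F y) := by
    intro j
    induction j with
    | zero =>
      refine ⟨fun p => F p.1, by fun_prop, fun _ => rfl, fun p => ?_, fun p => hFK _,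
        fun _ _ _ => rfl⟩
      rw [hc0, ← hH0]
      congr 2
      exact (min_eq_right bot_le).symm
    | succ j ih =>
      obtain ⟨F', h1, h2, h3, h4, h5⟩ := ih
      have hcont : Continuous (fun p : Y × I => act (F' p)⁻¹ (H (p.1, min p.2 (c (j + 1))))) :=
        hact.comp (f := fun p : Y × I => ((F' p)⁻¹, H (p.1, min p.2 (c (j + 1))))) (by fun_prop)
      have hmem : ∀ p : Y × I, act (F' p)⁻¹ (H (p.1, min p.2 (c (j + 1)))) ∈ V ∩ O := by
        intro p
        refine ⟨hn _ _ _ _ (hcd j p.2) (h3 p), hKO _ (inv_mem (h4 p)) _ (hHO _)⟩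
      refine ⟨fun p => F' p * s (act (F' p)⁻¹ (H (p.1, min p.2 (c (j + 1))))), ?_, ?_, ?_, ?_, ?_⟩
      · exact h1.mul (hs.comp_continuous hcont hmem)
      · intro y
        have e : min (0 : I) (c (j + 1)) = 0 := min_eq_left bot_le
        simp only [e, h2]
        rw [hH0, act_inv, hsb, mul_one]
      · intro p
        rw [act_mul, hsv _ (hmem p), act_inv']
      · intro p
        exact mul_mem (h4 p) (hsK _ (hmem p))
      · intro y hy t
        simp only [h5 y hy t]
        rw [hy, hH0, act_inv, hsb, mul_one]
  obtain ⟨F', h1, h2, h3, h4, h5⟩ := key n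
  refine ⟨F', h1, h2, fun p => ?_, h4, h5⟩
  rw [h3, hcn]
  congr 2
  exact min_eq_left le_top

end BottPf

namespace BottPf
open scoped unitInterval Topology.Homotopy

/-! ### Maps of low dimensional cubes to spheres -/

lemma sphere_null {N : Type} [Fintype N] {E : Type} [NormedAddCommGroup E] [NormedSpace ℝ E]
    [FiniteDimensional ℝ E] (h : (N → I) → E) (hc : Continuous h) (h1 : ∀ y, ‖h y‖ = 1)
    (e : E) (he : ‖e‖ = 1) (hb : ∀ y ∈ Cube.boundary N, h y = e)
    (hd : Fintype.card N + 1 < Module.finrank ℝ E) :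
    ∃ H : (N → I) × I → E, Continuous H ∧ (∀ p, ‖H p‖ = 1) ∧ (∀ y, H (y, 0) = h y) ∧
      (∀ y, H (y, 1) = e) ∧ (∀ y ∈ Cube.boundary N, ∀ t, H (y, t) = e) := by
  -- smooth approximation
  let cl : (N → ℝ) → (N → I) := fun x i => Set.projIcc 0 1 zero_le_one (x i)
  have hcl : UniformContinuous cl := by
    rw [uniformContinuous_pi]
    intro i
    have : UniformContinuous (Set.projIcc (0:ℝ) 1 zero_le_one) :=
      (LipschitzWith.projIcc (zero_le_one (α := ℝ))).uniformContinuous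
    exact this.comp (Pi.uniformContinuous_proj _ i)
  have hcl' : ∀ y : N → I, cl (fun i => (y i : ℝ)) = y := by
    intro y; ext i; simp [cl]
  have hu : UniformContinuous (h ∘ cl) :=
    (CompactSpace.uniformContinuous_of_continuous hc).comp hcl
  obtain ⟨g, hg, hgd⟩ := hu.exists_contDiff_dist_le (ε := 1 / 4) (by norm_num)
  have hg1 : ContDiff ℝ 1 g := hg.of_le (by simp)
  have hΦ : ContDiff ℝ 1 (fun p : (N → ℝ) × ℝ => -(p.2 • e) - g p.1) := by fun_prop
  have hdense := hΦ.dense_compl_range_of_finrank_lt_finrank (by simpa using hd)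
  obtain ⟨w, hw, hwd⟩ := hdense.exists_dist_lt 0 (ε := 1 / 4) (by norm_num)
  rw [dist_zero_left] at hwd
  let q : (N → I) → E := fun y => g (fun i => (y i : ℝ)) + w
  have hq : Continuous q := by
    have := hg.continuous
    fun_prop
  have hqh : ∀ y, ‖q y - h y‖ < 1 / 2 := by
    intro y
    have := hgd (fun i => (y i : ℝ))
    rw [Function.comp, hcl', dist_eq_norm] at this
    calc ‖q y - h y‖ = ‖(g (fun i => (y i : ℝ)) - h y) + w‖ := by simp only [q]; congr 1; abel
      _ ≤ _ := norm_add_le _ _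
      _ < 1 / 2 := by linarith
  have hqe : ∀ y (t : ℝ), q y + t • e ≠ 0 := by
    intro y t h0
    apply hw
    refine ⟨(fun i => (y i : ℝ), t), ?_⟩
    simp only [q] at h0
    have : w = -(t • e) - g (fun i => (y i : ℝ)) := by
      rw [eq_sub_iff_add_eq, eq_neg_iff_add_eq_zero, ← h0]; abel
    exact this.symm
  let φ : (N → I) → ℝ := fun y => min 1 (4 * ‖h y - e‖)
  have hφ : Continuous φ := by fun_prop
  have hφ0 : ∀ y, 0 ≤ φ y := fun y => le_min zero_le_one (by positivity)
  have hφ1 : ∀ y, φ y ≤ 1 := fun y => min_le_left _ _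
  let P : (N → I) × ℝ × ℝ → E := fun p =>
    (1 - p.2.2) • (h p.1 + (p.2.1 * φ p.1) • (q p.1 - h p.1)) + p.2.2 • e
  have hP : Continuous P := by fun_prop
  have hsmall : ∀ y, ∀ a ∈ Set.Icc (0:ℝ) 1, ‖(a * φ y) • (q y - h y)‖ < 1 / 2 := by
    intro y a ha
    rw [norm_smul, Real.norm_eq_abs, abs_of_nonneg (mul_nonneg ha.1 (hφ0 y))]
    have : a * φ y ≤ 1 := mul_le_one₀ ha.2 (hφ0 y) (hφ1 y)
    calc a * φ y * ‖q y - h y‖ ≤ 1 * ‖q y - h y‖ := by gcongr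
      _ < 1 / 2 := by rw [one_mul]; exact hqh y
  have hne1 : ∀ y, ∀ a ∈ Set.Icc (0:ℝ) 1, P (y, a, 0) ≠ 0 := by
    intro y a ha h0
    simp only [P, sub_zero, one_smul, zero_smul, add_zero] at h0
    have h2 := hsmall y a ha
    rw [← neg_eq_iff_add_eq_zero] at h0
    rw [← h0, norm_neg, h1] at h2
    norm_num at h2
  have hne2 : ∀ y, ∀ b ∈ Set.Icc (0:ℝ) 1, P (y, 1, b) ≠ 0 := by
    intro y b hb h0
    simp only [P, one_mul] at h0
    by_cases hφy : φ y = 1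
    · rw [hφy, one_smul, add_sub_cancel] at h0
      by_cases hb1 : b = 1
      · rw [hb1] at h0
        simp only [sub_self, zero_smul, one_smul, zero_add] at h0
        rw [h0] at he; simp at he
      · have h3 : (1 - b) ≠ 0 := sub_ne_zero.2 (Ne.symm hb1)
        apply hqe y ((1 - b)⁻¹ * b)
        have := congrArg (fun v => (1 - b)⁻¹ • v) h0
        simpa [smul_add, smul_smul, inv_mul_cancel₀ h3] using this
    · have h3 : ‖h y - e‖ < 1 / 4 := by
        by_contra hcon
        apply hφy
        exact min_eq_left (by linarith)
      have h4 := hsmall y 1 ⟨zero_le_one, le_rfl⟩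
      rw [one_mul] at h4
      have h5 : (1 - b) • ((h y - e) + φ y • (q y - h y)) = -e := by
        rw [eq_neg_iff_add_eq_zero, ← h0]
        simp only [smul_add, smul_sub, sub_smul, one_smul]
        abel
      have h6 : ‖(1 - b) • ((h y - e) + φ y • (q y - h y))‖ < 1 := by
        rw [norm_smul, Real.norm_eq_abs, abs_of_nonneg (by linarith [hb.2])]
        calc (1 - b) * ‖(h y - e) + φ y • (q y - h y)‖ ≤ 1 * (‖h y - e‖ + ‖φ y • (q y - h y)‖) := by
              gcongr
              · linarith [hb.1]
              · exact norm_add_le _ _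
          _ < 1 := by linarith
      rw [h5, norm_neg, he] at h6
      exact lt_irrefl _ h6
  let A : (N → I) × I → E := fun p => P (p.1, min 1 (2 * (p.2 : ℝ)), max 0 (2 * (p.2 : ℝ) - 1))
  have hA : Continuous A := by fun_prop
  have hA0 : ∀ p, A p ≠ 0 := by
    rintro ⟨y, t⟩
    simp only [A]
    have ht0 := t.2.1
    have ht1 := t.2.2
    rcases le_total (t : ℝ) (1 / 2) with ht | ht
    · rw [max_eq_left (by linarith)]
      exact hne1 _ _ ⟨le_min zero_le_one (by linarith), min_le_left _ _⟩
    · rw [min_eq_left (by linarith)]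
      exact hne2 _ _ ⟨le_max_left _ _, max_le zero_le_one (by linarith)⟩
  refine ⟨fun p => ‖A p‖⁻¹ • A p, ?_, ?_, ?_, ?_, ?_⟩
  · exact (hA.norm.inv₀ (fun p => norm_ne_zero_iff.2 (hA0 p))).smul hA
  · intro p
    rw [norm_smul, norm_inv, norm_norm, inv_mul_cancel₀ (norm_ne_zero_iff.2 (hA0 p))]
  · intro y
    have : A (y, 0) = h y := by simp [A, P]
    simp [this, h1]
  · intro y
    have : A (y, 1) = e := by simp only [A, P]; norm_num
    simp [this, he]
  · intro y hy t
    have : A (y, t) = e := by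
      simp only [A, P]
      rw [hb y hy]
      have : φ y = 0 := by simp [φ, hb y hy]
      rw [this]; simp [sub_smul]
    simp [this, he]

end BottPf

namespace BottPf
set_option linter.unusedSectionVars false
set_option linter.unusedSimpArgs false
open scoped unitInterval Topology.Homotopy

/-! ### Unitary groups: generalities -/

/-- The unitary group as a type. -/
abbrev U (ι : Type) [Fintype ι] [DecidableEq ι] : Type := ↥(Matrix.unitaryGroup ι ℂ)

section UBasic
variable {ι κ μ : Type} [Fintype ι] [DecidableEq ι] [Fintype κ] [DecidableEq κ]
  [Fintype μ] [DecidableEq μ]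

lemma U_star_mul (A : U ι) : (A : Matrix ι ι ℂ)ᴴ * (A : Matrix ι ι ℂ) = 1 :=
  (Matrix.mem_unitaryGroup_iff'.1 A.2)
lemma U_mul_star (A : U ι) : (A : Matrix ι ι ℂ) * (A : Matrix ι ι ℂ)ᴴ = 1 :=
  (Matrix.mem_unitaryGroup_iff.1 A.2)
lemma U_coe_inv (A : U ι) : ((A⁻¹ : U ι) : Matrix ι ι ℂ) = (A : Matrix ι ι ℂ)ᴴ := rfl
lemma U_coe_mul (A B : U ι) : ((A * B : U ι) : Matrix ι ι ℂ) = (A : Matrix ι ι ℂ) * B := rfl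
lemma U_coe_one : ((1 : U ι) : Matrix ι ι ℂ) = 1 := rfl
lemma mem_U {A : Matrix ι ι ℂ} (h : Aᴴ * A = 1) : A ∈ Matrix.unitaryGroup ι ℂ :=
  Matrix.mem_unitaryGroup_iff'.2 h

instance instCompactU : CompactSpace (U ι) := by
  apply isCompact_iff_compactSpace.1
  have hcl : IsClosed (Matrix.unitaryGroup ι ℂ : Set (Matrix ι ι ℂ)) := by
    have : (Matrix.unitaryGroup ι ℂ : Set (Matrix ι ι ℂ)) = {A | Aᴴ * A = 1} := by
      ext A; exact Matrix.mem_unitaryGroup_iff'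
    rw [this]
    exact isClosed_eq (by fun_prop) (by fun_prop)
  have hK : IsCompact (Set.univ.pi fun _ : ι => Set.univ.pi fun _ : ι =>
      Metric.closedBall (0 : ℂ) 1) :=
    isCompact_univ_pi fun _ => isCompact_univ_pi fun _ => isCompact_closedBall _ _
  refine IsCompact.of_isClosed_subset (s := Set.univ.pi fun _ : ι => Set.univ.pi fun _ : ι =>
      Metric.closedBall (0 : ℂ) 1) hK hcl ?_
  intro A hA
  simp only [Set.mem_pi, Set.mem_univ, forall_true_left, mem_closedBall_zero_iff]
  intro i j
  exact entry_norm_bound_of_unitary hA i j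

/-- Corner embedding along an isometry. -/
def stabM (P : Matrix κ ι ℂ) (A : Matrix ι ι ℂ) : Matrix κ κ ℂ := P * A * Pᴴ + (1 - P * Pᴴ)

lemma stabM_one (P : Matrix κ ι ℂ) : stabM P 1 = 1 := by simp [stabM]

lemma stabM_mul {P : Matrix κ ι ℂ} (hP : Pᴴ * P = 1) (A B : Matrix ι ι ℂ) :
    stabM P (A * B) = stabM P A * stabM P B := by
  have h1 : ∀ X : Matrix ι κ ℂ, Pᴴ * (P * X) = X := fun X => by
    rw [← Matrix.mul_assoc, hP, Matrix.one_mul]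
  simp only [stabM, Matrix.mul_add, Matrix.add_mul, Matrix.mul_sub, Matrix.sub_mul,
    Matrix.mul_one, Matrix.one_mul, Matrix.mul_assoc, h1]
  abel

lemma stabM_star (P : Matrix κ ι ℂ) (A : Matrix ι ι ℂ) : (stabM P A)ᴴ = stabM P Aᴴ := by
  simp [stabM, Matrix.mul_assoc]

lemma stabM_stabM (P : Matrix κ ι ℂ) (R : Matrix ι μ ℂ) (A : Matrix μ μ ℂ) :
    stabM P (stabM R A) = stabM (P * R) A := by
  simp only [stabM, Matrix.mul_add, Matrix.add_mul, Matrix.mul_sub, Matrix.sub_mul,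
    Matrix.mul_one, Matrix.one_mul, Matrix.mul_assoc, Matrix.conjTranspose_mul]
  abel

lemma stabM_conj (W : U κ) (P : Matrix κ ι ℂ) (A : Matrix ι ι ℂ) :
    stabM ((W : Matrix κ κ ℂ) * P) A = W * stabM P A * (W : Matrix κ κ ℂ)ᴴ := by
  have h1 := U_mul_star W
  simp only [stabM, Matrix.mul_add, Matrix.add_mul, Matrix.mul_sub, Matrix.sub_mul,
    Matrix.mul_one, Matrix.one_mul, Matrix.mul_assoc, Matrix.conjTranspose_mul, h1]

/-- Corner embedding as a homomorphism of unitary groups. -/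
def stab (P : Matrix κ ι ℂ) (hP : Pᴴ * P = 1) : U ι →* U κ where
  toFun A := ⟨stabM P A, mem_U (by
    rw [stabM_star, ← stabM_mul hP, U_star_mul, stabM_one])⟩
  map_one' := Subtype.ext (stabM_one P)
  map_mul' A B := Subtype.ext (stabM_mul hP A B)

@[simp] lemma stab_coe (P : Matrix κ ι ℂ) (hP : Pᴴ * P = 1) (A : U ι) :
    (stab P hP A : Matrix κ κ ℂ) = stabM P A := rfl

lemma continuous_stabM (P : Matrix κ ι ℂ) : Continuous (stabM P) := by
  unfold stabM; fun_prop

lemma continuous_stab (P : Matrix κ ι ℂ) (hP : Pᴴ * P = 1) : Continuous (stab P hP) :=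
  Continuous.subtype_mk ((continuous_stabM P).comp continuous_subtype_val) _

/-- The matrix of an embedding of index sets. -/
def embP (e : ι ↪ κ) : Matrix κ ι ℂ := (1 : Matrix κ κ ℂ).submatrix id e

lemma embP_apply (e : ι ↪ κ) (a : κ) (i : ι) : embP e a i = if a = e i then 1 else 0 := by
  simp [embP, Matrix.one_apply]

lemma embP_star_mul (e : ι ↪ κ) : (embP e)ᴴ * embP e = 1 := by
  ext i j
  simp [Matrix.mul_apply, embP_apply, Matrix.one_apply, apply_ite, eq_comm]

lemma embP_mul_star_apply (e : ι ↪ κ) (a b : κ) :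
    (embP e * (embP e)ᴴ) a b = if a = b ∧ a ∈ Set.range e then 1 else 0 := by
  simp only [Matrix.mul_apply, embP_apply, Matrix.conjTranspose_apply, apply_ite star, star_one,
    star_zero]
  by_cases ha : ∃ i, e i = a
  · obtain ⟨i, rfl⟩ := ha
    rw [Finset.sum_eq_single i]
    · simp [eq_comm]
    · intro j _ hj
      simp [e.injective.eq_iff, hj.symm]
    · simp
  · rw [Finset.sum_eq_zero, if_neg (by simpa using fun _ => by simpa using ha)]
    intro i _
    rw [if_neg (fun h => ha ⟨i, h.symm⟩)]; simp

lemma embP_trans (e : ι ↪ κ) (e' : κ ↪ μ) : embP (e.trans e') = embP e' * embP e := by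
  ext a i
  simp [Matrix.mul_apply, embP_apply]

/-- Stabilization along an embedding. -/
def stabE (e : ι ↪ κ) : U ι →* U κ := stab (embP e) (embP_star_mul e)

lemma continuous_stabE (e : ι ↪ κ) : Continuous (stabE e) := continuous_stab _ _

@[simp] lemma stabE_coe (e : ι ↪ κ) (A : U ι) : (stabE e A : Matrix κ κ ℂ) = stabM (embP e) A := rfl

lemma stabE_trans (e : ι ↪ κ) (e' : κ ↪ μ) (A : U ι) :
    stabE e' (stabE e A) = stabE (e.trans e') A := by
  apply Subtype.ext
  simp [stabM_stabM, embP_trans]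

/-- The unitaries supported on `s`. -/
def KK (s : Finset κ) : Subgroup (U κ) where
  carrier := {A | ∀ a, a ∉ s → (A : Matrix κ κ ℂ) *ᵥ Pi.single a 1 = Pi.single a 1}
  one_mem' := fun a _ => by rw [U_coe_one, Matrix.one_mulVec]
  mul_mem' := fun {A B} hA hB a ha => by
    rw [U_coe_mul, ← Matrix.mulVec_mulVec, hB a ha, hA a ha]
  inv_mem' := fun {A} hA a ha => by
    rw [U_coe_inv]
    conv_lhs => rw [← hA a ha]
    rw [Matrix.mulVec_mulVec, U_star_mul, Matrix.one_mulVec]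

lemma mem_KK {s : Finset κ} {A : U κ} : A ∈ KK s ↔
    ∀ a, a ∉ s → (A : Matrix κ κ ℂ) *ᵥ Pi.single a 1 = Pi.single a 1 := Iff.rfl

lemma KK_row {s : Finset κ} {A : U κ} (hA : A ∈ KK s) {a : κ} (ha : a ∉ s) (b : κ) :
    (A : Matrix κ κ ℂ) a b = if a = b then 1 else 0 := by
  have h := (KK s).inv_mem hA a ha
  have := congrFun h b
  rw [U_coe_inv] at this
  simp only [Matrix.mulVec_single_one, Matrix.col_apply, Matrix.conjTranspose_apply] at this
  rw [← star_star ((A : Matrix κ κ ℂ) a b), this]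
  by_cases h : a = b
  · subst h; simp
  · simp [h, Ne.symm h]

lemma KK_col {s : Finset κ} {A : U κ} (hA : A ∈ KK s) {a : κ} (ha : a ∉ s) (b : κ) :
    (A : Matrix κ κ ℂ) b a = if b = a then 1 else 0 := by
  have h := hA a ha
  have := congrFun h b
  simp only [Matrix.mulVec_single_one, Matrix.col_apply] at this
  rw [this]
  simp [Pi.single_apply]

end UBasic
end BottPf

namespace BottPf
set_option linter.unusedSectionVars false
set_option linter.unusedSimpArgs false
open scoped unitInterval Topology.Homotopy

/-! ### Compression of maps into unitary groups -/
section Compress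
variable {κ : Type} [Fintype κ] [DecidableEq κ]

/-- Reflection-type matrix taking the basis vector `c` to `v`. -/
noncomputable def reflM (c : κ) (v : κ → ℂ) : Matrix κ κ ℂ :=
  (1 - (1 + star (v c))⁻¹ • vecMulVec (v + Pi.single c 1) (star (v + Pi.single c 1))) *
    (1 - (2 : ℂ) • vecMulVec (Pi.single c 1) (star (Pi.single c 1)))

lemma refl2_sq (c : κ) : (1 - (2 : ℂ) • vecMulVec (Pi.single c 1) (star (Pi.single c 1)) :
    Matrix κ κ ℂ) * (1 - (2 : ℂ) • vecMulVec (Pi.single c 1) (star (Pi.single c 1))) = 1 := by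
  simp only [Matrix.mul_sub, Matrix.sub_mul, Matrix.one_mul, Matrix.mul_one, Matrix.smul_mul,
    Matrix.mul_smul, vecMulVec_mul_vecMulVec]
  have : star (Pi.single c (1:ℂ)) ⬝ᵥ (Pi.single c 1 : κ → ℂ) = 1 := by simp
  rw [this, one_smul]
  module

lemma refl2_star (c : κ) : (1 - (2 : ℂ) • vecMulVec (Pi.single c 1) (star (Pi.single c 1)) :
    Matrix κ κ ℂ)ᴴ = (1 - (2 : ℂ) • vecMulVec (Pi.single c 1) (star (Pi.single c 1))) := by
  simp [conjTranspose_vecMulVec]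

lemma reflM_unitary (c : κ) (v : κ → ℂ) (hv : star v ⬝ᵥ v = 1) (hc : v c ≠ -1) :
    reflM c v ∈ Matrix.unitaryGroup κ ℂ := by
  refine mul_mem (mem_U ?_) (mem_U ?_)
  · set w : κ → ℂ := v + Pi.single c 1 with hw
    have hww : star w ⬝ᵥ w = 2 + v c + star (v c) := by
      simp only [hw, star_add, add_dotProduct, dotProduct_add, hv]
      simp; ring
    have h1 : (1 + v c) ≠ 0 := fun h => hc (by linear_combination h)
    have h2 : (1 + star (v c)) ≠ 0 := fun h => h1 (by simpa using congrArg star h)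
    simp only [conjTranspose_sub, conjTranspose_one, conjTranspose_smul, conjTranspose_vecMulVec,
      star_star, Matrix.mul_sub, Matrix.sub_mul, Matrix.one_mul, Matrix.mul_one, Matrix.smul_mul,
      Matrix.mul_smul, vecMulVec_mul_vecMulVec, hww, star_inv₀, star_add, star_one]
    rw [vecMulVec_smul]
    have : (1 + v c)⁻¹ + (1 + star (v c))⁻¹ =
        ((1 + star (v c))⁻¹ * ((1 + v c)⁻¹ * (2 + v c + star (v c)))) := by
      field_simp; ring
    rw [smul_sub, smul_smul, smul_smul, mul_assoc, ← this]
    module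
  · rw [refl2_star, refl2_sq]

lemma reflM_mulVec (c : κ) (v : κ → ℂ) (hc : v c ≠ -1) :
    reflM c v *ᵥ Pi.single c 1 = v := by
  have h1 : (1 + v c) ≠ 0 := fun h => hc (by linear_combination h)
  have h2 : (1 + star (v c)) ≠ 0 := fun h => h1 (by simpa using congrArg star h)
  rw [reflM, ← Matrix.mulVec_mulVec]
  have e1 : (1 - (2 : ℂ) • vecMulVec (Pi.single c 1) (star (Pi.single c 1)) : Matrix κ κ ℂ) *ᵥ
      Pi.single c 1 = - Pi.single c 1 := by
    rw [Matrix.sub_mulVec, Matrix.one_mulVec, Matrix.smul_mulVec, vecMulVec_mulVec]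
    have : star (Pi.single c (1:ℂ)) ⬝ᵥ (Pi.single c 1 : κ → ℂ) = 1 := by simp
    rw [this]
    ext a; simp; ring
  rw [e1, Matrix.mulVec_neg, Matrix.sub_mulVec, Matrix.one_mulVec, Matrix.smul_mulVec,
    vecMulVec_mulVec]
  have : star (v + Pi.single c (1:ℂ)) ⬝ᵥ (Pi.single c 1 : κ → ℂ) = 1 + star (v c) := by
    simp [add_comm]
  rw [this]
  ext a
  simp only [Pi.neg_apply, Pi.sub_apply, Pi.smul_apply, Pi.add_apply, MulOpposite.smul_eq_mul_unop,
    MulOpposite.unop_op, smul_eq_mul]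
  field_simp
  ring

lemma reflM_single (c : κ) : reflM c (Pi.single c 1) = 1 := by
  rw [reflM]
  have : (1 + star ((Pi.single c 1 : κ → ℂ) c))⁻¹ •
      vecMulVec (Pi.single c 1 + Pi.single c 1 : κ → ℂ) (star (Pi.single c 1 + Pi.single c 1)) =
      (2 : ℂ) • vecMulVec (Pi.single c 1 : κ → ℂ) (star (Pi.single c 1)) := by
    ext a b
    simp [vecMulVec_apply]
    ring
  rw [this, refl2_sq]

lemma reflM_fix (c : κ) (v : κ → ℂ) (a : κ) (hac : a ≠ c) (hva : v a = 0) :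
    reflM c v *ᵥ Pi.single a 1 = Pi.single a 1 := by
  rw [reflM, ← Matrix.mulVec_mulVec]
  have e1 : (1 - (2 : ℂ) • vecMulVec (Pi.single c 1) (star (Pi.single c 1)) : Matrix κ κ ℂ) *ᵥ
      Pi.single a 1 = Pi.single a 1 := by
    rw [Matrix.sub_mulVec, Matrix.one_mulVec, Matrix.smul_mulVec, vecMulVec_mulVec]
    have : star (Pi.single c (1:ℂ)) ⬝ᵥ (Pi.single a 1 : κ → ℂ) = 0 := by simp [hac]
    rw [this]; simp
  rw [e1, Matrix.sub_mulVec, Matrix.one_mulVec, Matrix.smul_mulVec, vecMulVec_mulVec]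
  have : star (v + Pi.single c (1:ℂ)) ⬝ᵥ (Pi.single a 1 : κ → ℂ) = 0 := by
    simp [hac, hva]
  rw [this]; simp

lemma continuousOn_reflM (c : κ) : ContinuousOn (reflM c) {v | v c ≠ -1} := by
  unfold reflM
  have : ContinuousOn (fun v : κ → ℂ => (1 + star (v c))⁻¹) {v | v c ≠ -1} := by
    apply ContinuousOn.inv₀ (by fun_prop)
    intro v hv h
    apply hv
    have : 1 + v c = 0 := by simpa using congrArg star h
    linear_combination this
  refine ContinuousOn.mul ?_ continuousOn_const
  refine continuousOn_const.sub (this.smul ?_)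
  exact Continuous.continuousOn (by fun_prop)

/-- The local section of the sphere fibration. -/
noncomputable def reflS (c : κ) (v : κ → ℂ) : U κ :=
  open Classical in if h : reflM c v ∈ Matrix.unitaryGroup κ ℂ then ⟨reflM c v, h⟩ else 1

lemma star_dot_eq (v : κ → ℂ) : star v ⬝ᵥ v = ((∑ a, ‖v a‖ ^ 2 : ℝ) : ℂ) := by
  simp only [dotProduct, Pi.star_apply, Complex.star_def, Complex.conj_mul']
  push_cast; rfl

lemma compress {N : Type} [Fintype N] (c : κ) (s : Finset κ) (hcs : c ∉ s)
    (F : (N → I) → U κ) (hF : Continuous F) (hFK : ∀ y, F y ∈ KK (insert c s))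
    (hFb : ∀ y ∈ Cube.boundary N, F y ∈ KK s) (hd : Fintype.card N ≤ 2 * s.card) :
    ∃ H : (N → I) × I → U κ, Continuous H ∧ (∀ y, H (y, 0) = F y) ∧ (∀ y, H (y, 1) ∈ KK s) ∧
      (∀ y ∈ Cube.boundary N, ∀ t, H (y, t) = F y) := by
  let T : Finset κ := insert c s
  have hcT : c ∈ T := Finset.mem_insert_self _ _
  let v : (N → I) → κ → ℂ := fun y => (F y : Matrix κ κ ℂ) *ᵥ Pi.single c 1
  have hv : Continuous v := by
    have : Continuous fun y => (F y : Matrix κ κ ℂ) := continuous_subtype_val.comp hF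
    exact this.matrix_mulVec continuous_const
  have hv1 : ∀ y, star (v y) ⬝ᵥ v y = 1 := by
    intro y
    simp only [v]
    rw [star_mulVec, ← dotProduct_mulVec, mulVec_mulVec, U_star_mul, one_mulVec]
    simp
  have hv0 : ∀ y a, a ∉ T → v y a = 0 := by
    intro y a ha
    simp only [v, Matrix.mulVec_single_one, Matrix.col_apply]
    rw [KK_row (hFK y) ha, if_neg]
    rintro rfl; exact ha hcT
  have hvb : ∀ y ∈ Cube.boundary N, v y = Pi.single c 1 := fun y hy => hFb y hy c hcs
  -- pass to the small sphere
  let h : (N → I) → EuclideanSpace ℂ T := fun y => WithLp.toLp 2 (fun a => v y a)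
  have hh : Continuous h := (PiLp.continuous_toLp 2 _).comp (by fun_prop)
  have hsum : ∀ f : κ → ℝ, (∀ a, a ∉ T → f a = 0) → ∑ a : T, f a = ∑ a, f a := by
    intro f hf
    rw [Finset.sum_coe_sort T f]
    exact Finset.sum_subset (Finset.subset_univ _) (fun a _ ha => hf a ha)
  have hh1 : ∀ y, ‖h y‖ = 1 := by
    intro y
    rw [EuclideanSpace.norm_eq]
    have e := hv1 y
    rw [star_dot_eq] at e
    have e' : ∑ a, ‖v y a‖ ^ 2 = 1 := by exact_mod_cast e
    have := hsum (fun a => ‖v y a‖ ^ 2) (fun a ha => by simp [hv0 y a ha])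
    simp only [h]
    rw [this, e', Real.sqrt_one]
  let e0 : EuclideanSpace ℂ T := WithLp.toLp 2 (fun a => (Pi.single c 1 : κ → ℂ) a)
  have hhb : ∀ y ∈ Cube.boundary N, h y = e0 := fun y hy => by simp only [h, e0, hvb y hy]
  have he0 : ‖e0‖ = 1 := by
    rw [EuclideanSpace.norm_eq]
    have := hsum (fun a => ‖(Pi.single c 1 : κ → ℂ) a‖ ^ 2) (fun a ha => by
      have : a ≠ c := fun h => ha (h ▸ hcT)
      simp [this])
    simp only [e0]
    rw [this, Finset.sum_eq_single c] <;> simp +contextual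
  have hcard : T.card = s.card + 1 := Finset.card_insert_of_notMem hcs
  obtain ⟨Q, hQ, hQ1, hQ0, hQe, hQb⟩ := sphere_null h hh hh1 e0 he0 hhb (by
    rw [← Module.finrank_mul_finrank ℝ ℂ, Complex.finrank_real_complex, finrank_euclideanSpace,
      Fintype.card_coe, hcard]
    omega)
  let ext0 : EuclideanSpace ℂ T → κ → ℂ := fun w a => if ha : a ∈ T then w ⟨a, ha⟩ else 0
  have hext : Continuous ext0 := by
    refine continuous_pi fun a => ?_
    by_cases ha : a ∈ T
    · simp only [ext0, dif_pos ha]; fun_prop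
    · simp only [ext0, dif_neg ha]; fun_prop
  have hexth : ∀ y, ext0 (h y) = v y := by
    intro y; ext a
    by_cases ha : a ∈ T
    · simp [ext0, ha, h]
    · simp [ext0, ha, hv0 y a ha]
  have hexte : ext0 e0 = Pi.single c 1 := by
    ext a
    by_cases ha : a ∈ T
    · simp [ext0, ha, e0]
    · have : a ≠ c := fun h => ha (h ▸ hcT)
      simp [ext0, ha, this]
  have hextn : ∀ w, ‖w‖ = 1 → star (ext0 w) ⬝ᵥ ext0 w = 1 := by
    intro w hw
    rw [star_dot_eq]
    rw [← hsum (fun a => ‖ext0 w a‖ ^ 2) (fun a ha => by simp [ext0, ha])]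
    have : ∑ a : T, ‖ext0 w a‖ ^ 2 = ‖w‖ ^ 2 := by
      rw [EuclideanSpace.norm_sq_eq]
      refine Finset.sum_congr rfl fun a _ => ?_
      simp [ext0]
    rw [this, hw]; simp
  let O : Set (κ → ℂ) := {v | star v ⬝ᵥ v = 1 ∧ ∀ a, a ∉ T → v a = 0}
  let V : Set (κ → ℂ) := {v | v c ≠ -1}
  have hS : ∀ v ∈ V ∩ O, (reflS c v : Matrix κ κ ℂ) = reflM c v := by
    intro v hv
    rw [reflS, dif_pos (reflM_unitary c v hv.2.1 hv.1)]
  obtain ⟨F', h1, h2, h3, h4, h5⟩ := HLP (G := U κ) (B := κ → ℂ) (Y := N → I)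
    (fun A v => (A : Matrix κ κ ℂ) *ᵥ v)
    (by
      have : Continuous fun p : U κ × (κ → ℂ) => (p.1 : Matrix κ κ ℂ) :=
        continuous_subtype_val.comp continuous_fst
      exact this.matrix_mulVec continuous_snd)
    (fun v => by simp) (fun A B v => by simp [Matrix.mulVec_mulVec])
    (Pi.single c 1) V O
    (isOpen_ne.preimage (continuous_apply c))
    (by
      simp only [V, Set.mem_ofPred_eq, Pi.single_eq_same]
      norm_num [Complex.ext_iff])
    (reflS c)
    (by
      rw [Topology.IsInducing.subtypeVal.continuousOn_iff]
      refine ContinuousOn.congr ((continuousOn_reflM c).mono Set.inter_subset_left) ?_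
      intro v hv; exact hS v hv)
    (by
      apply Subtype.ext
      rw [reflS, dif_pos (by rw [reflM_single]; exact one_mem _)]
      exact reflM_single c)
    (fun v hv => by
      rw [hS v hv, reflM_mulVec c v hv.1])
    (KK T)
    (fun v hv a ha => by
      rw [hS v hv]
      exact reflM_fix c v a (fun h => ha (h ▸ hcT)) (hv.2.2 a ha))
    (fun A hA v hv => by
      refine ⟨?_, fun a ha => ?_⟩
      · rw [star_mulVec, ← dotProduct_mulVec, mulVec_mulVec, U_star_mul, one_mulVec]
        exact hv.1
      · simp only [Matrix.mulVec, dotProduct, KK_row hA ha]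
        simp [hv.2 a ha])
    F hF hFK (fun p => ext0 (Q p)) (hext.comp hQ)
    (fun p => ⟨hextn _ (hQ1 p), fun a ha => by simp [ext0, ha]⟩)
    (fun y => by simp only [hQ0, hexth, v])
  refine ⟨F', h1, h2, ?_, ?_⟩
  · intro y a ha
    by_cases hac : a = c
    · subst hac
      have := h3 (y, 1)
      simp only [hQe, hexte] at this
      exact this
    · exact h4 (y, 1) a (by simp [T, hac, ha])
  · intro y hy t
    apply h5
    intro t
    simp only [hQb y hy]

end Compress
end BottPf

namespace BottPf
set_option linter.unusedSectionVars false
set_option linter.unusedSimpArgs false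
open scoped unitInterval Topology.Homotopy

/-! ### Stability -/
section Stability
variable {ι κ μ : Type} [Fintype ι] [DecidableEq ι] [Fintype κ] [DecidableEq κ]
  [Fintype μ] [DecidableEq μ]

lemma compress_all {N : Type} [Fintype N] (s : Finset κ) (hd : Fintype.card N ≤ 2 * s.card)
    (r : Finset κ) :
    ∀ (F : C(N → I, U κ)), (∀ y, F y ∈ KK (r ∪ s)) →
    (∀ y ∈ Cube.boundary N, F y ∈ KK s) →
    ∃ F' : C(N → I, U κ), (∀ y, F' y ∈ KK s) ∧ F.HomotopicRel F' (Cube.boundary N) := by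
  induction r using Finset.induction_on with
  | empty =>
    intro F hF _
    exact ⟨F, fun y => by simpa using hF y, ContinuousMap.HomotopicRel.refl _⟩
  | insert c r hc ih =>
    intro F hF hb
    by_cases hcs : c ∈ r ∪ s
    · refine ih F (fun y => ?_) hb
      have := hF y
      rwa [Finset.insert_union, Finset.insert_eq_of_mem hcs] at this
    · have hmono : KK s ≤ KK (r ∪ s) := fun A hA a ha => hA a (fun h => ha (by simp [h]))
      obtain ⟨H, h1, h2, h3, h4⟩ := compress c (r ∪ s) hcs F F.continuous
        (fun y => by rw [← Finset.insert_union]; exact hF y) (fun y hy => hmono (hb y hy))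
        (hd.trans (by gcongr; exact Finset.subset_union_right))
      let F1 : C(N → I, U κ) := ⟨fun y => H (y, 1), by fun_prop⟩
      have hF1 : F.HomotopicRel F1 (Cube.boundary N) :=
        ⟨{ toFun := fun p => H (p.2, p.1)
           continuous_toFun := by fun_prop
           map_zero_left := h2
           map_one_left := fun y => rfl
           prop' := fun t y hy => h4 y hy t }⟩
      obtain ⟨F', h5, h6⟩ := ih F1 h3 (fun y hy => by
        have : F1 y = F y := h4 y hy 1
        rw [this]; exact hb y hy)
      exact ⟨F', h5, hF1.trans h6⟩

lemma compress_univ {N : Type} [Fintype N] (s : Finset κ) (hd : Fintype.card N ≤ 2 * s.card)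
    (F : C(N → I, U κ)) (hb : ∀ y ∈ Cube.boundary N, F y ∈ KK s) :
    ∃ F' : C(N → I, U κ), (∀ y, F' y ∈ KK s) ∧ F.HomotopicRel F' (Cube.boundary N) :=
  compress_all s hd Finset.univ F (fun y a ha => absurd (by simp) ha) hb

instance instPathConnU : PathConnectedSpace (U κ) := by
  have key : ∀ A : U κ, Joined A 1 := by
    intro A
    obtain ⟨F', h1, ⟨H⟩⟩ := compress_univ (N := Fin 0) (κ := κ) ∅ (by simp)
      (ContinuousMap.const _ A) (fun y ⟨i, _⟩ => i.elim0)
    have h2 : F' 0 = 1 := by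
      apply Subtype.ext
      ext a b
      rw [KK_row (h1 0) (by simp), U_coe_one, Matrix.one_apply]
    exact ⟨{ toFun := fun t => H (t, 0)
             source' := by simp
             target' := (H.apply_one 0).trans h2 }⟩
  exact ⟨⟨1⟩, fun A B => (key A).trans (key B).symm⟩

/-- Image of an embedding. -/
def rangeF (e : ι ↪ κ) : Finset κ := Finset.univ.map e

lemma rangeF_card (e : ι ↪ κ) : (rangeF e).card = Fintype.card ι := by simp [rangeF]

lemma stabE_mem (e : ι ↪ κ) (A : U ι) : stabE e A ∈ KK (rangeF e) := by
  intro a ha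
  rw [stabE_coe, stabM, Matrix.add_mulVec, Matrix.sub_mulVec, Matrix.one_mulVec]
  have : (embP e)ᴴ *ᵥ Pi.single a 1 = 0 := by
    ext i
    simp only [mulVec_single_one, col_apply, conjTranspose_apply, embP_apply, Pi.zero_apply]
    rw [if_neg, star_zero]
    rintro rfl
    exact ha (by simp [rangeF])
  simp only [← Matrix.mulVec_mulVec, this, Matrix.mulVec_zero, sub_zero, zero_add]

lemma KK_mul_compl (e : ι ↪ κ) {A : U κ} (hA : A ∈ KK (rangeF e)) :
    (A : Matrix κ κ ℂ) * (1 - embP e * (embP e)ᴴ) = 1 - embP e * (embP e)ᴴ := by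
  have hdiag : (1 - embP e * (embP e)ᴴ) =
      Matrix.diagonal (fun a => if a ∈ Set.range e then (0:ℂ) else 1) := by
    ext a b
    rw [Matrix.sub_apply, embP_mul_star_apply, Matrix.one_apply, Matrix.diagonal_apply]
    by_cases hab : a = b <;> by_cases h : a ∈ Set.range e <;> simp [hab, h] <;> simp_all
  rw [hdiag]
  ext a b
  rw [Matrix.mul_diagonal, Matrix.diagonal_apply]
  by_cases hb : b ∈ Set.range e
  · simp only [hb, if_true, mul_zero]
    split_ifs <;> simp_all
  · rw [KK_col hA (by simpa [rangeF] using hb)]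
    by_cases hab : a = b
    · subst hab; simp [hb]
    · simp [hab]

/-- Restriction to a corner. -/
noncomputable def resE (e : ι ↪ κ) (A : U κ) : U ι :=
  open Classical in
  if h : (embP e)ᴴ * (A : Matrix κ κ ℂ) * embP e ∈ Matrix.unitaryGroup ι ℂ then ⟨_, h⟩ else 1

lemma resE_mem (e : ι ↪ κ) {A : U κ} (hA : A ∈ KK (rangeF e)) :
    (embP e)ᴴ * (A : Matrix κ κ ℂ) * embP e ∈ Matrix.unitaryGroup ι ℂ := by
  apply mem_U
  have h1 := KK_mul_compl e ((KK _).inv_mem hA)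
  rw [U_coe_inv] at h1
  have hP := embP_star_mul e
  have h2 : (A : Matrix κ κ ℂ)ᴴ * (embP e * (embP e)ᴴ) =
      (A : Matrix κ κ ℂ)ᴴ - (1 - embP e * (embP e)ᴴ) := by
    rw [← h1]; simp only [Matrix.mul_sub, Matrix.mul_one]; abel
  calc ((embP e)ᴴ * (A : Matrix κ κ ℂ) * embP e)ᴴ * ((embP e)ᴴ * (A : Matrix κ κ ℂ) * embP e)
      = (embP e)ᴴ * ((A : Matrix κ κ ℂ)ᴴ * (embP e * (embP e)ᴴ)) * (A : Matrix κ κ ℂ) * embP e := by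
        simp only [conjTranspose_mul, conjTranspose_conjTranspose, Matrix.mul_assoc]
    _ = (embP e)ᴴ * ((A : Matrix κ κ ℂ)ᴴ * (A : Matrix κ κ ℂ)) * embP e -
        ((embP e)ᴴ - (embP e)ᴴ * embP e * (embP e)ᴴ) * (A : Matrix κ κ ℂ) * embP e := by
        rw [h2]; simp only [Matrix.mul_sub, Matrix.sub_mul, Matrix.mul_assoc, Matrix.mul_one,
          Matrix.one_mul]
    _ = 1 := by rw [U_star_mul, hP]; simp [hP]

lemma resE_coe (e : ι ↪ κ) {A : U κ} (hA : A ∈ KK (rangeF e)) :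
    (resE e A : Matrix ι ι ℂ) = (embP e)ᴴ * (A : Matrix κ κ ℂ) * embP e := by
  rw [resE, dif_pos (resE_mem e hA)]

lemma stabE_resE (e : ι ↪ κ) {A : U κ} (hA : A ∈ KK (rangeF e)) : stabE e (resE e A) = A := by
  apply Subtype.ext
  rw [stabE_coe, resE_coe e hA, stabM]
  have h1 := KK_mul_compl e hA
  have h2 := KK_mul_compl e ((KK _).inv_mem hA)
  have h3 := congrArg conjTranspose h2
  rw [U_coe_inv] at h3
  simp only [conjTranspose_mul, conjTranspose_sub, conjTranspose_one,
    conjTranspose_conjTranspose] at h3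
  set R := embP e * (embP e)ᴴ with hR
  have : embP e * ((embP e)ᴴ * (A : Matrix κ κ ℂ) * embP e) * (embP e)ᴴ = R * ((A : Matrix κ κ ℂ) * R) := by
    simp only [hR, Matrix.mul_assoc]
  rw [this]
  have hRR : R * R = R := by
    rw [hR]
    calc _ = embP e * ((embP e)ᴴ * embP e) * (embP e)ᴴ := by simp only [Matrix.mul_assoc]
      _ = _ := by rw [embP_star_mul, Matrix.mul_one]
  have h4 : (A : Matrix κ κ ℂ) * R = A - (1 - R) := by
    rw [← h1]; simp only [Matrix.mul_sub, Matrix.mul_one]; abel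
  have h5 : R * (A : Matrix κ κ ℂ) = A - (1 - R) := by
    rw [← h3]; simp only [Matrix.sub_mul, Matrix.one_mul]; abel
  rw [h4, Matrix.mul_sub, Matrix.mul_sub, hRR, h5]
  simp

lemma resE_stabE (e : ι ↪ κ) (A : U ι) : resE e (stabE e A) = A := by
  apply Subtype.ext
  rw [resE_coe e (stabE_mem e A), stabE_coe, stabM]
  have hP := embP_star_mul e
  have h1 : ∀ X : Matrix ι ι ℂ, (embP e)ᴴ * (embP e * X) = X := fun X => by
    rw [← Matrix.mul_assoc, hP, Matrix.one_mul]
  simp only [Matrix.mul_add, Matrix.add_mul, Matrix.mul_sub, Matrix.sub_mul, Matrix.mul_assoc, hP,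
    Matrix.mul_one, h1, Matrix.one_mul]
  simp

lemma resE_continuous {Y : Type} [TopologicalSpace Y] (e : ι ↪ κ) (F : Y → U κ) (hF : Continuous F)
    (h : ∀ y, F y ∈ KK (rangeF e)) : Continuous (fun y => resE e (F y)) := by
  rw [Topology.IsInducing.subtypeVal.continuous_iff]
  have h1 : Continuous fun y => (F y : Matrix κ κ ℂ) := continuous_subtype_val.comp hF
  have h2 : Continuous fun y => (embP e)ᴴ * (F y : Matrix κ κ ℂ) * embP e := by fun_prop
  exact h2.congr (fun y => (resE_coe e (h y)).symm)

/-- Stabilization of loops. -/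
noncomputable def stabL {N : Type} (e : ι ↪ κ) : Ω^ N (U ι) (1 : U ι) →* Ω^ N (U κ) (1 : U κ) :=
  homL (stabE e) (continuous_stabE e)

@[simp] lemma stabL_apply {N : Type} (e : ι ↪ κ) (f : Ω^ N (U ι) (1 : U ι)) (t) :
    stabL e f t = stabE e (f t) := rfl

theorem stab_surj {N : Type} [Fintype N] (e : ι ↪ κ) (hd : Fintype.card N ≤ 2 * Fintype.card ι)
    (f : Ω^ N (U κ) (1 : U κ)) :
    ∃ f' : Ω^ N (U ι) (1 : U ι), GenLoop.Homotopic f (stabL e f') := by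
  obtain ⟨F, h1, h2⟩ := compress_univ (rangeF e) (by rwa [rangeF_card]) f.1
    (fun y hy => by rw [f.2 y hy]; exact one_mem _)
  have hb : ∀ y ∈ Cube.boundary N, F y = 1 := by
    intro y hy
    obtain ⟨H⟩ := h2
    rw [← H.apply_one, H.eq_fst 1 hy]; exact f.2 y hy
  refine ⟨mkL (fun y => resE e (F y)) (resE_continuous e F F.continuous h1) (fun y hy => by
    rw [hb y hy, ← map_one (stabE e), resE_stabE]), ?_⟩
  have : stabL e (mkL (fun y => resE e (F y)) (resE_continuous e F F.continuous h1) (fun y hy => by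
    rw [hb y hy, ← map_one (stabE e), resE_stabE])) = (⟨F, hb⟩ : Ω^ N (U κ) (1 : U κ)) := by
    ext1 y
    exact stabE_resE e (h1 y)
  rw [this]
  exact h2

theorem stab_inj {N : Type} [Fintype N] (e : ι ↪ κ)
    (hd : Fintype.card N + 1 ≤ 2 * Fintype.card ι)
    (f : Ω^ N (U ι) (1 : U ι)) (h : GenLoop.Homotopic (stabL e f) 1) : GenLoop.Homotopic f 1 := by
  obtain ⟨H, hc, h0, h1, hb⟩ := exH h
  let G : C(Option N → I, U κ) := ⟨fun z => H (z none, fun i => z (some i)), by fun_prop⟩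
  have hGb : ∀ z ∈ Cube.boundary (Option N), G z ∈ KK (rangeF e) := by
    rintro z ⟨j, hj⟩
    rcases j with _ | i
    · rcases hj with hj | hj
      · simp only [G, ContinuousMap.coe_mk, hj, h0]; exact stabE_mem e _
      · simp only [G, ContinuousMap.coe_mk, hj, h1]; exact one_mem _
    · simp only [G, ContinuousMap.coe_mk]
      rw [hb _ _ ⟨i, hj⟩]; exact one_mem _
  obtain ⟨F, hF1, ⟨R⟩⟩ := compress_univ (rangeF e) (by rw [rangeF_card]; simpa using hd) G hGb
  have hFG : ∀ z ∈ Cube.boundary (Option N), F z = G z := fun z hz => by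
    rw [← R.apply_one, R.eq_fst 1 hz]
  let j : I × (N → I) → (Option N → I) := fun p o => o.elim p.1 p.2
  have hj : Continuous j := by
    refine continuous_pi fun o => ?_
    rcases o with _ | i
    · exact continuous_fst
    · exact (continuous_apply i).comp continuous_snd
  refine mkH (fun p => resE e (F (j p))) ?_ ?_ ?_ ?_
  · exact resE_continuous e (fun p => F (j p)) (F.continuous.comp hj) (fun _ => hF1 _)
  · intro y
    have : F (j (0, y)) = stabE e (f y) := by
      rw [hFG _ ⟨none, Or.inl rfl⟩]
      exact h0 y
    simp only [this, resE_stabE]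
  · intro y
    have : F (j (1, y)) = 1 := by
      rw [hFG _ ⟨none, Or.inr rfl⟩]
      exact h1 y
    simp only [this, oneL_apply]
    rw [← map_one (stabE e), resE_stabE]
  · rintro t y ⟨i, hi⟩
    have : F (j (t, y)) = 1 := by
      rw [hFG _ ⟨some i, hi⟩]
      exact hb t y ⟨i, hi⟩
    simp only [this]
    rw [← map_one (stabE e), resE_stabE]

/-- Permutation matrices as unitaries. -/
lemma embP_perm (e e' : ι ↪ κ) : ∃ W : U κ, embP e' = (W : Matrix κ κ ℂ) * embP e := by
  obtain ⟨p, hp⟩ : ∃ p : Equiv.Perm κ, ∀ i, p (e i) = e' i := by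
    let E : {a // a ∈ Set.range e} ≃ {a // a ∈ Set.range e'} :=
      (Equiv.ofInjective e e.injective).symm.trans (Equiv.ofInjective e' e'.injective)
    refine ⟨E.extendSubtype, fun i => ?_⟩
    rw [Equiv.extendSubtype_apply_of_mem E (e i) ⟨i, rfl⟩]
    have : (Equiv.ofInjective e e.injective).symm ⟨e i, ⟨i, rfl⟩⟩ = i :=
      Equiv.ofInjective_symm_apply e.injective i
    simp only [E, Equiv.trans_apply, this]
    rfl
  have hp' : e' = e.trans p.toEmbedding := by ext i; simp [hp]
  refine ⟨⟨embP p.toEmbedding, mem_U (embP_star_mul _)⟩, ?_⟩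
  rw [hp', embP_trans]

lemma stabL_indep {N : Type} (e e' : ι ↪ κ) (f : Ω^ N (U ι) (1 : U ι)) :
    GenLoop.Homotopic (stabL e f) (stabL e' f) := by
  obtain ⟨W, hW⟩ := embP_perm e e'
  refine conj_homotopic W _ _ (fun t => ?_)
  apply Subtype.ext
  simp only [stabL_apply, stabE_coe, U_coe_mul, U_coe_inv, hW, stabM_conj]

lemma stabL_trans {N : Type} (e : ι ↪ κ) (e' : κ ↪ μ) (f : Ω^ N (U ι) (1 : U ι)) :
    stabL e' (stabL e f) = stabL (e.trans e') f := by
  ext1 t; simp [stabE_trans]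

lemma stabL_homotopic {N : Type} (e : ι ↪ κ) {f g : Ω^ N (U ι) (1 : U ι)}
    (h : GenLoop.Homotopic f g) : GenLoop.Homotopic (stabL e f) (stabL e g) :=
  homL_homotopic _ _ h

end Stability
end BottPf

namespace BottPf
set_option linter.unusedSectionVars false
set_option linter.unusedSimpArgs false
open scoped unitInterval Topology.Homotopy

/-! ### Polar decomposition -/
section Polar
open scoped Matrix.Norms.L2Operator MatrixOrder ComplexOrder
variable {ι κ : Type} [Fintype ι] [DecidableEq ι] [Fintype κ] [DecidableEq κ]

lemma sqrt_continuous {Y : Type} [TopologicalSpace Y] (F : Y → Matrix ι ι ℂ) (hF : Continuous F)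
    (h : ∀ y, (F y).PosSemidef) : Continuous (fun y => CFC.sqrt (F y)) := by
  have h1 : ∀ y, (0 : Matrix ι ι ℂ) ≤ F y := fun y => (h y).nonneg
  have : Continuous (fun y => cfc NNReal.sqrt (F y)) :=
    Continuous.cfc_nnreal_of_mem_nhdsSet (s := Set.univ) NNReal.sqrt (by simp) hF
      h1 (NNReal.continuous_sqrt.continuousOn)
  exact this.congr (fun y => (CFC.sqrt_eq_cfc).symm)

/-- Positive part of the polar decomposition. -/
noncomputable def posP (A : Matrix ι ι ℂ) : Matrix ι ι ℂ := CFC.sqrt (Aᴴ * A)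

lemma posP_posDef {A : Matrix ι ι ℂ} (hA : IsUnit A) : (posP A).PosDef := by
  have h1 : (posP A).PosSemidef := by
    rw [← nonneg_iff_posSemidef]; exact CFC.sqrt_nonneg _
  rw [h1.posDef_iff_isUnit, posP, CFC.isUnit_sqrt_iff _
    (posSemidef_conjTranspose_mul_self A).nonneg]
  exact (hA.star).mul hA

lemma posP_mul_self (A : Matrix ι ι ℂ) : posP A * posP A = Aᴴ * A :=
  CFC.sqrt_mul_sqrt_self _ (posSemidef_conjTranspose_mul_self A).nonneg

lemma polM_mem {A : Matrix ι ι ℂ} (hA : IsUnit A) : A * (posP A)⁻¹ ∈ Matrix.unitaryGroup ι ℂ := by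
  apply mem_U
  have h := posP_posDef hA
  have hu : IsUnit (posP A).det := (Matrix.isUnit_iff_isUnit_det _).1 h.isUnit
  rw [conjTranspose_mul, conjTranspose_nonsing_inv, h.isHermitian.eq]
  calc _ = (posP A)⁻¹ * (Aᴴ * A) * (posP A)⁻¹ := by simp only [Matrix.mul_assoc]
    _ = ((posP A)⁻¹ * posP A) * (posP A * (posP A)⁻¹) := by
        rw [← posP_mul_self]; simp only [Matrix.mul_assoc]
    _ = 1 := by rw [Matrix.nonsing_inv_mul _ hu, Matrix.mul_nonsing_inv _ hu, Matrix.one_mul]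

/-- Unitary part of the polar decomposition. -/
noncomputable def pol (A : Matrix ι ι ℂ) : U ι :=
  open Classical in
  if h : IsUnit A then ⟨A * (posP A)⁻¹, polM_mem h⟩ else 1

lemma pol_coe {A : Matrix ι ι ℂ} (hA : IsUnit A) : (pol A : Matrix ι ι ℂ) = A * (posP A)⁻¹ := by
  rw [pol, dif_pos hA]

lemma pol_mul_posP {A : Matrix ι ι ℂ} (hA : IsUnit A) : (pol A : Matrix ι ι ℂ) * posP A = A := by
  have hu : IsUnit (posP A).det := (Matrix.isUnit_iff_isUnit_det _).1 (posP_posDef hA).isUnit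
  rw [pol_coe hA, Matrix.mul_assoc, Matrix.nonsing_inv_mul _ hu, Matrix.mul_one]

lemma pol_continuous {Y : Type} [TopologicalSpace Y] (F : Y → Matrix ι ι ℂ) (hF : Continuous F)
    (h : ∀ y, IsUnit (F y)) : Continuous (fun y => pol (F y)) := by
  rw [Topology.IsInducing.subtypeVal.continuous_iff]
  have h1 : Continuous fun y => posP (F y) :=
    sqrt_continuous _ (by fun_prop) (fun y => posSemidef_conjTranspose_mul_self _)
  have h2 : Continuous fun y => (posP (F y))⁻¹ := by
    have : ∀ y, (posP (F y)).det ≠ 0 := fun y => (posP_posDef (h y)).det_pos.ne'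
    simp only [Matrix.inv_def, Ring.inverse_eq_inv']
    have h4 : Continuous fun y => (posP (F y)).det⁻¹ := Continuous.inv₀ h1.matrix_det this
    exact h4.smul h1.matrix_adjugate
  have h3 : Continuous fun y => F y * (posP (F y))⁻¹ := by fun_prop
  exact h3.congr (fun y => (pol_coe (h y)).symm)

lemma U_isUnit (W : U ι) : IsUnit (W : Matrix ι ι ℂ) := 
  (Matrix.isUnit_iff_isUnit_det _).2 (UnitaryGroup.det_isUnit W)

lemma pol_eq {A P : Matrix ι ι ℂ} (W : U ι) (hP : P.PosDef) (h : A = (W : Matrix ι ι ℂ) * P) :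
    pol A = W := by
  have hA : IsUnit A := by rw [h]; exact (U_isUnit W).mul hP.isUnit
  have : posP A = P := by
    apply CFC.sqrt_unique _ hP.posSemidef.nonneg
    rw [h, conjTranspose_mul, hP.isHermitian.eq]
    calc P * P = P * ((W : Matrix ι ι ℂ)ᴴ * (W : Matrix ι ι ℂ)) * P := by
          rw [U_star_mul, Matrix.mul_one]
      _ = _ := by simp only [Matrix.mul_assoc]
  apply Subtype.ext
  have hu : IsUnit P.det := (Matrix.isUnit_iff_isUnit_det _).1 hP.isUnit
  rw [pol_coe hA, this, h, Matrix.mul_assoc, Matrix.mul_nonsing_inv _ hu, Matrix.mul_one]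

@[simp] lemma pol_U (W : U ι) : pol (W : Matrix ι ι ℂ) = W :=
  pol_eq W PosDef.one (by rw [Matrix.mul_one])

lemma pol_mul_left {A : Matrix ι ι ℂ} (hA : IsUnit A) (W : U ι) :
    pol ((W : Matrix ι ι ℂ) * A) = W * pol A := by
  apply pol_eq _ (posP_posDef hA)
  rw [U_coe_mul, Matrix.mul_assoc, pol_mul_posP hA]

lemma pol_mul_right {A : Matrix ι ι ℂ} (hA : IsUnit A) (W : U ι) :
    pol (A * (W : Matrix ι ι ℂ)) = pol A * W := by
  have h2 : Function.Injective (fun x : ι → ℂ => (W : Matrix ι ι ℂ) *ᵥ x) :=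
    Matrix.mulVec_injective_of_isUnit (U_isUnit W)
  apply pol_eq (P := (W : Matrix ι ι ℂ)ᴴ * posP A * (W : Matrix ι ι ℂ)) _
  · exact (posP_posDef hA).conjTranspose_mul_mul_same h2
  rw [U_coe_mul]
  calc A * (W : Matrix ι ι ℂ) = (pol A : Matrix ι ι ℂ) * posP A * (W : Matrix ι ι ℂ) := by
        rw [pol_mul_posP hA]
    _ = (pol A : Matrix ι ι ℂ) * ((W : Matrix ι ι ℂ) * (W : Matrix ι ι ℂ)ᴴ) * posP A * (W : Matrix ι ι ℂ) := by
        rw [U_mul_star, Matrix.mul_one]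
    _ = _ := by simp only [Matrix.mul_assoc]

lemma kron_mem (A : U ι) (B : U κ) :
    (A : Matrix ι ι ℂ) ⊗ₖ (B : Matrix κ κ ℂ) ∈ Matrix.unitaryGroup (ι × κ) ℂ := by
  apply mem_U
  rw [conjTranspose_kronecker, ← mul_kronecker_mul, U_star_mul, U_star_mul, one_kronecker_one]

/-- Kronecker product of unitaries. -/
noncomputable def kronU (A : U ι) (B : U κ) : U (ι × κ) := ⟨_, kron_mem A B⟩

lemma kronU_coe (A : U ι) (B : U κ) :
    (kronU A B : Matrix (ι × κ) (ι × κ) ℂ) = (A : Matrix ι ι ℂ) ⊗ₖ (B : Matrix κ κ ℂ) := rfl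

lemma pol_kron {A : Matrix ι ι ℂ} {B : Matrix κ κ ℂ} (hA : IsUnit A) (hB : IsUnit B) :
    pol (A ⊗ₖ B) = kronU (pol A) (pol B) := by
  apply pol_eq _ ((posP_posDef hA).kronecker (posP_posDef hB))
  rw [kronU_coe, ← mul_kronecker_mul, pol_mul_posP hA, pol_mul_posP hB]

lemma U_norm_le (W : U ι) : ‖(W : Matrix ι ι ℂ)‖ ≤ 1 := by
  have h := l2_opNorm_conjTranspose_mul_self (W : Matrix ι ι ℂ)
  rw [U_star_mul] at h
  have h1 : ‖(1 : Matrix ι ι ℂ)‖ ≤ 1 := by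
    rw [← diagonal_one, l2_opNorm_diagonal]
    exact (pi_norm_le_iff_of_nonneg zero_le_one).2 (fun i => by simp)
  nlinarith [norm_nonneg (W : Matrix ι ι ℂ)]

lemma isUnit_of_close {A : Matrix ι ι ℂ} (W : U ι) (h : ‖A - (W : Matrix ι ι ℂ)‖ < 1) :
    IsUnit A := by
  have h1 : ‖(1 : Matrix ι ι ℂ) - ((W⁻¹ : U ι) : Matrix ι ι ℂ) * A‖ < 1 := by
    calc _ = ‖((W⁻¹ : U ι) : Matrix ι ι ℂ) * ((W : Matrix ι ι ℂ) - A)‖ := by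
          rw [Matrix.mul_sub, ← U_coe_mul, inv_mul_cancel, U_coe_one]
      _ ≤ ‖((W⁻¹ : U ι) : Matrix ι ι ℂ)‖ * ‖(W : Matrix ι ι ℂ) - A‖ := norm_mul_le _ _
      _ ≤ 1 * ‖(W : Matrix ι ι ℂ) - A‖ := by gcongr; exact U_norm_le _
      _ < 1 := by rwa [one_mul, norm_sub_rev]
  have h2 : IsUnit (((W⁻¹ : U ι) : Matrix ι ι ℂ) * A) := by
    have := isUnit_one_sub_of_norm_lt_one h1
    simpa using this
  have h3 := (U_isUnit W).mul h2
  rwa [← Matrix.mul_assoc, ← U_coe_mul, mul_inv_cancel, U_coe_one, Matrix.one_mul] at h3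

/-- Polar part of a matrix family close to a unitary loop. -/
lemma pol_homotopic {N : Type} {F : (N → I) → Matrix ι ι ℂ} (hF : Continuous F)
    (g f : Ω^ N (U ι) (1 : U ι)) (hf : ∀ y, f y = pol (F y)) 
    (h : ∀ y, ‖F y - (g y : Matrix ι ι ℂ)‖ < 1)
    (hb : ∀ y ∈ Cube.boundary N, F y = 1) :
    GenLoop.Homotopic f g := by
  have hg : Continuous fun y => (g y : Matrix ι ι ℂ) := continuous_subtype_val.comp (contL g)
  have hu : ∀ p : I × (N → I), IsUnit ((1 - (p.1 : ℝ)) • F p.2 + (p.1 : ℝ) • (g p.2 : Matrix ι ι ℂ)) := by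
    intro p
    apply isUnit_of_close (g p.2)
    have : (1 - (p.1 : ℝ)) • F p.2 + (p.1 : ℝ) • (g p.2 : Matrix ι ι ℂ) - (g p.2 : Matrix ι ι ℂ) =
        (1 - (p.1 : ℝ)) • (F p.2 - (g p.2 : Matrix ι ι ℂ)) := by module
    rw [this, norm_smul, Real.norm_of_nonneg (by linarith [p.1.2.2])]
    calc _ ≤ 1 * ‖F p.2 - (g p.2 : Matrix ι ι ℂ)‖ := by gcongr; linarith [p.1.2.1]
      _ < 1 := by rw [one_mul]; exact h _
  refine mkH (fun p => pol ((1 - (p.1 : ℝ)) • F p.2 + (p.1 : ℝ) • (g p.2 : Matrix ι ι ℂ))) ?_ ?_ ?_ ?_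
  · exact pol_continuous _ (by fun_prop) hu
  · intro y; simp [hf]
  · intro y; simp
  · intro t y hy
    have h1 : g y = 1 := GenLoop.boundary g y hy
    simp only [hb y hy, h1, U_coe_one]
    rw [← add_smul]; simp only [sub_add_cancel, one_smul]
    exact pol_U 1

lemma close_homotopic {N : Type} (f g : Ω^ N (U ι) (1 : U ι)) 
    (h : ∀ y, ‖(f y : Matrix ι ι ℂ) - (g y : Matrix ι ι ℂ)‖ < 1) :
    GenLoop.Homotopic f g :=
  pol_homotopic (F := fun y => (f y : Matrix ι ι ℂ)) (continuous_subtype_val.comp (contL f)) g f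
    (fun y => (pol_U _).symm) h (fun y hy => by rw [GenLoop.boundary f y hy, U_coe_one])

end Polar
end BottPf

namespace BottPf
set_option linter.unusedSectionVars false
set_option linter.unusedSimpArgs false
open scoped unitInterval Topology.Homotopy

/-! ### Swapping pairs of coordinates -/
section Swap
variable {N M X : Type} [TopologicalSpace X] {x : X}

/-- Clamp a real to the unit interval. -/
noncomputable def clampI (r : ℝ) : I := Set.projIcc (0:ℝ) 1 zero_le_one (1/2 + r)

lemma clampI_continuous : Continuous clampI := continuous_projIcc.comp (by fun_prop)

lemma clampI_coe (t : I) : clampI ((t:ℝ) - 1/2) = t := by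
  rw [clampI]; simp

lemma clampI_bd {r : ℝ} (h : 1/2 ≤ |r|) : clampI r = 0 ∨ clampI r = 1 := by
  rcases le_abs.1 h with h | h
  · right; exact Set.projIcc_of_right_le _ (by linarith)
  · left; exact Set.projIcc_of_le_left _ (by linarith)

/-- Homotopy from families of self maps of Euclidean space. -/
lemma family_homotopic (f g g' : Ω^ M X x) (A : I → (M → ℝ) → (M → ℝ))
    (hA : Continuous fun p : I × (M → ℝ) => A p.1 p.2)
    (hb : ∀ t (v : M → ℝ), (∃ i, 1/2 ≤ |v i|) → ∃ i, 1/2 ≤ |A t v i|)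
    (h0 : ∀ y, g y = f (fun i => clampI (A 0 (fun j => (y j : ℝ) - 1/2) i)))
    (h1 : ∀ y, g' y = f (fun i => clampI (A 1 (fun j => (y j : ℝ) - 1/2) i))) :
    GenLoop.Homotopic g g' := by
  refine mkH (fun p => f (fun i => clampI (A p.1 (fun j => (p.2 j : ℝ) - 1/2) i))) ?_
    (fun y => (h0 y).symm) (fun y => (h1 y).symm) ?_
  · refine (contL f).comp (continuous_pi fun i => clampI_continuous.comp ?_)
    have : Continuous fun p : I × (M → I) => A p.1 (fun j => (p.2 j : ℝ) - 1/2) :=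
      hA.comp (continuous_fst.prodMk (by fun_prop))
    exact (continuous_apply i).comp this
  · rintro t y ⟨i, hi⟩
    obtain ⟨j, hj⟩ := hb t (fun j => (y j : ℝ) - 1/2) ⟨i, by
      rcases hi with h | h <;> norm_num [h, abs_of_nonneg, abs_of_neg]⟩
    exact GenLoop.boundary f _ ⟨j, clampI_bd hj⟩

lemma scale_ex (f : Ω^ M X x) (c : ℝ) (hc : 1 ≤ c) : ∃ f' : Ω^ M X x,
    (∀ y, f' y = f (fun i => clampI (c * ((y i : ℝ) - 1/2)))) ∧ GenLoop.Homotopic f f' := by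
  have hb : ∀ y ∈ Cube.boundary M, f (fun i => clampI (c * ((y i : ℝ) - 1/2))) = x := by
    rintro y ⟨i, hi⟩
    refine GenLoop.boundary f _ ⟨i, clampI_bd ?_⟩
    rw [abs_mul, abs_of_nonneg (by linarith : (0:ℝ) ≤ c)]
    rcases hi with h | h <;> norm_num [h, abs_of_nonneg, abs_of_neg] <;> linarith
  have hcont : Continuous fun y : M → I => f (fun i => clampI (c * ((y i : ℝ) - 1/2))) :=
    (contL f).comp (continuous_pi fun i => clampI_continuous.comp (by fun_prop))
  refine ⟨mkL _ hcont hb, fun y => rfl, ?_⟩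
  refine family_homotopic f _ _ (fun t v i => (1 + (t:ℝ) * (c - 1)) * v i) (by fun_prop) ?_ ?_ ?_
  · rintro t v ⟨i, hi⟩
    refine ⟨i, ?_⟩
    have : 0 ≤ (t:ℝ) * (c - 1) := mul_nonneg t.2.1 (by linarith)
    rw [abs_mul, abs_of_nonneg (by linarith)]
    nlinarith [abs_nonneg (v i)]
  · intro y; congr 1; ext1 i; simp only [Set.Icc.coe_zero, zero_mul, add_zero, one_mul, clampI_coe]
  · intro y; rw [mkL_apply]; congr 1; ext1 i; simp

/-- Swap of two coordinate pairs. -/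
def swapY (Z : Type) (y : (N ⊕ Fin 2) ⊕ Fin 2 → Z) : (N ⊕ Fin 2) ⊕ Fin 2 → Z :=
  Sum.elim (Sum.elim (fun n => y (.inl (.inl n))) (fun k => y (.inr k))) (fun k => y (.inl (.inr k)))

/-- Rotation exchanging the pairs. -/
noncomputable def rotA (c s : ℝ) (v : (N ⊕ Fin 2) ⊕ Fin 2 → ℝ) : (N ⊕ Fin 2) ⊕ Fin 2 → ℝ :=
  let p : Fin 2 → ℝ := fun k => v (.inl (.inr k))
  let q : Fin 2 → ℝ := fun k => v (.inr k)
  let d : Fin 2 → ℝ := ![c * ((p 0 - q 0)/2) - s * ((p 1 - q 1)/2),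
    s * ((p 0 - q 0)/2) + c * ((p 1 - q 1)/2)]
  Sum.elim (Sum.elim (fun n => v (.inl (.inl n))) (fun k => (p k + q k)/2 + d k))
    (fun k => (p k + q k)/2 - d k)

lemma rotA_continuous : Continuous fun p : ℝ × ℝ × ((N ⊕ Fin 2) ⊕ Fin 2 → ℝ) =>
    rotA p.1 p.2.1 p.2.2 := by
  refine continuous_pi fun i => ?_
  rcases i with (i | i) | i
  · simp only [rotA, Sum.elim_inl]; fun_prop
  · fin_cases i <;> simp [rotA] <;> fun_prop
  · fin_cases i <;> simp [rotA] <;> fun_prop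

lemma rotA_bd (c s : ℝ) (h : c^2 + s^2 = 1) (v : (N ⊕ Fin 2) ⊕ Fin 2 → ℝ)
    (hv : ∃ i, 1/2 ≤ |v i|) : ∃ i, 1/2 ≤ |3 * rotA c s v i| := by
  have hc : |c| ≤ 1 := abs_le_one_iff_mul_self_le_one.2 (by nlinarith)
  have hs : |s| ≤ 1 := abs_le_one_iff_mul_self_le_one.2 (by nlinarith)
  by_contra hcon
  push Not at hcon
  have key : ∀ i, |rotA c s v i| < 1/6 := fun i => by
    have := hcon i; rw [abs_mul, abs_of_nonneg (by norm_num : (0:ℝ) ≤ 3)] at this; linarith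
  have a0 := key (.inl (.inr 0))
  have a1 := key (.inl (.inr 1))
  have b0 := key (.inr 0)
  have b1 := key (.inr 1)
  obtain ⟨i, hi⟩ := hv
  simp only [rotA, Sum.elim_inl, Sum.elim_inr, cons_val_zero, cons_val_one] at a0 a1 b0 b1
  set p0 := v (.inl (.inr 0)) with hp0
  set p1 := v (.inl (.inr 1)) with hp1
  set q0 := v (.inr 0) with hq0
  set q1 := v (.inr 1) with hq1
  set e0 := c * ((p0 - q0)/2) - s * ((p1 - q1)/2) with he0
  set e1 := s * ((p0 - q0)/2) + c * ((p1 - q1)/2) with he1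
  rw [abs_lt] at a0 a1 b0 b1
  have m0 : |e0| < 1/6 := abs_lt.2 ⟨by linarith, by linarith⟩
  have m1 : |e1| < 1/6 := abs_lt.2 ⟨by linarith, by linarith⟩
  have d0 : (p0 - q0)/2 = c * e0 + s * e1 := by
    rw [he0, he1]; linear_combination (-(p0 - q0)/2) * h
  have d1 : (p1 - q1)/2 = c * e1 - s * e0 := by
    rw [he0, he1]; linear_combination (-(p1 - q1)/2) * h
  have ce0 : |c * e0| < 1/6 := by rw [abs_mul]; nlinarith [abs_nonneg c, abs_nonneg e0]
  have ce1 : |c * e1| < 1/6 := by rw [abs_mul]; nlinarith [abs_nonneg c, abs_nonneg e1]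
  have se0 : |s * e0| < 1/6 := by rw [abs_mul]; nlinarith [abs_nonneg s, abs_nonneg e0]
  have se1 : |s * e1| < 1/6 := by rw [abs_mul]; nlinarith [abs_nonneg s, abs_nonneg e1]
  rw [abs_lt] at ce0 ce1 se0 se1
  have r1 : |p0| < 1/2 := abs_lt.2 ⟨by linarith, by linarith⟩
  have r2 : |p1| < 1/2 := abs_lt.2 ⟨by linarith, by linarith⟩
  have r3 : |q0| < 1/2 := abs_lt.2 ⟨by linarith, by linarith⟩
  have r4 : |q1| < 1/2 := abs_lt.2 ⟨by linarith, by linarith⟩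
  rcases i with (i | i) | i
  · have := key (.inl (.inl i))
    simp only [rotA, Sum.elim_inl] at this
    linarith
  · fin_cases i
    · exact absurd hi (not_le.2 r1)
    · exact absurd hi (not_le.2 r2)
  · fin_cases i
    · exact absurd hi (not_le.2 r3)
    · exact absurd hi (not_le.2 r4)

theorem swap_homotopic (f g : Ω^ ((N ⊕ Fin 2) ⊕ Fin 2) X x) (h : ∀ y, g y = f (swapY I y)) :
    GenLoop.Homotopic f g := by
  obtain ⟨f', hf', hf⟩ := scale_ex f 3 (by norm_num)
  obtain ⟨g', hg', hg⟩ := scale_ex g 3 (by norm_num)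
  refine (hf.trans ?_).trans hg.symm
  refine family_homotopic f _ _
    (fun t v i => 3 * rotA (Real.cos (Real.pi * t)) (Real.sin (Real.pi * t)) v i) ?_ ?_ ?_ ?_
  · have := (rotA_continuous (N := N)).comp (g := _) (f := fun p : I × ((N ⊕ Fin 2) ⊕ Fin 2 → ℝ) =>
      (Real.cos (Real.pi * p.1), Real.sin (Real.pi * p.1), p.2)) (by fun_prop)
    exact continuous_const.mul this
  · intro t v hv
    exact rotA_bd _ _ (Real.cos_sq_add_sin_sq _) v hv
  · intro y
    rw [hf']
    congr 1; ext1 i; congr 2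
    rcases i with (i | i) | i
    · simp [rotA]
    · fin_cases i <;> simp [rotA] <;> ring
    · fin_cases i <;> simp [rotA] <;> ring
  · intro y
    rw [hg', h]
    congr 1; ext1 i
    rcases i with (i | i) | i
    · simp [rotA, swapY]
    · fin_cases i <;> simp [rotA, swapY] <;> congr 1 <;> ring
    · fin_cases i <;> simp [rotA, swapY] <;> congr 1 <;> ring

end Swap
end BottPf

namespace BottPf
set_option linter.unusedSectionVars false
set_option linter.unusedSimpArgs false
open scoped unitInterval Topology.Homotopy

/-! ### Fuzzy torus -/
section Fuzzy
open scoped Matrix.Norms.L2Operator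

/-- Size of the discretization. -/
def mm (L : ℕ) : ℕ := 2 * (L + 2) ^ 2
instance (L : ℕ) : NeZero (mm L) := ⟨by unfold mm; positivity⟩

lemma lt_mm (L : ℕ) : L + 2 < mm L := by unfold mm; nlinarith

abbrev JJ (L : ℕ) := ZMod (mm L)

/-- Root of unity. -/
noncomputable def ee {L : ℕ} (a : JJ L) : Circle := ZMod.toCircle a

lemma ee_add {L : ℕ} (a b : JJ L) : ee (a + b) = ee a * ee b := by
  simp [ee, AddChar.map_add_eq_mul]

lemma ee_zero {L : ℕ} : ee (0 : JJ L) = 1 := by simp [ee]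

lemma ee_star {L : ℕ} (a : JJ L) : star (ee a : ℂ) * (ee a : ℂ) = 1 := by
  have h := Complex.conj_mul' (ee a : ℂ)
  have h2 : ‖(ee a : ℂ)‖ = 1 := Circle.norm_coe _
  rw [h2] at h
  simpa using h

lemma ee_neg {L : ℕ} (a : JJ L) : (ee (-a) : ℂ) = star (ee a : ℂ) := by
  have h1 : (ee (-a) : ℂ) * (ee a : ℂ) = 1 := by
    rw [← Circle.coe_mul, ← ee_add]; simp [ee_zero]
  have h2 := ee_star a
  have h3 : (ee a : ℂ) ≠ 0 := Circle.coe_ne_zero _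
  exact mul_right_cancel₀ h3 (h1.trans h2.symm)

lemma ee_sum {L : ℕ} (j : JJ L) : ∑ b : JJ L, (ee (j * b) : ℂ) = if j = 0 then (mm L : ℂ) else 0 := by
  have := AddChar.sum_mulShift j (ZMod.isPrimitive_stdAddChar (mm L))
  rw [ZMod.card] at this
  simpa [mul_comm j, ee, ZMod.stdAddChar_apply] using this

/-- Matrices with orthogonal columns. -/
noncomputable def colM {L : ℕ} (k : JJ L) (x : JJ L → JJ L → ℂ) : Matrix (JJ L × JJ L) (JJ L) ℂ :=
  Matrix.of fun c j => x j c.1 * (ee ((j + k) * c.2) : ℂ) * ((Real.sqrt (mm L) : ℝ) : ℂ)⁻¹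

lemma colM_sub {L : ℕ} (k : JJ L) (x y : JJ L → JJ L → ℂ) :
    colM k x - colM k y = colM k (fun j a => x j a - y j a) := by
  ext c j; simp [colM]; ring

lemma colM_star_mul {L : ℕ} (k : JJ L) (x : JJ L → JJ L → ℂ) :
    (colM k x)ᴴ * colM k x = Matrix.diagonal (fun j => ((∑ a, ‖x j a‖ ^ 2 : ℝ) : ℂ)) := by
  ext i j
  rw [Matrix.mul_apply, Fintype.sum_prod_type]
  have hm : (((Real.sqrt (mm L) : ℝ) : ℂ)⁻¹) * (((Real.sqrt (mm L) : ℝ) : ℂ)⁻¹) = (mm L : ℂ)⁻¹ := by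
    rw [← mul_inv, ← Complex.ofReal_mul, Real.mul_self_sqrt (by positivity)]; simp
  have h1 : ∀ a b : JJ L, (colM k x)ᴴ i (a, b) * colM k x (a, b) j =
      (star (x i a) * x j a * (mm L : ℂ)⁻¹) * (ee ((j - i) * b) : ℂ) := by
    intro a b
    have h2 : (ee ((j - i) * b) : ℂ) = star (ee ((i + k) * b) : ℂ) * (ee ((j + k) * b) : ℂ) := by
      rw [← ee_neg, ← Circle.coe_mul, ← ee_add]; congr 2; ring
    rw [h2, ← hm]
    simp only [colM, conjTranspose_apply, of_apply, star_mul', star_inv₀]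
    have : star ((Real.sqrt (mm L) : ℝ) : ℂ) = ((Real.sqrt (mm L) : ℝ) : ℂ) := Complex.conj_ofReal _
    rw [this]; ring
  simp_rw [h1, ← Finset.mul_sum, ee_sum]
  rw [Matrix.diagonal_apply]
  by_cases h : i = j
  · subst h
    have hm0 : (mm L : ℂ) ≠ 0 := by simp [NeZero.ne]
    simp only [sub_self, if_true]
    push_cast
    refine Finset.sum_congr rfl fun a _ => ?_
    rw [mul_assoc, inv_mul_cancel₀ hm0, mul_one]
    exact Complex.conj_mul' _
  · have : j - i ≠ 0 := sub_ne_zero.2 (Ne.symm h)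
    simp [h, this]

lemma colM_norm_le {L : ℕ} (k : JJ L) (x : JJ L → JJ L → ℂ) (r : ℝ) (hr : 0 ≤ r)
    (h : ∀ j, ∑ a, ‖x j a‖ ^ 2 ≤ r ^ 2) : ‖colM k x‖ ≤ r := by
  have h1 := l2_opNorm_conjTranspose_mul_self (colM k x)
  rw [colM_star_mul, l2_opNorm_diagonal] at h1
  have h2 : ‖(fun j => ((∑ a, ‖x j a‖ ^ 2 : ℝ) : ℂ))‖ ≤ r ^ 2 := by
    refine (pi_norm_le_iff_of_nonneg (by positivity)).2 fun j => ?_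
    rw [Complex.norm_real, Real.norm_of_nonneg (by positivity)]
    exact h j
  rw [h1] at h2
  exact abs_le_of_sq_le_sq' (by nlinarith) hr |>.2

/-- Window function. -/
noncomputable def ww {L : ℕ} (c : JJ L) : ℝ := if c.val < L + 2 then (Real.sqrt (L + 2))⁻¹ else 0

lemma ww_sq {L : ℕ} (c : JJ L) : ww c ^ 2 = if c.val < L + 2 then ((L:ℝ) + 2)⁻¹ else 0 := by
  unfold ww; split_ifs
  · rw [inv_pow, Real.sq_sqrt (by positivity)]
  · simp

lemma ww_card (L : ℕ) : (Finset.univ.filter (fun c : JJ L => c.val < L + 2)).card = L + 2 := by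
  have : (Finset.univ.filter (fun c : JJ L => c.val < L + 2)) =
      (Finset.range (L + 2)).image (fun n : ℕ => (n : JJ L)) := by
    ext c
    simp only [Finset.mem_filter, Finset.mem_univ, true_and, Finset.mem_image, Finset.mem_range]
    constructor
    · intro h; exact ⟨c.val, h, ZMod.natCast_zmod_val c⟩
    · rintro ⟨n, hn, rfl⟩
      rwa [ZMod.val_cast_of_lt (hn.trans (lt_mm L))]
  rw [this, Finset.card_image_of_injOn, Finset.card_range]
  intro a ha b hb hab
  simp only [Finset.coe_range, Set.mem_Iio] at ha hb
  have := congrArg ZMod.val hab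
  simpa [ZMod.val_cast_of_lt (ha.trans (lt_mm L)), ZMod.val_cast_of_lt (hb.trans (lt_mm L))] using this

lemma ww_sum (L : ℕ) : ∑ c : JJ L, ww c ^ 2 = 1 := by
  simp_rw [ww_sq]
  rw [← Finset.sum_filter, Finset.sum_const, ww_card, nsmul_eq_mul]
  push_cast
  exact mul_inv_cancel₀ (by positivity)

lemma ww_shift (L : ℕ) : ∑ c : JJ L, (ww c - ww (c - 1)) ^ 2 ≤ 2 * ((L:ℝ) + 2)⁻¹ := by
  have hp : (0:ℝ) ≤ ((L:ℝ) + 2)⁻¹ := by positivity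
  have h1 : ∀ c : JJ L, (ww c - ww (c - 1)) ^ 2 ≤
      if c ∈ ({0, ((L + 2 : ℕ) : JJ L)} : Finset (JJ L)) then ((L:ℝ) + 2)⁻¹ else 0 := by
    intro c
    split_ifs with h
    · have : ∀ a b : JJ L, (ww a - ww b) ^ 2 ≤ ((L:ℝ) + 2)⁻¹ := by
        intro a b
        have e1 := ww_sq a
        have e2 := ww_sq b
        unfold ww at e1 e2 ⊢
        split_ifs at e1 e2 ⊢ <;> nlinarith
      exact this _ _
    · simp only [Finset.mem_insert, Finset.mem_singleton, not_or] at h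
      have hc : c.val ≠ 0 := by rw [Ne, ZMod.val_eq_zero]; exact h.1
      have hc2 : c.val ≠ L + 2 := by
        intro hh; apply h.2; rw [← hh, ZMod.natCast_zmod_val]
      have hlt := ZMod.val_lt c
      have hval : (c - 1).val = c.val - 1 := by
        have : c - 1 = ((c.val - 1 : ℕ) : JJ L) := by
          rw [Nat.cast_sub (by omega), ZMod.natCast_zmod_val]; simp
        rw [this, ZMod.val_cast_of_lt (by omega)]
      have : ww c = ww (c - 1) := by
        unfold ww; rw [hval]
        have : c.val < L + 2 ↔ c.val - 1 < L + 2 := by omega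
        simp only [this]
      rw [this]; simp
  calc _ ≤ ∑ c : JJ L, if c ∈ ({0, ((L + 2 : ℕ) : JJ L)} : Finset (JJ L)) then ((L:ℝ) + 2)⁻¹ else 0 :=
        Finset.sum_le_sum fun c _ => h1 c
    _ = (({0, ((L + 2 : ℕ) : JJ L)} : Finset (JJ L)).card : ℝ) * ((L:ℝ) + 2)⁻¹ := by
        rw [Finset.sum_ite_mem, Finset.univ_inter, Finset.sum_const, nsmul_eq_mul]
    _ ≤ 2 * ((L:ℝ) + 2)⁻¹ := by
        gcongr
        exact_mod_cast Finset.card_le_two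

/-- The isometry of the fuzzy torus. -/
noncomputable def VV (L : ℕ) : Matrix (JJ L × JJ L) (JJ L) ℂ :=
  colM 0 (fun j a => (ww (a - j) : ℂ))

lemma VV_star_mul (L : ℕ) : (VV L)ᴴ * VV L = 1 := by
  rw [VV, colM_star_mul, ← diagonal_one]
  congr 1; ext1 j
  have : ∑ a : JJ L, ‖((ww (a - j) : ℝ) : ℂ)‖ ^ 2 = 1 := by
    rw [← ww_sum L]
    exact Fintype.sum_equiv (Equiv.subRight j) _ _ (fun a => by simp [Complex.norm_real])
  rw [this]; simp

lemma norm_one_le {ι : Type} [Fintype ι] [DecidableEq ι] : ‖(1 : Matrix ι ι ℂ)‖ ≤ 1 := by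
  rw [← diagonal_one, l2_opNorm_diagonal]
  exact (pi_norm_le_iff_of_nonneg zero_le_one).2 (fun i => by simp)

lemma norm_isom {ι κ : Type} [Fintype ι] [DecidableEq ι] [Fintype κ] [DecidableEq κ]
    (P : Matrix κ ι ℂ) (h : Pᴴ * P = 1) : ‖P‖ ≤ 1 := by
  have h1 := l2_opNorm_conjTranspose_mul_self P
  rw [h] at h1
  nlinarith [norm_nonneg P, norm_one_le (ι := ι)]

lemma VV_norm (L : ℕ) : ‖VV L‖ ≤ 1 := norm_isom _ (VV_star_mul L)

lemma VV_star_norm (L : ℕ) : ‖(VV L)ᴴ‖ ≤ 1 := by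
  rw [l2_opNorm_conjTranspose]; exact VV_norm L

abbrev TT2 := Circle × Circle

/-- Multiplication operator. -/
noncomputable def DD (L : ℕ) (φ : TT2 → ℂ) : Matrix (JJ L × JJ L) (JJ L × JJ L) ℂ :=
  Matrix.diagonal (fun c => φ (ee c.1, ee c.2))

lemma DD_mul (L : ℕ) (φ ψ : TT2 → ℂ) : DD L (fun z => φ z * ψ z) = DD L φ * DD L ψ := by
  simp [DD]

lemma DD_add (L : ℕ) (φ ψ : TT2 → ℂ) : DD L (fun z => φ z + ψ z) = DD L φ + DD L ψ := by
  simp [DD]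

lemma DD_sub (L : ℕ) (φ ψ : TT2 → ℂ) : DD L (fun z => φ z - ψ z) = DD L φ - DD L ψ := by
  simp [DD]

lemma DD_norm_le (L : ℕ) (φ : TT2 → ℂ) (r : ℝ) (hr : 0 ≤ r) (h : ∀ z, ‖φ z‖ ≤ r) : ‖DD L φ‖ ≤ r := by
  rw [DD, l2_opNorm_diagonal]
  exact (pi_norm_le_iff_of_nonneg hr).2 (fun c => h _)

/-- Quantization error. -/
noncomputable def err (L : ℕ) (φ : TT2 → ℂ) (A : Matrix (JJ L) (JJ L) ℂ) : ℝ :=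
  ‖DD L φ * VV L - VV L * A‖

/-- Quantization. -/
noncomputable def tau (L : ℕ) (φ : TT2 → ℂ) : Matrix (JJ L) (JJ L) ℂ := (VV L)ᴴ * DD L φ * VV L

lemma tau_sub_le (L : ℕ) (φ : TT2 → ℂ) (A : Matrix (JJ L) (JJ L) ℂ) : ‖tau L φ - A‖ ≤ err L φ A := by
  have : tau L φ - A = (VV L)ᴴ * (DD L φ * VV L - VV L * A) := by
    rw [Matrix.mul_sub, ← Matrix.mul_assoc (VV L)ᴴ (VV L) A, VV_star_mul, Matrix.one_mul, tau,
      Matrix.mul_assoc]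
  rw [this, err]
  calc _ ≤ ‖(VV L)ᴴ‖ * ‖DD L φ * VV L - VV L * A‖ := l2_opNorm_mul _ _
    _ ≤ 1 * _ := by gcongr; exact VV_star_norm L
    _ = _ := one_mul _

lemma norm_VV_mul (L : ℕ) {κ : Type} [Fintype κ] [DecidableEq κ] (A : Matrix (JJ L) κ ℂ) :
    ‖VV L * A‖ ≤ ‖A‖ := by
  calc _ ≤ ‖VV L‖ * ‖A‖ := l2_opNorm_mul _ _
    _ ≤ 1 * _ := by gcongr; exact VV_norm L
    _ = _ := one_mul _

lemma norm_le_VV_mul (L : ℕ) {κ : Type} [Fintype κ] [DecidableEq κ] (A : Matrix (JJ L) κ ℂ) :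
    ‖A‖ ≤ ‖VV L * A‖ := by
  calc ‖A‖ = ‖(VV L)ᴴ * (VV L * A)‖ := by rw [← Matrix.mul_assoc, VV_star_mul, Matrix.one_mul]
    _ ≤ ‖(VV L)ᴴ‖ * ‖VV L * A‖ := l2_opNorm_mul _ _
    _ ≤ 1 * _ := by gcongr; exact VV_star_norm L
    _ = _ := one_mul _

lemma err_tau_le (L : ℕ) (φ : TT2 → ℂ) (A : Matrix (JJ L) (JJ L) ℂ) :
    err L φ (tau L φ) ≤ 2 * err L φ A := by
  have : DD L φ * VV L - VV L * tau L φ = (DD L φ * VV L - VV L * A) - VV L * (tau L φ - A) := by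
    rw [Matrix.mul_sub]; abel
  rw [err, this]
  calc _ ≤ err L φ A + ‖VV L * (tau L φ - A)‖ := norm_sub_le _ _
    _ ≤ err L φ A + err L φ A := by
        gcongr; exact (norm_VV_mul L _).trans (tau_sub_le L φ A)
    _ = _ := by ring

lemma err_mul (L : ℕ) (φ ψ : TT2 → ℂ) (A B : Matrix (JJ L) (JJ L) ℂ) (r : ℝ) (hr : 0 ≤ r)
    (h : ∀ z, ‖φ z‖ ≤ r) : err L (fun z => φ z * ψ z) (A * B) ≤ r * err L ψ B + err L φ A * ‖B‖ := by
  have : DD L (fun z => φ z * ψ z) * VV L - VV L * (A * B) =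
      DD L φ * (DD L ψ * VV L - VV L * B) + (DD L φ * VV L - VV L * A) * B := by
    rw [DD_mul]; simp only [Matrix.mul_sub, Matrix.sub_mul, Matrix.mul_assoc]; abel
  rw [err, this]
  refine (norm_add_le _ _).trans ?_
  gcongr
  · refine (l2_opNorm_mul _ _).trans ?_
    have := DD_norm_le L φ r hr h
    unfold err; gcongr
  · exact l2_opNorm_mul _ _

lemma err_add (L : ℕ) (φ ψ : TT2 → ℂ) (A B : Matrix (JJ L) (JJ L) ℂ) :
    err L (fun z => φ z + ψ z) (A + B) ≤ err L φ A + err L ψ B := by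
  have : DD L (fun z => φ z + ψ z) * VV L - VV L * (A + B) =
      (DD L φ * VV L - VV L * A) + (DD L ψ * VV L - VV L * B) := by
    rw [DD_add]; simp only [Matrix.add_mul, Matrix.mul_add]; abel
  rw [err, this]
  exact norm_add_le _ _

lemma err_close (L : ℕ) (φ ψ : TT2 → ℂ) (A : Matrix (JJ L) (JJ L) ℂ) (r : ℝ) (hr : 0 ≤ r)
    (h : ∀ z, ‖φ z - ψ z‖ ≤ r) : err L φ A ≤ r + err L ψ A := by
  have : DD L φ * VV L - VV L * A = DD L (fun z => φ z - ψ z) * VV L +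
      (DD L ψ * VV L - VV L * A) := by
    rw [DD_sub, Matrix.sub_mul]; abel
  rw [err, this]
  refine (norm_add_le _ _).trans ?_
  gcongr
  · refine (l2_opNorm_mul _ _).trans ?_
    have h1 := DD_norm_le L _ r hr h
    calc _ ≤ r * 1 := by gcongr; exact VV_norm L
      _ = r := mul_one r
  · exact le_rfl

lemma tau_mul_le (L : ℕ) (φ ψ : TT2 → ℂ) (B : Matrix (JJ L) (JJ L) ℂ) (r : ℝ) (hr : 0 ≤ r)
    (h : ∀ z, ‖φ z‖ ≤ r) :
    ‖tau L (fun z => φ z * ψ z) - tau L φ * tau L ψ‖ ≤ r * (2 * err L ψ B) := by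
  have : tau L (fun z => φ z * ψ z) - tau L φ * tau L ψ =
      (VV L)ᴴ * (DD L φ * (DD L ψ * VV L - VV L * tau L ψ)) := by
    rw [tau, DD_mul]; simp only [tau, Matrix.mul_sub, Matrix.mul_assoc]
  rw [this]
  have h1 := DD_norm_le L φ r hr h
  calc _ ≤ ‖(VV L)ᴴ‖ * ‖(DD L φ * (DD L ψ * VV L - VV L * tau L ψ))‖ := l2_opNorm_mul _ _
    _ ≤ 1 * (‖DD L φ‖ * ‖(DD L ψ * VV L - VV L * tau L ψ)‖) := by
        gcongr
        · exact VV_star_norm L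
        · exact l2_opNorm_mul _ _
    _ ≤ 1 * (r * (2 * err L ψ B)) := by
        gcongr
        exact err_tau_le L ψ B
    _ = _ := one_mul _

/-- The shift matrix. -/
noncomputable def shiftM (L : ℕ) : Matrix (JJ L) (JJ L) ℂ :=
  Matrix.of fun i j => if i = j + 1 then 1 else 0

lemma err_z2 (L : ℕ) : err L (fun z => (z.2 : ℂ)) (shiftM L) ≤ Real.sqrt (2 * ((L:ℝ) + 2)⁻¹) := by
  have h1 : DD L (fun z => (z.2 : ℂ)) * VV L = colM 1 (fun j a => (ww (a - j) : ℂ)) := by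
    ext c j
    rw [DD, Matrix.diagonal_mul]
    simp only [VV, colM, of_apply, add_zero]
    have : (ee ((j + 1) * c.2) : ℂ) = (ee (j * c.2) : ℂ) * (ee c.2 : ℂ) := by
      rw [← Circle.coe_mul, ← ee_add]; congr 2; ring
    rw [this]; ring
  have h2 : VV L * shiftM L = colM 1 (fun j a => (ww (a - j - 1) : ℂ)) := by
    ext c j
    rw [Matrix.mul_apply]
    simp only [shiftM, of_apply, mul_ite, mul_one, mul_zero, Finset.sum_ite_eq', Finset.mem_univ,
      if_true, VV, colM, add_zero]
    rw [sub_add_eq_sub_sub]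
  rw [err, h1, h2, colM_sub]
  refine colM_norm_le _ _ _ (Real.sqrt_nonneg _) fun j => ?_
  rw [Real.sq_sqrt (by positivity)]
  refine le_trans (le_of_eq ?_) (ww_shift L)
  refine Fintype.sum_equiv (Equiv.subRight j) _ _ fun a => ?_
  rw [← Complex.ofReal_sub, Complex.norm_real, Real.norm_eq_abs, sq_abs]
  simp

/-- Shift for `z̄₂`. -/
lemma err_z2' (L : ℕ) : err L (fun z => star (z.2 : ℂ)) (shiftM L)ᴴ ≤
    Real.sqrt (2 * ((L:ℝ) + 2)⁻¹) := by
  have h1 : shiftM L * (shiftM L)ᴴ = 1 := by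
    ext i j
    rw [Matrix.mul_apply]
    simp only [shiftM, of_apply, conjTranspose_apply, apply_ite star, star_one, star_zero, mul_ite,
      mul_one, mul_zero, Matrix.one_apply]
    rw [Finset.sum_eq_single (j - 1)]
    · simp
    · intro b _ hb
      rw [if_neg]; rintro rfl; simp at hb
    · simp
  have h2 : DD L (fun z => star (z.2 : ℂ)) * DD L (fun z => (z.2 : ℂ)) = 1 := by
    rw [← DD_mul]; simp only [DD]
    rw [← diagonal_one]; congr 1; ext1 c; exact ee_star _
  have : DD L (fun z => star (z.2 : ℂ)) * VV L - VV L * (shiftM L)ᴴ =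
      - (DD L (fun z => star (z.2 : ℂ)) * ((DD L (fun z => (z.2 : ℂ)) * VV L - VV L * shiftM L) *
        (shiftM L)ᴴ)) := by
    simp only [Matrix.sub_mul, Matrix.mul_sub, Matrix.mul_assoc, h1, Matrix.mul_one]
    rw [← Matrix.mul_assoc (DD L _) (DD L _), h2, Matrix.one_mul]; abel
  have hS : ‖(shiftM L)ᴴ‖ ≤ 1 := norm_isom _ (by rw [conjTranspose_conjTranspose, h1])
  have hD : ‖DD L (fun z => star (z.2 : ℂ))‖ ≤ 1 := DD_norm_le L _ 1 zero_le_one (fun z => by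
    rw [norm_star]; exact (Circle.norm_coe _).le)
  rw [err, this, norm_neg]
  calc _ ≤ ‖DD L (fun z => star (z.2 : ℂ))‖ * (‖(DD L (fun z => (z.2 : ℂ)) * VV L - VV L * shiftM L)‖ *
        ‖(shiftM L)ᴴ‖) := by
        refine (l2_opNorm_mul _ _).trans ?_
        gcongr; exact l2_opNorm_mul _ _
    _ ≤ 1 * (err L (fun z => (z.2 : ℂ)) (shiftM L) * 1) := by
        unfold err; gcongr
    _ ≤ _ := by rw [one_mul, mul_one]; exact err_z2 L

lemma ee_close {L : ℕ} (a j : JJ L) (h : (a - j).val < L + 2) :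
    dist (ee a) (ee j) ≤ Real.pi * ((L:ℝ) + 2)⁻¹ := by
  have h1 : ee a = ee (a - j) * ee j := by rw [← ee_add]; simp
  have h2 : dist (ee a) (ee j) = ‖(ee (a - j) : ℂ) - 1‖ := by
    change dist (ee a : ℂ) (ee j : ℂ) = _
    rw [dist_eq_norm]
    show ‖(ee a : ℂ) - (ee j : ℂ)‖ = _
    rw [h1, Circle.coe_mul]
    have : (ee (a-j) : ℂ) * (ee j : ℂ) - (ee j : ℂ) = ((ee (a - j) : ℂ) - 1) * (ee j : ℂ) := by ring
    rw [this, norm_mul, Circle.norm_coe, mul_one]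
  have h3 : (ee (a - j) : ℂ) = Complex.exp (Complex.I * ((2 * Real.pi * ((a-j).val / mm L) : ℝ) : ℂ)) := by
    rw [ee, ZMod.toCircle_apply]; congr 1; push_cast; ring
  rw [h2, h3]
  refine (Real.norm_exp_I_mul_ofReal_sub_one_le).trans ?_
  rw [Real.norm_of_nonneg (by positivity)]
  have hmm : (mm L : ℝ) = 2 * ((L:ℝ) + 2)^2 := by unfold mm; push_cast; ring
  have hv : ((a - j).val : ℝ) ≤ (L:ℝ) + 2 := by exact_mod_cast h.le
  rw [hmm]
  have hp : (0:ℝ) < (L:ℝ) + 2 := by positivity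
  calc 2 * Real.pi * (((a - j).val : ℝ) / (2 * ((L:ℝ) + 2)^2))
      ≤ 2 * Real.pi * (((L:ℝ) + 2) / (2 * ((L:ℝ) + 2)^2)) := by gcongr
    _ = _ := by field_simp

lemma err_z1 (L : ℕ) (φ : Circle → ℂ) (r : ℝ) (hr : 0 ≤ r)
    (h : ∀ a j : JJ L, (a - j).val < L + 2 → ‖φ (ee a) - φ (ee j)‖ ≤ r) :
    err L (fun z => φ z.1) (Matrix.diagonal fun j => φ (ee j)) ≤ r := by
  have h1 : DD L (fun z => φ z.1) * VV L = colM 0 (fun j a => φ (ee a) * (ww (a - j) : ℂ)) := by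
    ext c j
    rw [DD, Matrix.diagonal_mul]
    simp only [VV, colM, of_apply, add_zero]
    ring
  have h2 : VV L * (Matrix.diagonal (fun j => φ (ee j)) : Matrix (JJ L) (JJ L) ℂ) =
      colM 0 (fun j a => φ (ee j) * (ww (a - j) : ℂ)) := by
    ext c j
    rw [Matrix.mul_diagonal]
    simp only [VV, colM, of_apply, add_zero]
    ring
  rw [err, h1, h2, colM_sub]
  refine colM_norm_le _ _ _ hr fun j => ?_
  calc _ ≤ ∑ a : JJ L, r ^ 2 * ww (a - j) ^ 2 := by
        refine Finset.sum_le_sum fun a _ => ?_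
        rw [← sub_mul, norm_mul, mul_pow, Complex.norm_real, Real.norm_eq_abs, sq_abs]
        by_cases hc : (a - j).val < L + 2
        · have := h a j hc; gcongr
        · simp [ww, hc]
    _ = r ^ 2 := by
        rw [← Finset.mul_sum]
        have : ∑ a : JJ L, ww (a - j) ^ 2 = 1 := by
          rw [← ww_sum L]
          exact Fintype.sum_equiv (Equiv.subRight j) _ _ (fun a => by simp)
        rw [this, mul_one]

end Fuzzy
end BottPf

namespace BottPf
set_option linter.unusedSectionVars false
set_option linter.unusedSimpArgs false
open scoped unitInterval Topology.Homotopy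

/-! ### Asymptotic multiplicativity -/
section Asymp
open scoped Matrix.Norms.L2Operator
open Filter

/-- Asymptotically quantizable functions. -/
def Apx (φ : TT2 → ℂ) : Prop := ∀ ε > 0, ∀ᶠ L in atTop, ∃ A, err L φ A ≤ ε

lemma Apx.add {φ ψ : TT2 → ℂ} (h : Apx φ) (h' : Apx ψ) : Apx (fun z => φ z + ψ z) := by
  intro ε hε
  filter_upwards [h (ε/2) (by positivity), h' (ε/2) (by positivity)] with L ⟨A, hA⟩ ⟨B, hB⟩
  exact ⟨A + B, (err_add L φ ψ A B).trans (by linarith)⟩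

lemma norm_of_err {L : ℕ} {ψ : TT2 → ℂ} {B : Matrix (JJ L) (JJ L) ℂ} {r : ℝ} (hr : 0 ≤ r)
    (h : ∀ z, ‖ψ z‖ ≤ r) : ‖B‖ ≤ r + err L ψ B := by
  refine (norm_le_VV_mul L B).trans ?_
  have : VV L * B = DD L ψ * VV L - (DD L ψ * VV L - VV L * B) := by abel
  rw [this]
  refine (norm_sub_le _ _).trans ?_
  gcongr
  · calc _ ≤ ‖DD L ψ‖ * ‖VV L‖ := l2_opNorm_mul _ _
      _ ≤ r * 1 := by
        gcongr
        · exact DD_norm_le L ψ r hr h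
        · exact VV_norm L
      _ = r := mul_one r
  · exact le_rfl

lemma Apx.mul {φ ψ : TT2 → ℂ} (h : Apx φ) (h' : Apx ψ) {r s : ℝ} (hr : 0 ≤ r) (hs : 0 ≤ s)
    (hφ : ∀ z, ‖φ z‖ ≤ r) (hψ : ∀ z, ‖ψ z‖ ≤ s) : Apx (fun z => φ z * ψ z) := by
  intro ε hε
  have h1 : 0 < ε / (2 * (r + 1)) := by positivity
  have h2 : 0 < ε / (2 * (s + 1)) := by positivity
  filter_upwards [h _ h2, h' (min 1 (ε / (2 * (r + 1)))) (by positivity)] with L ⟨A, hA⟩ ⟨B, hB⟩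
  have hB1 : err L ψ B ≤ 1 := hB.trans (min_le_left _ _)
  have hB2 : err L ψ B ≤ ε / (2 * (r + 1)) := hB.trans (min_le_right _ _)
  have hBn : ‖B‖ ≤ s + 1 := (norm_of_err hs hψ).trans (by linarith)
  refine ⟨A * B, (err_mul L φ ψ A B r hr hφ).trans ?_⟩
  have e0 : 0 ≤ err L φ A := norm_nonneg _
  have e1 : 0 ≤ err L ψ B := norm_nonneg _
  have e2 : 0 ≤ ‖B‖ := norm_nonneg _
  generalize err L ψ B = x at *
  generalize err L φ A = y at *
  generalize ‖B‖ = b at *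
  have t1 : r * x ≤ (r + 1) * (ε / (2 * (r + 1))) := mul_le_mul (by linarith) hB2 e1 (by linarith)
  have t2 : y * b ≤ ε / (2 * (s + 1)) * (s + 1) := mul_le_mul hA hBn e2 h2.le
  have t3 : (r + 1) * (ε / (2 * (r + 1))) = ε / 2 := by field_simp
  have t4 : ε / (2 * (s + 1)) * (s + 1) = ε / 2 := by field_simp
  linarith

lemma Apx.const (c : ℂ) : Apx (fun _ => c) := by
  intro ε hε
  refine Eventually.of_forall fun L => ⟨Matrix.diagonal (fun _ => c), ?_⟩
  refine (err_z1 L (fun _ => c) 0 le_rfl (fun a j _ => by simp)).trans hε.le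

lemma err_z1_tendsto (φ : C(Circle, ℂ)) (ε : ℝ) (hε : 0 < ε) :
    ∀ᶠ L in atTop, err L (fun z => φ z.1) (Matrix.diagonal fun j => φ (ee j)) ≤ ε := by
  have huc : UniformContinuous φ := CompactSpace.uniformContinuous_of_continuous φ.continuous
  obtain ⟨δ, hδ, h⟩ := Metric.uniformContinuous_iff.1 huc ε hε
  have h1 : Tendsto (fun L : ℕ => Real.pi * ((L:ℝ) + 2)⁻¹) atTop (𝓝 (Real.pi * 0)) :=
    Tendsto.const_mul _ (tendsto_inv_atTop_zero.comp
      (tendsto_atTop_add_const_right _ _ tendsto_natCast_atTop_atTop))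
  rw [mul_zero] at h1
  filter_upwards [h1.eventually_lt_const hδ] with L hL
  refine err_z1 L φ ε hε.le (fun a j haj => ?_)
  rw [← dist_eq_norm]
  exact (h ((ee_close a j haj).trans_lt hL)).le

lemma sqrt_tendsto (ε : ℝ) (hε : 0 < ε) : ∀ᶠ L : ℕ in atTop, Real.sqrt (2 * ((L:ℝ) + 2)⁻¹) ≤ ε := by
  have h1 : Tendsto (fun L : ℕ => 2 * ((L:ℝ) + 2)⁻¹) atTop (𝓝 (2 * 0)) :=
    Tendsto.const_mul _ (tendsto_inv_atTop_zero.comp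
      (tendsto_atTop_add_const_right _ _ tendsto_natCast_atTop_atTop))
  have h2 := h1.sqrt
  simp only [mul_zero, Real.sqrt_zero] at h2
  exact (h2.eventually_lt_const hε).mono fun L h => h.le

/-- Quantizable together with the adjoint. -/
def Apx2 (φ : C(TT2, ℂ)) : Prop := Apx φ ∧ Apx (star φ : C(TT2, ℂ))

lemma Apx2.star {φ : C(TT2, ℂ)} (h : Apx2 φ) : Apx2 (star φ) := by
  unfold Apx2
  rw [star_star]
  exact ⟨h.2, h.1⟩

lemma Apx2.mul {φ ψ : C(TT2, ℂ)} (h : Apx2 φ) (h' : Apx2 ψ) : Apx2 (φ * ψ) := by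
  have b : ∀ χ : C(TT2, ℂ), ∀ z, ‖χ z‖ ≤ ‖χ‖ := fun χ z => χ.norm_coe_le_norm z
  refine ⟨h.1.mul h'.1 (norm_nonneg _) (norm_nonneg _) (b φ) (b ψ), ?_⟩
  rw [star_mul]
  exact h'.2.mul h.2 (norm_nonneg _) (norm_nonneg _) (b _) (b _)

lemma Apx2.add {φ ψ : C(TT2, ℂ)} (h : Apx2 φ) (h' : Apx2 ψ) : Apx2 (φ + ψ) := by
  refine ⟨h.1.add h'.1, ?_⟩
  rw [star_add]
  exact h.2.add h'.2

def apxAlg : StarSubalgebra ℂ C(TT2, ℂ) where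
  carrier := {φ | Apx2 φ}
  mul_mem' := Apx2.mul
  add_mem' := Apx2.add
  algebraMap_mem' c := ⟨Apx.const c, Apx.const (star c)⟩
  star_mem' := Apx2.star

lemma apx_all (φ : C(TT2, ℂ)) : Apx φ := by
  have hz1 : (⟨fun z : TT2 => (z.1 : ℂ), by fun_prop⟩ : C(TT2, ℂ)) ∈ apxAlg := by
    refine ⟨fun ε hε => ?_, fun ε hε => ?_⟩
    · filter_upwards [err_z1_tendsto ⟨fun z => (z : ℂ), by fun_prop⟩ ε hε] with L hL
      exact ⟨_, hL⟩
    · filter_upwards [err_z1_tendsto ⟨fun z => star (z : ℂ), by fun_prop⟩ ε hε] with L hL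
      exact ⟨_, hL⟩
  have hz2 : (⟨fun z : TT2 => (z.2 : ℂ), by fun_prop⟩ : C(TT2, ℂ)) ∈ apxAlg := by
    refine ⟨fun ε hε => ?_, fun ε hε => ?_⟩
    · filter_upwards [sqrt_tendsto ε hε] with L hL
      exact ⟨_, (err_z2 L).trans hL⟩
    · filter_upwards [sqrt_tendsto ε hε] with L hL
      exact ⟨_, (err_z2' L).trans hL⟩
  have hsep : apxAlg.SeparatesPoints := by
    intro x y hxy
    by_cases h1 : x.1 = y.1
    · have h2 : x.2 ≠ y.2 := fun h => hxy (Prod.ext h1 h)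
      exact ⟨_, ⟨_, hz2, rfl⟩, fun h => h2 (Circle.ext h)⟩
    · exact ⟨_, ⟨_, hz1, rfl⟩, fun h => h1 (Circle.ext h)⟩
  have htop := ContinuousMap.starSubalgebra_topologicalClosure_eq_top_of_separatesPoints apxAlg hsep
  have hmem : φ ∈ apxAlg.topologicalClosure := by rw [htop]; trivial
  have hcl : φ ∈ closure (apxAlg : Set C(TT2, ℂ)) := hmem
  intro ε hε
  obtain ⟨ψ, hψ, hd⟩ := Metric.mem_closure_iff.1 hcl (ε/2) (by positivity)
  filter_upwards [hψ.1 (ε/2) (by positivity)] with L ⟨A, hA⟩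
  refine ⟨A, (err_close L φ ψ A (ε/2) (by positivity) (fun z => ?_)).trans (by linarith)⟩
  rw [← dist_eq_norm]
  exact (ContinuousMap.dist_apply_le_dist z).trans hd.le

lemma apx_unif {Y : Type} [TopologicalSpace Y] [CompactSpace Y] (φ : Y → TT2 → ℂ)
    (hφ : Continuous fun p : Y × TT2 => φ p.1 p.2) (ε : ℝ) (hε : 0 < ε) :
    ∀ᶠ L in atTop, ∀ y, ∃ A, err L (φ y) A ≤ ε := by
  let Φ : C(Y, C(TT2, ℂ)) := ContinuousMap.curry ⟨fun p : Y × TT2 => φ p.1 p.2, hφ⟩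
  have hcov := isCompact_univ (X := Y).elim_finite_subcover
    (fun y : Y => {y' | dist (Φ y') (Φ y) < ε/2})
    (fun y => isOpen_lt (by fun_prop) continuous_const)
    (fun y _ => Set.mem_iUnion.2 ⟨y, by simp [hε]⟩)
  obtain ⟨t, ht⟩ := hcov
  have h1 : ∀ᶠ L in atTop, ∀ y ∈ t, ∃ A, err L (φ y) A ≤ ε/2 :=
    (Filter.eventually_all_finset t).2 fun y _ => apx_all (Φ y) (ε/2) (by positivity)
  filter_upwards [h1] with L hL y
  obtain ⟨y0, hy0, hd⟩ : ∃ y0 ∈ t, dist (Φ y) (Φ y0) < ε/2 := by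
    simpa using ht (Set.mem_univ y)
  obtain ⟨A, hA⟩ := hL y0 hy0
  refine ⟨A, (err_close L (φ y) (φ y0) A (ε/2) (by positivity) (fun z => ?_)).trans (by linarith)⟩
  rw [← dist_eq_norm]
  exact (ContinuousMap.dist_apply_le_dist (f := Φ y) (g := Φ y0) z).trans hd.le

lemma tau_mul_unif {Y : Type} [TopologicalSpace Y] [CompactSpace Y] (φ ψ : Y → TT2 → ℂ)
    (hφ : Continuous fun p : Y × TT2 => φ p.1 p.2) (hψ : Continuous fun p : Y × TT2 => ψ p.1 p.2)
    (ε : ℝ) (hε : 0 < ε) :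
    ∀ᶠ L in atTop, ∀ y, ‖tau L (fun z => φ y z * ψ y z) - tau L (φ y) * tau L (ψ y)‖ ≤ ε := by
  obtain ⟨r, hr⟩ := isCompact_univ.exists_bound_of_continuousOn hφ.continuousOn
  have hr' : ∀ y z, ‖φ y z‖ ≤ |r| := fun y z => (hr (y, z) (Set.mem_univ _)).trans (le_abs_self r)
  filter_upwards [apx_unif ψ hψ (ε / (2 * (|r| + 1))) (by positivity)] with L hL y
  obtain ⟨B, hB⟩ := hL y
  refine (tau_mul_le L (φ y) (ψ y) B |r| (abs_nonneg r) (hr' y)).trans ?_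
  calc |r| * (2 * err L (ψ y) B) ≤ (|r| + 1) * (2 * (ε / (2 * (|r| + 1)))) := by
        have e0 : 0 ≤ err L (ψ y) B := norm_nonneg _
        exact mul_le_mul (by linarith) (by linarith) (by linarith) (by positivity)
    _ = ε := by field_simp

variable {κ : Type} [Fintype κ] [DecidableEq κ]

/-- Inclusion of a slot. -/
def slot {J : Type} (p : κ) : J ↪ κ × J := ⟨fun j => (p, j), fun _ _ h => (Prod.ext_iff.1 h).2⟩

lemma slot_apply {J : Type} (p : κ) (j : J) : slot p j = (p, j) := rfl

lemma norm_block {J : Type} [Fintype J] [DecidableEq J] (M : Matrix (κ × J) (κ × J) ℂ) :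
    ‖M‖ ≤ ∑ p, ∑ q, ‖M.submatrix (fun j : J => (p, j)) (fun j : J => (q, j))‖ := by
  have h : M = ∑ p, ∑ q, embP (slot p : J ↪ κ × J) *
      (M.submatrix (fun j : J => (p, j)) (fun j : J => (q, j)) * (embP (slot q : J ↪ κ × J))ᴴ) := by
    ext ⟨p, j⟩ ⟨q, i⟩
    simp only [Matrix.sum_apply, Matrix.mul_apply, embP_apply, conjTranspose_apply, slot_apply,
      submatrix_apply, Prod.mk.injEq]
    simp [apply_ite, ite_and, Finset.sum_ite_eq, Finset.sum_ite_eq']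
  have hn : ∀ p : κ, ‖embP (slot p : J ↪ κ × J)‖ ≤ 1 := fun p => norm_isom _ (embP_star_mul _)
  conv_lhs => rw [h]
  refine (norm_sum_le _ _).trans (Finset.sum_le_sum fun p _ => ?_)
  refine (norm_sum_le _ _).trans (Finset.sum_le_sum fun q _ => ?_)
  refine (l2_opNorm_mul _ _).trans ?_
  have h2 := l2_opNorm_mul (M.submatrix (fun j : J => (p, j)) (fun j : J => (q, j)))
    (embP (slot q : J ↪ κ × J))ᴴ
  rw [l2_opNorm_conjTranspose] at h2
  set x := ‖M.submatrix (fun j : J => (p, j)) (fun j : J => (q, j))‖ with hx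
  have hx0 : 0 ≤ x := norm_nonneg _
  calc _ ≤ 1 * (x * 1) := by
        gcongr
        · exact hn p
        · exact h2.trans (by gcongr; exact hn q)
    _ = x := by ring

/-- Matrix quantization. -/
noncomputable def TT (L : ℕ) (F : TT2 → Matrix κ κ ℂ) : Matrix (κ × JJ L) (κ × JJ L) ℂ :=
  Matrix.of fun x y => tau L (fun z => F z x.1 y.1) x.2 y.2

lemma tau_apply (L : ℕ) (φ : TT2 → ℂ) (i j : JJ L) :
    tau L φ i j = ∑ c : JJ L × JJ L, star (VV L c i) * φ (ee c.1, ee c.2) * VV L c j := by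
  rw [tau, Matrix.mul_apply]
  refine Finset.sum_congr rfl fun c _ => ?_
  rw [DD, Matrix.mul_diagonal, conjTranspose_apply]

lemma tau_const (L : ℕ) (c : ℂ) : tau L (fun _ => c) = c • 1 := by
  rw [tau, DD]
  have : (Matrix.diagonal (fun _ => c) : Matrix (JJ L × JJ L) (JJ L × JJ L) ℂ) = c • 1 := by
    rw [← diagonal_one, ← diagonal_smul]; congr 1; ext1; simp
  rw [this, Matrix.mul_smul, Matrix.smul_mul, Matrix.mul_one, VV_star_mul]

lemma TT_one (L : ℕ) : TT L (fun _ => (1 : Matrix κ κ ℂ)) = 1 := by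
  ext ⟨p, j⟩ ⟨q, i⟩
  simp only [TT, of_apply, tau_const, Matrix.smul_apply, Matrix.one_apply, Prod.mk.injEq]
  by_cases h1 : p = q <;> by_cases h2 : j = i <;> simp [h1, h2]

lemma TT_star (L : ℕ) (F : TT2 → Matrix κ κ ℂ) : TT L (fun z => (F z)ᴴ) = (TT L F)ᴴ := by
  ext ⟨p, j⟩ ⟨q, i⟩
  simp only [TT, of_apply, conjTranspose_apply, tau_apply, star_sum, star_mul', star_star]
  exact Finset.sum_congr rfl fun c _ => by ring

lemma TT_continuous {Y : Type} [TopologicalSpace Y] (L : ℕ) (F : Y → TT2 → Matrix κ κ ℂ)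
    (hF : ∀ z, Continuous fun y => F y z) : Continuous fun y => TT L (F y) := by
  refine continuous_matrix fun x y => ?_
  simp only [TT, of_apply, tau_apply]
  refine continuous_finsetSum _ fun c _ => ?_
  have := (hF (ee c.1, ee c.2)).matrix_elem x.1 y.1
  fun_prop

lemma TT_mul {Y : Type} [TopologicalSpace Y] [CompactSpace Y] (F G : Y → TT2 → Matrix κ κ ℂ)
    (hF : Continuous fun p : Y × TT2 => F p.1 p.2) (hG : Continuous fun p : Y × TT2 => G p.1 p.2)
    (ε : ℝ) (hε : 0 < ε) :
    ∀ᶠ L in atTop, ∀ y, ‖TT L (fun z => F y z * G y z) - TT L (F y) * TT L (G y)‖ ≤ ε := by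
  set δ := ε / (Fintype.card κ ^ 3 + 1) with hδ
  have h1 : ∀ᶠ L in atTop, ∀ p q r, ∀ y, ‖tau L (fun z => F y z p r * G y z r q) -
      tau L (fun z => F y z p r) * tau L (fun z => G y z r q)‖ ≤ δ := by
    simp only [eventually_all]
    intro p q r
    exact tau_mul_unif (fun y z => F y z p r) (fun y z => G y z r q) (hF.matrix_elem p r)
      (hG.matrix_elem r q) δ (by positivity)
  filter_upwards [h1] with L hL y
  refine (norm_block _).trans ?_
  have h2 : ∀ p q : κ, ‖(TT L (fun z => F y z * G y z) - TT L (F y) * TT L (G y)).submatrix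
      (fun j : JJ L => (p, j)) (fun j : JJ L => (q, j))‖ ≤ Fintype.card κ * δ := by
    intro p q
    have : (TT L (fun z => F y z * G y z) - TT L (F y) * TT L (G y)).submatrix
        (fun j : JJ L => (p, j)) (fun j : JJ L => (q, j)) = ∑ r, (tau L (fun z => F y z p r * G y z r q) -
      tau L (fun z => F y z p r) * tau L (fun z => G y z r q)) := by
      ext i j
      simp only [submatrix_apply, Matrix.sub_apply, Matrix.sum_apply, TT, of_apply, Matrix.mul_apply,
        Fintype.sum_prod_type, Finset.sum_sub_distrib]
      congr 1
      simp only [tau_apply, Matrix.mul_apply, Finset.mul_sum, Finset.sum_mul]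
      rw [Finset.sum_comm]
    rw [this]
    refine (norm_sum_le _ _).trans ?_
    calc _ ≤ ∑ r : κ, δ := Finset.sum_le_sum fun r _ => hL p q r y
      _ = _ := by simp
  calc _ ≤ ∑ p : κ, ∑ q : κ, (Fintype.card κ * δ) :=
        Finset.sum_le_sum fun p _ => Finset.sum_le_sum fun q _ => h2 p q
    _ = (Fintype.card κ : ℝ) ^ 3 * δ := by simp; ring
    _ ≤ ((Fintype.card κ : ℝ) ^ 3 + 1) * δ := by
        have : 0 < δ := by positivity
        nlinarith
    _ = ε := by rw [hδ]; field_simp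

lemma TT_norm_le (L : ℕ) (F : TT2 → Matrix κ κ ℂ) (r : ℝ) (h : ∀ z p q, ‖F z p q‖ ≤ r) (hr : 0 ≤ r) :
    ‖TT L F‖ ≤ (Fintype.card κ : ℝ) ^ 2 * r := by
  refine (norm_block _).trans ?_
  calc _ ≤ ∑ p : κ, ∑ q : κ, r := by
        refine Finset.sum_le_sum fun p _ => Finset.sum_le_sum fun q _ => ?_
        have : (TT L F).submatrix (fun j : JJ L => (p, j)) (fun j : JJ L => (q, j)) =
          tau L (fun z => F z p q) := by ext i j; rfl
        rw [this, tau]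
        calc _ ≤ ‖(VV L)ᴴ‖ * ‖DD L (fun z => F z p q)‖ * ‖VV L‖ := by
              refine (l2_opNorm_mul _ _).trans ?_
              gcongr; exact l2_opNorm_mul _ _
          _ ≤ 1 * r * 1 := by
              gcongr
              · exact VV_star_norm L
              · exact DD_norm_le L _ r hr (fun z => h z p q)
              · exact VV_norm L
          _ = r := by ring
    _ = _ := by simp; ring

end Asymp
end BottPf

namespace BottPf
set_option linter.unusedSectionVars false
set_option linter.unusedSimpArgs false
open scoped unitInterval Topology.Homotopy

/-! ### Descent to the torus -/
section Descent

/-- The circle parametrization. -/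
noncomputable def eT (s : I) : Circle := Circle.exp (2 * Real.pi * s)

lemma eT_continuous : Continuous eT := by unfold eT; fun_prop

lemma eT_zero : eT 0 = 1 := by simp [eT]
lemma eT_one : eT 1 = 1 := by simp [eT]

lemma eT_surj : Function.Surjective eT := by
  intro z
  obtain ⟨θ, hθ⟩ := Circle.exp_surjective z
  refine ⟨⟨Int.fract (θ / (2 * Real.pi)), Int.fract_nonneg _, (Int.fract_lt_one _).le⟩, ?_⟩
  rw [← hθ, eT, Circle.exp_eq_exp]
  refine ⟨-⌊θ / (2 * Real.pi)⌋, ?_⟩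
  have : Int.fract (θ / (2 * Real.pi)) = θ / (2 * Real.pi) - ⌊θ / (2 * Real.pi)⌋ := rfl
  simp only [this]
  have := Real.pi_pos
  field_simp
  push_cast
  ring

lemma eT_inj {s t : I} (h : eT s = eT t) : s = t ∨ ((s = 0 ∨ s = 1) ∧ (t = 0 ∨ t = 1)) := by
  rw [eT, eT, Circle.exp_eq_exp] at h
  obtain ⟨m, hm⟩ := h
  have hp := Real.pi_pos
  have h1 : (s : ℝ) = t + m := by
    have : 2 * Real.pi * (s : ℝ) = 2 * Real.pi * (t + m) := by rw [hm]; ring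
    exact mul_left_cancel₀ (by positivity) this
  have a1 := s.2.1; have a2 := s.2.2; have b1 := t.2.1; have b2 := t.2.2
  have m1 : m ≤ 1 := by
    have : (m : ℝ) ≤ 1 := by linarith
    exact_mod_cast this
  have m2 : -1 ≤ m := by
    have : (-1 : ℝ) ≤ m := by linarith
    exact_mod_cast this
  obtain h | h | h : m = -1 ∨ m = 0 ∨ m = 1 := by omega
  · subst h; right; push_cast at h1
    exact ⟨.inl (Subtype.ext (by change (s:ℝ) = 0; linarith)), .inr (Subtype.ext (by change (t:ℝ) = 1; linarith))⟩
  · subst h; left; exact Subtype.ext (by simpa using h1)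
  · subst h; right; push_cast at h1
    exact ⟨.inr (Subtype.ext (by change (s:ℝ) = 1; linarith)), .inl (Subtype.ext (by change (t:ℝ) = 0; linarith))⟩

/-- A section of the parametrization. -/
noncomputable def secT : Circle → I := Function.surjInv eT_surj
lemma eT_secT (z : Circle) : eT (secT z) = z := Function.surjInv_eq eT_surj z

variable {N : Type}

/-- Assemble coordinates. -/
def joinY {Z : Type} (x : N → Z) (s t : Z) : N ⊕ Fin 2 → Z := Sum.elim x ![s, t]

@[simp] lemma joinY_inl {Z : Type} (x : N → Z) (s t : Z) (n : N) : joinY x s t (.inl n) = x n := rfl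
@[simp] lemma joinY_zero {Z : Type} (x : N → Z) (s t : Z) : joinY x s t (.inr 0) = s := rfl
@[simp] lemma joinY_one {Z : Type} (x : N → Z) (s t : Z) : joinY x s t (.inr 1) = t := rfl

lemma joinY_eta {Z : Type} (y : N ⊕ Fin 2 → Z) :
    joinY (fun n => y (.inl n)) (y (.inr 0)) (y (.inr 1)) = y := by
  ext i; rcases i with i | i
  · rfl
  · fin_cases i <;> rfl

lemma joinY_continuous : Continuous fun p : (N → I) × I × I => joinY p.1 p.2.1 p.2.2 := by
  refine continuous_pi fun i => ?_
  rcases i with i | i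
  · simp only [joinY_inl]; fun_prop
  · fin_cases i
    · change Continuous fun p : (N → I) × I × I => p.2.1; fun_prop
    · change Continuous fun p : (N → I) × I × I => p.2.2; fun_prop

lemma joinY_bd_inl {x : N → I} (hx : x ∈ Cube.boundary N) (s t : I) :
    joinY x s t ∈ Cube.boundary (N ⊕ Fin 2) := by
  obtain ⟨i, hi⟩ := hx; exact ⟨.inl i, hi⟩

lemma joinY_bd0 (x : N → I) {s : I} (hs : s = 0 ∨ s = 1) (t : I) :
    joinY x s t ∈ Cube.boundary (N ⊕ Fin 2) := ⟨.inr 0, hs⟩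

lemma joinY_bd1 (x : N → I) (s : I) {t : I} (ht : t = 0 ∨ t = 1) :
    joinY x s t ∈ Cube.boundary (N ⊕ Fin 2) := ⟨.inr 1, ht⟩

lemma desc_val {X : Type} {c : X} (f : (N ⊕ Fin 2 → I) → X)
    (hb : ∀ y ∈ Cube.boundary (N ⊕ Fin 2), f y = c) (x : N → I) (s t : I) :
    f (joinY x (secT (eT s)) (secT (eT t))) = f (joinY x s t) := by
  rcases eT_inj (eT_secT (eT s)) with h | ⟨h, h'⟩
  · rcases eT_inj (eT_secT (eT t)) with k | ⟨k, k'⟩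
    · rw [h, k]
    · rw [hb _ (joinY_bd1 _ _ k), hb _ (joinY_bd1 _ _ k')]
  · rw [hb _ (joinY_bd0 _ h _), hb _ (joinY_bd0 _ h' _)]

lemma desc_continuous {X Y : Type} [TopologicalSpace X] [TopologicalSpace Y] [CompactSpace Y] [T2Space Y]
    {c : X} (H : Y → (N ⊕ Fin 2 → I) → X)
    (hH : Continuous fun p : Y × (N ⊕ Fin 2 → I) => H p.1 p.2)
    (hb : ∀ y, ∀ v ∈ Cube.boundary (N ⊕ Fin 2), H y v = c) :
    Continuous fun p : (Y × (N → I)) × TT2 => H p.1.1 (joinY p.1.2 (secT p.2.1) (secT p.2.2)) := by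
  let q : (Y × (N → I)) × I × I → (Y × (N → I)) × TT2 := fun p => (p.1, eT p.2.1, eT p.2.2)
  have hq : Continuous q := by
    have := eT_continuous
    fun_prop
  have hs : Function.Surjective q := fun p => ⟨(p.1, secT p.2.1, secT p.2.2), by
    simp only [q, eT_secT]⟩
  have hquot : IsQuotientMap q := (hq.isClosedMap).isQuotientMap hq hs
  rw [hquot.continuous_iff]
  have h1 : Continuous fun p : (Y × (N → I)) × I × I => H p.1.1 (joinY p.1.2 p.2.1 p.2.2) :=
    hH.comp ((by fun_prop : Continuous fun p : (Y × (N → I)) × I × I => p.1.1).prodMk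
      (joinY_continuous.comp (by fun_prop : Continuous fun p : (Y × (N → I)) × I × I =>
        (p.1.2, p.2.1, p.2.2))))
  exact h1.congr fun p => (desc_val (H p.1.1) (hb p.1.1) p.1.2 p.2.1 p.2.2).symm

end Descent

/-! ### The quantization map on loops -/
section Alpha
open scoped Matrix.Norms.L2Operator MatrixOrder ComplexOrder
open Filter
variable {N ι : Type} [Fintype ι] [DecidableEq ι]

lemma norm_sub_pol {A : Matrix ι ι ℂ} (hA : IsUnit A) :
    ‖A - (pol A : Matrix ι ι ℂ)‖ ≤ ‖Aᴴ * A - 1‖ := by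
  have hB : (0 : Matrix ι ι ℂ) ≤ Aᴴ * A := (posSemidef_conjTranspose_mul_self A).nonneg
  have hsa : IsSelfAdjoint (Aᴴ * A) := .of_nonneg hB
  have h1 : ‖posP A - 1‖ ≤ ‖Aᴴ * A - 1‖ := by
    have e1 : posP A - 1 = cfc (fun x : ℝ => Real.sqrt x - 1) (Aᴴ * A) := by
      rw [posP, CFC.sqrt_eq_real_sqrt _ hB, cfc_sub .., cfc_const_one ℝ (Aᴴ * A), cfcₙ_eq_cfc]
    have e2 : Aᴴ * A - 1 = cfc (fun x : ℝ => x - 1) (Aᴴ * A) := by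
      rw [cfc_sub .., cfc_const_one ℝ (Aᴴ * A), cfc_id' ℝ (Aᴴ * A)]
    rw [e1]
    refine norm_cfc_le (norm_nonneg _) fun x hx => ?_
    have h0 : 0 ≤ x := spectrum_nonneg_of_nonneg hB hx
    have h2 : ‖x - 1‖ ≤ ‖Aᴴ * A - 1‖ := by
      rw [e2]
      exact norm_apply_le_norm_cfc (fun x : ℝ => x - 1) (Aᴴ * A) hx
    refine le_trans ?_ h2
    have h3 : x - 1 = (Real.sqrt x - 1) * (Real.sqrt x + 1) := by
      have := Real.mul_self_sqrt h0; nlinarith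
    rw [h3, norm_mul]
    refine le_mul_of_one_le_right (norm_nonneg _) ?_
    have := Real.sqrt_nonneg x
    rw [Real.norm_of_nonneg (by linarith)]; linarith
  have h2 : A - (pol A : Matrix ι ι ℂ) = (pol A : Matrix ι ι ℂ) * (posP A - 1) := by
    rw [Matrix.mul_sub, pol_mul_posP hA, Matrix.mul_one]
  rw [h2]
  calc _ ≤ ‖(pol A : Matrix ι ι ℂ)‖ * ‖posP A - 1‖ := l2_opNorm_mul _ _
    _ ≤ 1 * ‖posP A - 1‖ := by gcongr; exact U_norm_le _
    _ ≤ _ := by rw [one_mul]; exact h1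

lemma isUnit_of_star {A : Matrix ι ι ℂ} (h : ‖Aᴴ * A - 1‖ < 1) : IsUnit A := by
  have : IsUnit (Aᴴ * A) := isUnit_of_close 1 (by simpa using h)
  rw [Matrix.isUnit_iff_isUnit_det] at this ⊢
  rw [Matrix.det_mul] at this
  exact isUnit_of_mul_isUnit_right this

/-- Quantized loop, as matrices. -/
noncomputable def TL (L : ℕ) (f : (N ⊕ Fin 2 → I) → U ι) (x : N → I) :
    Matrix (ι × JJ L) (ι × JJ L) ℂ :=
  TT L (fun z => (f (joinY x (secT z.1) (secT z.2)) : Matrix ι ι ℂ))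

lemma TL_bd (L : ℕ) (f : (N ⊕ Fin 2 → I) → U ι) (hb : ∀ v ∈ Cube.boundary (N ⊕ Fin 2), f v = 1)
    (x : N → I) (hx : x ∈ Cube.boundary N) : TL L f x = 1 := by
  rw [← TT_one, TL]; congr 1; ext1 z
  rw [hb _ (joinY_bd_inl hx _ _)]; rfl

lemma TL_near {Y : Type} [TopologicalSpace Y] [CompactSpace Y] [T2Space Y]
    (H : Y → (N ⊕ Fin 2 → I) → U ι)
    (hH : Continuous fun p : Y × (N ⊕ Fin 2 → I) => H p.1 p.2)
    (hb : ∀ y, ∀ v ∈ Cube.boundary (N ⊕ Fin 2), H y v = 1) (ε : ℝ) (hε : 0 < ε) :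
    ∀ᶠ L in atTop, ∀ y x, ‖(TL L (H y) x)ᴴ * TL L (H y) x - 1‖ ≤ ε := by
  have hc := (continuous_subtype_val (p := fun A => A ∈ Matrix.unitaryGroup ι ℂ)).comp
    (desc_continuous H hH hb)
  have h := TT_mul (Y := Y × (N → I))
    (fun p z => ((H p.1 (joinY p.2 (secT z.1) (secT z.2)) : U ι) : Matrix ι ι ℂ)ᴴ)
    (fun p z => ((H p.1 (joinY p.2 (secT z.1) (secT z.2)) : U ι) : Matrix ι ι ℂ))
    hc.matrix_conjTranspose hc ε hε
  filter_upwards [h] with L hL y x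
  have h1 := hL (y, x)
  simp only [U_star_mul] at h1
  rw [TT_one, TT_star, norm_sub_rev] at h1
  exact h1

lemma TL_continuous {Y : Type} [TopologicalSpace Y] (L : ℕ)
    (H : Y → (N ⊕ Fin 2 → I) → U ι)
    (hH : Continuous fun p : Y × (N ⊕ Fin 2 → I) => H p.1 p.2) :
    Continuous fun p : Y × (N → I) => TL L (H p.1) p.2 := by
  refine TT_continuous L _ fun z => continuous_subtype_val.comp (hH.comp (continuous_fst.prodMk ?_))
  exact joinY_continuous.comp (by fun_prop : Continuous fun p : Y × (N → I) =>
        (p.2, secT z.1, secT z.2))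

lemma TL_cont1 (L : ℕ) (f : Ω^ (N ⊕ Fin 2) (U ι) (1 : U ι)) : Continuous fun x : N → I => TL L f x := by
  refine TT_continuous L _ fun z => continuous_subtype_val.comp ((contL f).comp ?_)
  exact joinY_continuous.comp (by fun_prop : Continuous fun p : (N → I) =>
        (p, secT z.1, secT z.2))

lemma pol_one' : pol (1 : Matrix ι ι ℂ) = 1 := pol_U 1

lemma TL_pol_bd (L : ℕ) (f : Ω^ (N ⊕ Fin 2) (U ι) (1 : U ι)) (x : N → I) (hx : x ∈ Cube.boundary N) :
    pol (TL L f x) = 1 := by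
  rw [TL_bd L f (GenLoop.boundary f) x hx, pol_one']

noncomputable def alpha (L : ℕ) (f : Ω^ (N ⊕ Fin 2) (U ι) (1 : U ι)) : Ω^ N (U (ι × JJ L)) (1 : U (ι × JJ L)) :=
  open Classical in
  if h : ∀ x, IsUnit (TL L f x) then
    mkL (fun x => pol (TL L f x)) (pol_continuous _ (TL_cont1 L f) h) (TL_pol_bd L f)
  else 1

lemma alpha_apply (L : ℕ) (f : Ω^ (N ⊕ Fin 2) (U ι) (1 : U ι)) (h : ∀ x, IsUnit (TL L f x)) (x : N → I) :
    alpha L f x = pol (TL L f x) := by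
  rw [alpha, dif_pos h]; rfl

lemma alpha_good (f : Ω^ (N ⊕ Fin 2) (U ι) (1 : U ι)) (ε : ℝ) (hε : 0 < ε) :
    ∀ᶠ L in atTop, (∀ x, IsUnit (TL L f x)) ∧
      ∀ x, ‖TL L f x - (alpha L f x : Matrix (ι × JJ L) (ι × JJ L) ℂ)‖ ≤ ε := by
  filter_upwards [TL_near (Y := Unit) (fun _ => f) ((contL f).comp continuous_snd)
    (fun _ => GenLoop.boundary f) (min ε (1/2)) (by positivity)] with L hL
  have h1 : ∀ x, IsUnit (TL L f x) := fun x => isUnit_of_star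
    (((hL () x).trans (min_le_right _ _)).trans_lt (by norm_num))
  refine ⟨h1, fun x => ?_⟩
  rw [alpha_apply L f h1]
  exact (norm_sub_pol (h1 x)).trans ((hL () x).trans (min_le_left _ _))

lemma alpha_homotopic {f g : Ω^ (N ⊕ Fin 2) (U ι) (1 : U ι)} (h : GenLoop.Homotopic f g) :
    ∀ᶠ L in atTop, GenLoop.Homotopic (alpha L f) (alpha L g) := by
  obtain ⟨H, hc, h0, h1, hb⟩ := exH h
  filter_upwards [TL_near (Y := I) (fun t v => H (t, v)) hc hb (1/2) (by norm_num)] with L hL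
  have hu : ∀ t x, IsUnit (TL L (fun v => H (t, v)) x) := fun t x => isUnit_of_star
    ((hL t x).trans_lt (by norm_num))
  have e0 : (fun v => H (0, v)) = f := funext h0
  have e1 : (fun v => H (1, v)) = g := funext h1
  refine mkH (fun p => pol (TL L (fun v => H (p.1, v)) p.2)) (pol_continuous _
    (TL_continuous L (fun t v => H (t, v)) hc) fun p => hu _ _) (fun x => ?_) (fun x => ?_) fun t x hx => ?_
  · rw [alpha_apply L f (by rw [← e0]; exact hu 0)]; simp only [e0]
  · rw [alpha_apply L g (by rw [← e1]; exact hu 1)]; simp only [e1]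
  · rw [TL_bd L _ (hb t) x hx]; exact pol_one'

lemma alpha_close (L : ℕ) (f : Ω^ (N ⊕ Fin 2) (U ι) (1 : U ι)) (g : Ω^ N (U (ι × JJ L)) (1 : U (ι × JJ L)))
    (h : ∀ x, ‖TL L f x - (g x : Matrix (ι × JJ L) (ι × JJ L) ℂ)‖ < 1) :
    GenLoop.Homotopic (alpha L f) g :=
  pol_homotopic (F := TL L f) (TL_cont1 L f) g _
    (alpha_apply L f fun x => isUnit_of_close _ (h x)) h (TL_bd L f (GenLoop.boundary f))

end Alpha
end BottPf

namespace BottPf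
set_option linter.unusedSectionVars false
set_option linter.unusedSimpArgs false
open scoped unitInterval Topology.Homotopy

/-! ### Amplification by projections -/
section Amp
variable {ι τ κ : Type} [Fintype ι] [DecidableEq ι] [Fintype τ] [DecidableEq τ] [Fintype κ] [DecidableEq κ]

/-- `A` on the range of `P`, identity on the complement. -/
def amp (A : Matrix ι ι ℂ) (P : Matrix τ τ ℂ) : Matrix (ι × τ) (ι × τ) ℂ := A ⊗ₖ P + 1 ⊗ₖ (1 - P)

lemma amp_eq (A : Matrix ι ι ℂ) (P : Matrix τ τ ℂ) : amp A P = (A - 1) ⊗ₖ P + 1 := by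
  ext ⟨i, p⟩ ⟨j, q⟩
  simp only [amp, Matrix.add_apply, kroneckerMap_apply, Matrix.sub_apply, Matrix.one_apply, Prod.mk.injEq,
    ite_and]
  by_cases h1 : i = j <;> by_cases h2 : p = q <;> simp [h1, h2] <;> ring

lemma amp_one (P : Matrix τ τ ℂ) : amp (1 : Matrix ι ι ℂ) P = 1 := by simp [amp_eq]

lemma amp_mul (A B : Matrix ι ι ℂ) {P : Matrix τ τ ℂ} (h : P * P = P) :
    amp (A * B) P = amp A P * amp B P := by
  simp only [amp_eq, Matrix.add_mul, Matrix.mul_add, Matrix.one_mul, Matrix.mul_one, ← mul_kronecker_mul, h]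
  rw [← add_assoc, ← add_kronecker, ← add_kronecker]
  congr 2
  noncomm_ring

lemma amp_star (A : Matrix ι ι ℂ) {P : Matrix τ τ ℂ} (h : Pᴴ = P) : (amp A P)ᴴ = amp Aᴴ P := by
  simp [amp_eq, conjTranspose_kronecker, h]

/-- Orthogonal projections. -/
abbrev Prj (τ : Type) [Fintype τ] [DecidableEq τ] := {P : Matrix τ τ ℂ // Pᴴ = P ∧ P * P = P}

/-- Amplification as a unitary. -/
def ampU (P : Prj τ) (A : U ι) : U (ι × τ) :=
  ⟨amp (A : Matrix ι ι ℂ) P.1, mem_U (by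
    rw [amp_star _ P.2.1, ← amp_mul _ _ P.2.2, U_star_mul, amp_one])⟩

lemma ampU_coe (P : Prj τ) (A : U ι) : (ampU P A : Matrix (ι × τ) (ι × τ) ℂ) = amp (A : Matrix ι ι ℂ) P.1 := rfl

lemma ampU_one (P : Prj τ) : ampU P (1 : U ι) = 1 := Subtype.ext (by rw [ampU_coe, U_coe_one, amp_one, U_coe_one])

lemma ampU_mul (P : Prj τ) (A B : U ι) : ampU P (A * B) = ampU P A * ampU P B :=
  Subtype.ext (by rw [ampU_coe, U_coe_mul, amp_mul _ _ P.2.2, U_coe_mul, ampU_coe, ampU_coe])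

lemma ampU_inv_coe (P : Prj τ) (A : U ι) :
    (((ampU P A)⁻¹ : U (ι × τ)) : Matrix (ι × τ) (ι × τ) ℂ) = (amp (A : Matrix ι ι ℂ) P.1)ᴴ := by
  rw [U_coe_inv, ampU_coe]

lemma amp_continuous {Y : Type} [TopologicalSpace Y] (P : Y → Matrix τ τ ℂ) (A : Y → Matrix ι ι ℂ)
    (hP : Continuous P) (hA : Continuous A) : Continuous fun y => amp (A y) (P y) := by
  refine continuous_matrix fun x y => ?_
  simp only [amp_eq, Matrix.add_apply, kroneckerMap_apply, Matrix.sub_apply]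
  have h1 := hP.matrix_elem x.2 y.2
  have h2 := hA.matrix_elem x.1 y.1
  fun_prop

lemma ampU_continuous {Y : Type} [TopologicalSpace Y] (P : Y → Prj τ) (A : Y → U ι)
    (hP : Continuous P) (hA : Continuous A) : Continuous fun y => ampU (P y) (A y) := by
  rw [Topology.IsInducing.subtypeVal.continuous_iff]
  exact amp_continuous _ _ (continuous_subtype_val.comp hP) (continuous_subtype_val.comp hA)


end Amp
end BottPf

namespace BottPf
set_option linter.unusedSectionVars false
set_option linter.unusedSimpArgs false
open scoped unitInterval Topology.Homotopy

section AmpNorm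
open scoped Matrix.Norms.L2Operator
variable {ι τ κ : Type} [Fintype ι] [DecidableEq ι] [Fintype τ] [DecidableEq τ] [Fintype κ] [DecidableEq κ]

lemma norm_submatrix_le (e : κ ≃ ι) (M : Matrix ι ι ℂ) : ‖M.submatrix e e‖ ≤ ‖M‖ := by
  have h : M.submatrix e e = (embP e.toEmbedding)ᴴ * (M * embP e.toEmbedding) := by
    ext i j
    simp [Matrix.mul_apply, embP_apply]
  have hn : ‖embP e.toEmbedding‖ ≤ 1 := norm_isom _ (embP_star_mul _)
  rw [h]
  calc _ ≤ ‖(embP e.toEmbedding)ᴴ‖ * (‖M‖ * ‖embP e.toEmbedding‖) := by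
        refine (l2_opNorm_mul _ _).trans ?_
        gcongr; exact l2_opNorm_mul _ _
    _ ≤ 1 * (‖M‖ * 1) := by
        rw [l2_opNorm_conjTranspose]; gcongr
    _ = _ := by ring

lemma kron_norm_left (A : Matrix ι ι ℂ) (P : Matrix τ τ ℂ) (r : ℝ) (hA : ∀ i j, ‖A i j‖ ≤ r) :
    ‖A ⊗ₖ P‖ ≤ (Fintype.card ι : ℝ) ^ 2 * r * ‖P‖ := by
  refine (norm_block _).trans ?_
  calc _ ≤ ∑ p : ι, ∑ q : ι, r * ‖P‖ := by
        refine Finset.sum_le_sum fun p _ => Finset.sum_le_sum fun q _ => ?_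
        have : (A ⊗ₖ P).submatrix (fun j : τ => (p, j)) (fun j : τ => (q, j)) = A p q • P := by
          ext i j; simp
        rw [this, norm_smul]
        gcongr; exact hA p q
    _ = _ := by simp; ring

lemma kron_norm_right (A : Matrix ι ι ℂ) (P : Matrix τ τ ℂ) (r : ℝ) (hP : ∀ i j, ‖P i j‖ ≤ r) :
    ‖A ⊗ₖ P‖ ≤ (Fintype.card τ : ℝ) ^ 2 * r * ‖A‖ := by
  have h : A ⊗ₖ P = (P ⊗ₖ A).submatrix (Equiv.prodComm ι τ) (Equiv.prodComm ι τ) := by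
    ext i j; simp [mul_comm]
  rw [h]
  exact (norm_submatrix_le _ _).trans (kron_norm_left P A r hP)

lemma amp_norm_P (A : U ι) (P P' : Matrix τ τ ℂ) :
    ‖amp (A : Matrix ι ι ℂ) P - amp (A : Matrix ι ι ℂ) P'‖ ≤ (Fintype.card ι : ℝ) ^ 2 * 2 * ‖P - P'‖ := by
  have h : amp (A : Matrix ι ι ℂ) P - amp (A : Matrix ι ι ℂ) P' = ((A : Matrix ι ι ℂ) - 1) ⊗ₖ (P - P') := by
    rw [amp_eq, amp_eq]
    ext i j; simp [Matrix.sub_apply]; ring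
  rw [h]
  refine kron_norm_left _ _ 2 fun i j => ?_
  rw [Matrix.sub_apply]
  refine (norm_sub_le _ _).trans ?_
  have h1 := entry_norm_bound_of_unitary A.2 i j
  have h2 : ‖(1 : Matrix ι ι ℂ) i j‖ ≤ 1 := by rw [Matrix.one_apply]; split_ifs <;> simp
  linarith

lemma amp_norm_A (A A' : Matrix ι ι ℂ) (P : Matrix τ τ ℂ) (r : ℝ) (hP : ∀ i j, ‖P i j‖ ≤ r) :
    ‖amp A P - amp A' P‖ ≤ (Fintype.card τ : ℝ) ^ 2 * r * ‖A - A'‖ := by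
  have h : amp A P - amp A' P = (A - A') ⊗ₖ P := by
    rw [amp_eq, amp_eq]
    ext i j; simp [Matrix.sub_apply]; ring
  rw [h]
  exact kron_norm_right _ _ r hP

lemma tau_affine (L : ℕ) (a b : ℂ) (φ : TT2 → ℂ) :
    tau L (fun z => a * φ z + b) = a • tau L φ + b • 1 := by
  rw [← tau_const]
  ext i j
  simp only [tau_apply, Matrix.add_apply, Matrix.smul_apply, smul_eq_mul, Finset.mul_sum, ← Finset.sum_add_distrib]
  exact Finset.sum_congr rfl fun c _ => by ring

lemma TT_amp_P (L : ℕ) (A : Matrix ι ι ℂ) (Q : TT2 → Matrix τ τ ℂ) :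
    TT L (fun z => amp A (Q z)) =
      (amp A (TT L Q)).submatrix (Equiv.prodAssoc ι τ (JJ L)) (Equiv.prodAssoc ι τ (JJ L)) := by
  ext ⟨⟨i, p⟩, j⟩ ⟨⟨i', p'⟩, j'⟩
  simp only [TT, of_apply, amp_eq, Matrix.add_apply, kroneckerMap_apply, tau_affine, submatrix_apply,
    Equiv.prodAssoc_apply, Matrix.smul_apply, smul_eq_mul, Matrix.one_apply, Prod.mk.injEq]
  by_cases h1 : i = i' <;> by_cases h2 : p = p' <;> by_cases h3 : j = j' <;> simp [h1, h2, h3]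

/-- Exchange of the last two factors. -/
def exch (ι J τ : Type) : (ι × τ) × J ≃ (ι × J) × τ where
  toFun x := ((x.1.1, x.2), x.1.2)
  invFun x := ((x.1.1, x.2), x.1.2)
  left_inv _ := rfl
  right_inv _ := rfl

lemma TT_amp_A (L : ℕ) (F : TT2 → Matrix ι ι ℂ) (P : Matrix τ τ ℂ) :
    TT L (fun z => amp (F z) P) =
      (amp (TT L F) P).submatrix (exch ι (JJ L) τ) (exch ι (JJ L) τ) := by
  ext ⟨⟨i, p⟩, j⟩ ⟨⟨i', p'⟩, j'⟩
  have h : ∀ z, amp (F z) P (i, p) (i', p') = P p p' * F z i i' + ((1 : Matrix (ι × τ) (ι × τ) ℂ) (i, p) (i', p') -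
      (1 : Matrix ι ι ℂ) i i' * P p p') := by
    intro z; rw [amp_eq, Matrix.add_apply, kroneckerMap_apply, Matrix.sub_apply]; ring
  simp only [TT, of_apply, h, tau_affine, submatrix_apply, exch, Equiv.coe_fn_mk]
  simp only [amp_eq, Matrix.add_apply, kroneckerMap_apply, Matrix.sub_apply,
    Matrix.smul_apply, smul_eq_mul, Matrix.one_apply, Prod.mk.injEq, of_apply]
  by_cases h1 : i = i' <;> by_cases h2 : p = p' <;> by_cases h3 : j = j' <;> simp [h1, h2, h3] <;> ring

end AmpNorm

/-! ### The Bott projection and the Bott map -/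
section Bott

/-- off-diagonal coefficients -/
noncomputable def yp (z : Circle) : ℝ := max (z : ℂ).im 0
/-- off-diagonal coefficients -/
noncomputable def yn (z : Circle) : ℝ := max (-(z : ℂ).im) 0

lemma yp_continuous : Continuous yp := by unfold yp; fun_prop
lemma yn_continuous : Continuous yn := by unfold yn; fun_prop

lemma yp_mul_yn (z : Circle) : yp z * yn z = 0 := by
  unfold yp yn
  rcases le_total 0 (z : ℂ).im with h | h
  · rw [max_eq_right (a := -(z : ℂ).im) (by linarith), mul_zero]
  · rw [max_eq_right h, zero_mul]

lemma yp_sq (z : Circle) : yp z ^ 2 + yn z ^ 2 = 1 - (z : ℂ).re ^ 2 := by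
  have h : (z : ℂ).re ^ 2 + (z : ℂ).im ^ 2 = 1 := by
    have := Circle.normSq_coe z
    rw [Complex.normSq_apply] at this; linarith
  unfold yp yn
  rcases le_total 0 (z : ℂ).im with h' | h'
  · rw [max_eq_right (a := -(z : ℂ).im) (by linarith), max_eq_left h']; linarith
  · rw [max_eq_right h', max_eq_left (a := -(z : ℂ).im) (by linarith)]; linarith

/-- off-diagonal entry -/
noncomputable def off (z : TT2) : ℂ := ((yp z.1 / 2 : ℝ) : ℂ) * (z.2 : ℂ) + ((yn z.1 / 2 : ℝ) : ℂ)

/-- The Bott projection. -/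
noncomputable def QM (z : TT2) : Matrix (Fin 2) (Fin 2) ℂ :=
  !![(((1 + (z.1 : ℂ).re) / 2 : ℝ) : ℂ), star (off z); off z, (((1 - (z.1 : ℂ).re) / 2 : ℝ) : ℂ)]

lemma off_mul (z : TT2) : off z * star (off z) = (((1 - (z.1 : ℂ).re ^ 2) / 4 : ℝ) : ℂ) := by
  have h1 : (z.2 : ℂ) * star (z.2 : ℂ) = 1 := by
    have := Complex.mul_conj (z.2 : ℂ)
    rw [Circle.normSq_coe] at this; simpa using this
  have h2 : ((yp z.1 : ℝ) : ℂ) * ((yn z.1 : ℝ) : ℂ) = 0 := by exact_mod_cast yp_mul_yn z.1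
  have h3 : ((yp z.1 : ℝ) : ℂ) ^ 2 + ((yn z.1 : ℝ) : ℂ) ^ 2 = 1 - (((z.1 : ℂ).re : ℝ) : ℂ) ^ 2 := by
    exact_mod_cast yp_sq z.1
  have h4 : star (off z) = ((yp z.1 / 2 : ℝ) : ℂ) * star (z.2 : ℂ) + ((yn z.1 / 2 : ℝ) : ℂ) := by
    simp [off]
  rw [h4, off]
  push_cast
  linear_combination (↑(yp z.1) ^ 2 / 4 : ℂ) * h1 + ((z.2 : ℂ) + star (z.2 : ℂ)) / 4 * h2 + h3 / 4

lemma off_continuous : Continuous off := by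
  have := yp_continuous
  have := yn_continuous
  unfold off
  fun_prop

lemma QM_continuous : Continuous QM := by
  have := off_continuous
  refine continuous_matrix fun i j => ?_
  fin_cases i <;> fin_cases j <;> simp [QM] <;> fun_prop

lemma QM_star (z : TT2) : (QM z)ᴴ = QM z := by
  ext i j
  fin_cases i <;> fin_cases j <;> simp [QM]

lemma QM_idem (z : TT2) : QM z * QM z = QM z := by
  have h := off_mul z
  push_cast at h
  ext i j
  fin_cases i <;> fin_cases j <;> simp [QM, Matrix.mul_apply, Fin.sum_univ_two] <;>
   [skip; ring; ring; skip]
  all_goals (simp at h; linear_combination h)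

lemma QM_entry (z : TT2) (i j : Fin 2) : ‖QM z i j‖ ≤ 1 := by
  have h1 : |(z.1 : ℂ).re| ≤ 1 := by
    have := Complex.abs_re_le_norm (z.1 : ℂ)
    have h2 : ‖(z.1 : ℂ)‖ = 1 := Circle.norm_coe _
    linarith
  obtain ⟨h2, h3⟩ := abs_le.1 h1
  have h4 : ‖off z‖ ≤ 1 := by
    have h := off_mul z
    have h5 : off z * star (off z) = ((‖off z‖ ^ 2 : ℝ) : ℂ) := by
      have := Complex.mul_conj' (off z); push_cast; exact this
    rw [h5] at h
    have h6 : ‖off z‖ ^ 2 = (1 - (z.1 : ℂ).re ^ 2) / 4 := by exact_mod_cast h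
    nlinarith [norm_nonneg (off z), sq_nonneg (z.1 : ℂ).re]
  fin_cases i <;> fin_cases j
  · change ‖(((1 + (z.1 : ℂ).re) / 2 : ℝ) : ℂ)‖ ≤ 1
    rw [Complex.norm_real, Real.norm_eq_abs, abs_le]; constructor <;> linarith
  · change ‖star (off z)‖ ≤ 1
    rwa [norm_star]
  · exact h4
  · change ‖(((1 - (z.1 : ℂ).re) / 2 : ℝ) : ℂ)‖ ≤ 1
    rw [Complex.norm_real, Real.norm_eq_abs, abs_le]; constructor <;> linarith

/-- The Bott projection. -/
noncomputable def QP (z : TT2) : Prj (Fin 2) := ⟨QM z, QM_star z, QM_idem z⟩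

lemma QP_continuous : Continuous QP := by
  exact QM_continuous.subtype_mk _

lemma QP_one (z : Circle) : QP (1, z) = QP (1, 1) := by
  apply Subtype.ext
  simp [QP, QM, off, yp, yn]

variable {N ι : Type} [Fintype ι] [DecidableEq ι]

/-- Pointwise Bott map. -/
noncomputable def betaF (z : TT2) (u : U ι) : U (ι × Fin 2) :=
  ampU (QP z) u * (ampU (QP (z.1, 1)) u)⁻¹

lemma betaF_one (z : TT2) : betaF z (1 : U ι) = 1 := by simp [betaF, ampU_one]
lemma betaF_z1 (z : Circle) (u : U ι) : betaF (1, z) u = 1 := by simp [betaF, QP_one z]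
lemma betaF_z2 (z : Circle) (u : U ι) : betaF (z, 1) u = 1 := by simp [betaF]

lemma betaF_continuous {Y : Type} [TopologicalSpace Y] (z : Y → TT2) (u : Y → U ι) (hz : Continuous z)
    (hu : Continuous u) : Continuous fun y => betaF (z y) (u y) := by
  have h1 := ampU_continuous (fun y => QP (z y)) u (QP_continuous.comp hz) hu
  have h2 := ampU_continuous (fun y => QP ((z y).1, 1)) u (QP_continuous.comp (by fun_prop)) hu
  unfold betaF
  exact h1.mul h2.inv

attribute [irreducible] betaF

lemma betaF_bd {y : N ⊕ Fin 2 → I} (hy : y ∈ Cube.boundary (N ⊕ Fin 2)) (u : U ι)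
    (hu : (fun n => y (.inl n)) ∈ Cube.boundary N → u = 1) :
    betaF (eT (y (.inr 0)), eT (y (.inr 1))) u = 1 := by
  obtain ⟨i | i, hi⟩ := hy
  · rw [hu ⟨i, hi⟩, betaF_one]
  · have he : eT (y (.inr i)) = 1 := by
      rcases hi with hi | hi <;> rw [hi]
      · exact eT_zero
      · exact eT_one
    fin_cases i
    · change eT (y (.inr 0)) = 1 at he; rw [he, betaF_z1]
    · change eT (y (.inr 1)) = 1 at he; rw [he, betaF_z2]

lemma coord_continuous : Continuous fun y : N ⊕ Fin 2 → I => ((eT (y (.inr 0)), eT (y (.inr 1))) : TT2) :=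
  (eT_continuous.comp (continuous_apply (Sum.inr 0))).prodMk
    (eT_continuous.comp (continuous_apply (Sum.inr 1)))

lemma beta_cont (u : Ω^ N (U ι) (1 : U ι)) : Continuous fun y : N ⊕ Fin 2 → I =>
    betaF (eT (y (.inr 0)), eT (y (.inr 1))) (u (fun n => y (.inl n))) := by
  have h1 : Continuous fun y : N ⊕ Fin 2 → I => u (fun n => y (.inl n)) :=
    (contL u).comp (continuous_pi fun n => continuous_apply (Sum.inl n))
  exact betaF_continuous _ _ coord_continuous h1

/-- The Bott map. -/
noncomputable def beta (u : Ω^ N (U ι) (1 : U ι)) : Ω^ (N ⊕ Fin 2) (U (ι × Fin 2)) (1 : U (ι × Fin 2)) :=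
  mkL (fun y => betaF (eT (y (.inr 0)), eT (y (.inr 1))) (u (fun n => y (.inl n))))
    (beta_cont u)
    (fun y hy => betaF_bd hy _ (GenLoop.boundary u _))

lemma beta_apply (u : Ω^ N (U ι) (1 : U ι)) (y : N ⊕ Fin 2 → I) :
    beta u y = betaF (eT (y (.inr 0)), eT (y (.inr 1))) (u (fun n => y (.inl n))) := rfl

lemma beta_homotopic {u v : Ω^ N (U ι) (1 : U ι)} (h : GenLoop.Homotopic u v) :
    GenLoop.Homotopic (beta u) (beta v) := by
  obtain ⟨H, hc, h0, h1, hb⟩ := exH h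
  refine mkH (fun p => betaF (eT (p.2 (.inr 0)), eT (p.2 (.inr 1))) (H (p.1, fun n => p.2 (.inl n)))) ?_ ?_ ?_ ?_
  · have h2 : Continuous fun p : I × (N ⊕ Fin 2 → I) => H (p.1, fun n => p.2 (.inl n)) :=
      hc.comp (by fun_prop)
    have h3 : Continuous fun p : I × (N ⊕ Fin 2 → I) => ((eT (p.2 (.inr 0)), eT (p.2 (.inr 1))) : TT2) :=
      coord_continuous.comp continuous_snd
    exact betaF_continuous _ _ h3 h2
  · intro y; rw [h0, beta_apply]
  · intro y; rw [h1, beta_apply]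
  · intro t y hy; exact betaF_bd hy _ (hb t _)

lemma beta_one : beta (1 : Ω^ N (U ι) (1 : U ι)) = 1 := by
  refine GenLoop.ext _ _ fun y => ?_
  rw [beta_apply, oneL_apply, betaF_one, oneL_apply]

lemma beta_mul [DecidableEq N] [Nonempty N] (u v : Ω^ N (U ι) (1 : U ι)) :
    GenLoop.Homotopic (beta (u * v)) (beta u * beta v) := by
  obtain ⟨f, g, hf, hg, hd, he⟩ := hdisj u v
  have h1 : GenLoop.Homotopic (u * v) (f * g) := by
    have : cls (f * g) = cls u * cls v := he
    have h3 : cls (u * v) = cls (f * g) := by rw [this, map_mul]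
    exact cls_eq.1 h3
  have h2 : beta (f * g) = beta f * beta g := by
    refine GenLoop.ext _ _ fun y => ?_
    simp only [beta_apply, mulL_apply]
    rcases hd (fun n => y (.inl n)) with h | h <;> simp [h, betaF_one]
  refine (beta_homotopic h1).trans ?_
  rw [h2]
  exact hmul (beta_homotopic hf) (beta_homotopic hg)

/-- The Bott map to homotopy classes as a homomorphism. -/
noncomputable def betaHom [DecidableEq N] [Nonempty N] :
    Ω^ N (U ι) (1 : U ι) →* HomotopyGroup (N ⊕ Fin 2) (U (ι × Fin 2)) (1 : U (ι × Fin 2)) where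
  toFun u := cls (beta u)
  map_one' := by rw [beta_one, map_one]
  map_mul' u v := by rw [← map_mul, cls_eq]; exact beta_mul u v

end Bott
end BottPf

namespace BottPf
set_option linter.unusedSectionVars false
set_option linter.unusedSimpArgs false
open scoped unitInterval Topology.Homotopy

/-! ### Explicit projections -/
section Expl
variable {J : Type} [Fintype J] [DecidableEq J]

/-- Explicit partial isometry. -/
noncomputable def Wm (D : Finset J) (ν : J → J) (θ : J → ℝ) : Matrix (Fin 2 × J) J ℂ :=
  Matrix.of fun x j => if j ∈ D then (if x.1 = 0 then (if x.2 = j then ((Real.cos (θ j) : ℝ) : ℂ) else 0)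
    else (if x.2 = ν j then ((Real.sin (θ j) : ℝ) : ℂ) else 0)) else 0

lemma Wm_zero (D : Finset J) (ν : J → J) (θ : J → ℝ) (k j : J) :
    Wm D ν θ (0, k) j = if j ∈ D then (if k = j then ((Real.cos (θ j) : ℝ) : ℂ) else 0) else 0 := rfl
lemma Wm_one (D : Finset J) (ν : J → J) (θ : J → ℝ) (k j : J) :
    Wm D ν θ (1, k) j = if j ∈ D then (if k = ν j then ((Real.sin (θ j) : ℝ) : ℂ) else 0) else 0 := rfl

lemma Wm_star_mul {D : Finset J} {ν : J → J} (hν : Set.InjOn ν D) (θ : J → ℝ) :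
    (Wm D ν θ)ᴴ * Wm D ν θ = Matrix.diagonal fun j => if j ∈ D then 1 else 0 := by
  ext i j
  rw [Matrix.mul_apply, Fintype.sum_prod_type, Fin.sum_univ_two]
  simp only [conjTranspose_apply, Wm_zero, Wm_one]
  by_cases hi : i ∈ D <;> by_cases hj : j ∈ D
  swap; · rw [diagonal_apply]; by_cases h : i = j <;> simp_all
  swap; · rw [diagonal_apply]; by_cases h : i = j <;> simp_all
  swap; · rw [diagonal_apply]; by_cases h : i = j <;> simp_all
  simp only [hi, hj, if_true, apply_ite star, star_zero, ite_mul, zero_mul, mul_ite, mul_zero, Finset.sum_ite_eq',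
    Finset.sum_ite_eq, Finset.mem_univ]
  by_cases h : i = j
  · subst h
    rw [diagonal_apply_eq, if_pos hi]
    simp only [if_true]
    have := Real.cos_sq_add_sin_sq (θ i)
    have h2 : (((Real.cos (θ i)) : ℝ) : ℂ) ^ 2 + (((Real.sin (θ i)) : ℝ) : ℂ) ^ 2 = 1 := by exact_mod_cast this
    rw [← h2, Complex.star_def, Complex.conj_ofReal, Complex.conj_ofReal]; ring
  · have h' : ν i ≠ ν j := fun e => h (hν hi hj e)
    rw [diagonal_apply_ne _ h, if_neg (Ne.symm h), if_neg h'.symm, add_zero]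

lemma Wm_mul_diag (D : Finset J) (ν : J → J) (θ : J → ℝ) :
    Wm D ν θ * (Matrix.diagonal fun j => if j ∈ D then 1 else 0 : Matrix J J ℂ) = Wm D ν θ := by
  ext x j
  rw [Matrix.mul_diagonal, Wm, of_apply]
  by_cases hj : j ∈ D <;> simp [hj]

/-- Explicit projection. -/
noncomputable def EP (D : Finset J) (ν : J → J) (hν : Set.InjOn ν D) (θ : J → ℝ) : Prj (Fin 2 × J) :=
  ⟨Wm D ν θ * (Wm D ν θ)ᴴ, by simp, by
    calc _ = Wm D ν θ * ((Wm D ν θ)ᴴ * Wm D ν θ) * (Wm D ν θ)ᴴ := by simp only [Matrix.mul_assoc]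
      _ = _ := by rw [Wm_star_mul hν, Wm_mul_diag]⟩

lemma EP_continuous (D : Finset J) (ν : J → J) (hν : Set.InjOn ν D) (θ : J → ℝ) :
    Continuous fun t : I => EP D ν hν (fun j => (1 - (t : ℝ)) * θ j) := by
  have h1 : Continuous fun t : I => Wm D ν (fun j => (1 - (t : ℝ)) * θ j) := by
    refine continuous_matrix fun x j => ?_
    unfold Wm
    simp only [of_apply]
    split_ifs <;> fun_prop
  exact (h1.matrix_mul h1.matrix_conjTranspose).subtype_mk _

lemma EP_zero (D : Finset J) (ν : J → J) (hν : Set.InjOn ν D) :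
    (EP D ν hν (fun _ => 0)).1 = Matrix.diagonal fun x => if x.1 = 0 ∧ x.2 ∈ D then 1 else 0 := by
  ext ⟨p, k⟩ ⟨q, k'⟩
  simp only [EP, Matrix.mul_apply, conjTranspose_apply, Wm, of_apply, Real.cos_zero, Real.sin_zero,
    Complex.ofReal_one, Complex.ofReal_zero, ite_self, diagonal_apply]
  by_cases hp : p = 0
  · by_cases hq : q = 0
    · subst hp hq
      by_cases hk : k = k'
      · subst hk
        simp [apply_ite star, ite_and]
      · have : ¬ (((0 : Fin 2), k) = (0, k')) := fun h => hk (Prod.ext_iff.1 h).2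
        rw [if_neg this]
        refine Finset.sum_eq_zero fun j _ => ?_
        by_cases h1 : k = j
        · have : ¬ k' = j := fun h => hk (h1.trans h.symm)
          simp [this]
        · simp [h1]
    · have : ¬ ((p, k) = (q, k')) := fun h => hq ((Prod.ext_iff.1 h).1.symm.trans hp)
      simp [hq, this]
  · simp [hp]

variable {D : Finset J} {ν : J → J} (hν : Set.InjOn ν D) (θ : J → ℝ)

lemma EP_00 (hD : ∀ j ∉ D, Real.cos (θ j) = 0) :
    (EP D ν hν θ).1.submatrix (fun j : J => ((0 : Fin 2), j)) (fun j : J => ((0 : Fin 2), j)) =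
      Matrix.diagonal fun j => ((Real.cos (θ j) ^ 2 : ℝ) : ℂ) := by
  ext k k'
  simp only [submatrix_apply, EP, Matrix.mul_apply, conjTranspose_apply, Wm_zero]
  by_cases hk : k = k'
  · subst hk
    rw [diagonal_apply_eq, Finset.sum_eq_single k]
    · by_cases h : k ∈ D
      · simp only [h, if_true, Complex.star_def, Complex.conj_ofReal]; push_cast; ring
      · simp [h, hD k h]
    · intro j _ hj; simp [Ne.symm hj]
    · simp
  · rw [diagonal_apply_ne _ hk]
    refine Finset.sum_eq_zero fun j _ => ?_
    by_cases h1 : k = j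
    · have : ¬ k' = j := fun h => hk (h1.trans h.symm)
      simp [this]
    · simp [h1]

lemma EP_10 :
    (EP D ν hν θ).1.submatrix (fun j : J => ((1 : Fin 2), j)) (fun j : J => ((0 : Fin 2), j)) =
      Matrix.of fun k j => if j ∈ D ∧ k = ν j then ((Real.sin (θ j) * Real.cos (θ j) : ℝ) : ℂ) else 0 := by
  ext k k'
  simp only [submatrix_apply, EP, Matrix.mul_apply, conjTranspose_apply, Wm_zero, Wm_one, of_apply]
  rw [Finset.sum_eq_single k']
  · by_cases h : k' ∈ D <;> by_cases h' : k = ν k' <;> simp [h, h', Complex.conj_ofReal, -Complex.ofReal_cos, -Complex.ofReal_sin]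
  · intro j _ hj; simp [Ne.symm hj]
  · simp

lemma EP_11 :
    (EP D ν hν θ).1.submatrix (fun j : J => ((1 : Fin 2), j)) (fun j : J => ((1 : Fin 2), j)) =
      Matrix.diagonal fun k => ((∑ j ∈ D, if k = ν j then Real.sin (θ j) ^ 2 else 0 : ℝ) : ℂ) := by
  ext k k'
  simp only [submatrix_apply, EP, Matrix.mul_apply, conjTranspose_apply, Wm_one]
  by_cases hk : k = k'
  · subst hk
    rw [diagonal_apply_eq, Complex.ofReal_sum]
    rw [← Finset.sum_subset (Finset.subset_univ D) (fun j _ hj => by simp [hj])]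
    refine Finset.sum_congr rfl fun j hj => ?_
    by_cases h : k = ν j
    · simp only [h, hj, if_true, Complex.star_def, Complex.conj_ofReal]; push_cast; ring
    · simp [h, hj]
  · rw [diagonal_apply_ne _ hk]
    refine Finset.sum_eq_zero fun j _ => ?_
    by_cases h1 : k = ν j
    · have : ¬ k' = ν j := fun h => hk (h1.trans h.symm)
      simp [this]
    · simp [h1]

end Expl

/-! ### Trigonometric data -/
section Trig
/-- The angle at a point. -/
noncomputable def ang {L : ℕ} (j : JJ L) : ℝ := Real.arccos ((ee j : ℂ).re) / 2

lemma re_mem (z : Circle) : -1 ≤ (z : ℂ).re ∧ (z : ℂ).re ≤ 1 := by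
  have := Complex.abs_re_le_norm (z : ℂ)
  have h2 : ‖(z : ℂ)‖ = 1 := Circle.norm_coe _
  rw [h2] at this
  exact abs_le.1 this

lemma ang_cos {L : ℕ} (j : JJ L) : Real.cos (ang j) ^ 2 = (1 + (ee j : ℂ).re) / 2 := by
  rw [Real.cos_sq, ang, mul_div_cancel₀ _ two_ne_zero, Real.cos_arccos (re_mem _).1 (re_mem _).2]; ring

lemma ang_sin {L : ℕ} (j : JJ L) : Real.sin (ang j) ^ 2 = (1 - (ee j : ℂ).re) / 2 := by
  rw [Real.sin_sq, ang_cos]; ring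

lemma ang_sc {L : ℕ} (j : JJ L) : Real.sin (ang j) * Real.cos (ang j) = (yp (ee j) + yn (ee j)) / 2 := by
  have h1 : Real.sin (2 * ang j) = Real.sqrt (1 - (ee j : ℂ).re ^ 2) := by
    rw [ang, mul_div_cancel₀ _ two_ne_zero, Real.sin_arccos]
  have h2 : Real.sqrt (1 - (ee j : ℂ).re ^ 2) = yp (ee j) + yn (ee j) := by
    rw [← yp_sq, Real.sqrt_eq_iff_mul_self_eq (by positivity) (by unfold yp yn; positivity)]
    have := yp_mul_yn (ee j); nlinarith
  rw [Real.sin_two_mul] at h1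
  linarith

/-- Half point. -/
def hh (L : ℕ) : ℕ := (L + 2) ^ 2

lemma mm_eq (L : ℕ) : mm L = 2 * hh L := rfl

lemma ee_exp {L : ℕ} (j : JJ L) : (ee j : ℂ) = Complex.exp ((Real.pi * (j.val / hh L : ℝ) : ℝ) * Complex.I) := by
  have h := ZMod.toCircle_eq_circleExp j
  have : (hh L : ℝ) ≠ 0 := by unfold hh; positivity
  rw [ee, h, Circle.coe_exp]
  congr 3
  have h1 : (mm L : ℝ) = 2 * hh L := by rw [mm_eq]; push_cast; ring
  rw [h1]; field_simp

lemma ee_re {L : ℕ} (j : JJ L) : (ee j : ℂ).re = Real.cos (Real.pi * (j.val / hh L)) := by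
  rw [ee_exp, Complex.exp_ofReal_mul_I_re]
lemma ee_im {L : ℕ} (j : JJ L) : (ee j : ℂ).im = Real.sin (Real.pi * (j.val / hh L)) := by
  rw [ee_exp, Complex.exp_ofReal_mul_I_im]

lemma hh_pos (L : ℕ) : (0 : ℝ) < hh L := by unfold hh; positivity

lemma yn_zero {L : ℕ} (j : JJ L) (h : j.val ≤ hh L) : yn (ee j) = 0 := by
  rw [yn, max_eq_right]
  rw [ee_im, neg_nonpos]
  have h1 : ((j.val : ℝ)) / hh L ≤ 1 := by
    rw [div_le_one (hh_pos L)]; exact_mod_cast h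
  apply Real.sin_nonneg_of_nonneg_of_le_pi
  · have := Real.pi_pos; have := hh_pos L; positivity
  · nlinarith [Real.pi_pos]

lemma yp_zero {L : ℕ} (j : JJ L) (h : hh L ≤ j.val) : yp (ee j) = 0 := by
  rw [yp, max_eq_right]
  rw [ee_im]
  have h1 : 1 ≤ ((j.val : ℝ)) / hh L := by
    rw [one_le_div (hh_pos L)]; exact_mod_cast h
  have h2 : ((j.val : ℝ)) / hh L ≤ 2 := by
    rw [div_le_iff₀ (hh_pos L)]
    have := (ZMod.val_lt j).le
    have h1 : mm L = 2 * hh L := rfl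
    have h4 : j.val ≤ 2 * hh L := by omega
    exact_mod_cast h4
  have h3 : Real.sin (Real.pi * (j.val / hh L)) = - Real.sin (Real.pi * (j.val / hh L) - Real.pi) := by
    rw [Real.sin_sub_pi]; ring
  rw [h3, neg_nonpos]
  apply Real.sin_nonneg_of_nonneg_of_le_pi <;> nlinarith [Real.pi_pos]

lemma re_half {L : ℕ} (j : JJ L) (h : j.val = hh L) : (ee j : ℂ).re = -1 := by
  rw [ee_re, h, div_self (hh_pos L).ne', mul_one, Real.cos_pi]

/-- The partial shift. -/
def nu {L : ℕ} (j : JJ L) : JJ L := if j.val < hh L then j + 1 else j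

/-- Its domain. -/
def dom (L : ℕ) : Finset (JJ L) := Finset.univ.filter fun j => j.val ≠ hh L

lemma mem_dom {L : ℕ} {j : JJ L} : j ∈ dom L ↔ j.val ≠ hh L := by simp [dom]

lemma one_lt_hh (L : ℕ) : 1 < hh L := by 
  unfold hh
  have : 2^2 ≤ (L+2)^2 := Nat.pow_le_pow_left (by omega) 2
  omega

lemma val_succ {L : ℕ} (j : JJ L) (h : j.val < hh L) : (j + 1).val = j.val + 1 := by
  have h1 : mm L = 2 * hh L := rfl
  have h2 := one_lt_hh L
  have : Fact (1 < mm L) := ⟨by omega⟩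
  rw [ZMod.val_add, ZMod.val_one, Nat.mod_eq_of_lt (by omega)]

lemma nu_inj (L : ℕ) : Set.InjOn (nu (L := L)) (dom L) := by
  intro i hi j hj h
  have hi' := mem_dom.1 hi
  have hj' := mem_dom.1 hj
  unfold nu at h
  split_ifs at h with h1 h2 h2
  · exact add_right_cancel h
  · have := val_succ i h1; rw [h] at this; omega
  · have := val_succ j h2; rw [← h] at this; omega
  · exact h

lemma nu_fiber {L : ℕ} (k : JJ L) : (k = 0 ∧ ∀ j ∈ dom L, k ≠ nu j) ∨
    ∃ j ∈ dom L, k = nu j ∧ dist (ee k) (ee j) ≤ Real.pi * ((L:ℝ) + 2)⁻¹ := by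
  by_cases hk : k.val ≤ hh L
  · by_cases h0 : k = 0
    · left
      refine ⟨h0, fun j hj e => ?_⟩
      have hj' := mem_dom.1 hj
      rw [h0] at e
      unfold nu at e
      split_ifs at e with h1
      · have := val_succ j h1; rw [← e, ZMod.val_zero] at this; omega
      · rw [← e, ZMod.val_zero] at h1; have := one_lt_hh L; omega
    · right
      have hv : k.val ≠ 0 := fun h => h0 ((ZMod.val_eq_zero k).1 h)
      have h2 := one_lt_hh L
      have h1 : mm L = 2 * hh L := rfl
      have : Fact (1 < mm L) := ⟨by omega⟩
      have hv1 : (k - 1).val = k.val - 1 := by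
        rw [ZMod.val_sub (by rw [ZMod.val_one]; omega), ZMod.val_one]
      refine ⟨k - 1, mem_dom.2 (by omega), ?_, ee_close _ _ ?_⟩
      · rw [nu, if_pos (by omega)]; ring
      · have : k - (k - 1) = 1 := by ring
        rw [this, ZMod.val_one]; omega
  · right
    refine ⟨k, mem_dom.2 (by omega), ?_, ?_⟩
    · rw [nu, if_neg (by omega)]
    · rw [dist_self]; have := Real.pi_pos; positivity

end Trig
end BottPf

namespace BottPf
set_option linter.unusedSectionVars false
set_option linter.unusedSimpArgs false
open scoped unitInterval Topology.Homotopy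

/-! ### Quantization of the Bott projection -/
section QB
open scoped Matrix.Norms.L2Operator
open Filter

lemma block4 (L : ℕ) (Q : TT2 → Matrix (Fin 2) (Fin 2) ℂ) (hQ : ∀ z, (Q z)ᴴ = Q z)
    (E : Matrix (Fin 2 × JJ L) (Fin 2 × JJ L) ℂ) (hE : Eᴴ = E) (a b c : ℝ)
    (h00 : ‖tau L (fun z => Q z 0 0) - E.submatrix (fun j => ((0 : Fin 2), j)) (fun j => ((0 : Fin 2), j))‖ ≤ a)
    (h10 : ‖tau L (fun z => Q z 1 0) - E.submatrix (fun j => ((1 : Fin 2), j)) (fun j => ((0 : Fin 2), j))‖ ≤ b)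
    (h11 : ‖tau L (fun z => Q z 1 1) - E.submatrix (fun j => ((1 : Fin 2), j)) (fun j => ((1 : Fin 2), j))‖ ≤ c) :
    ‖TT L Q - E‖ ≤ a + b + b + c := by
  have hT : (TT L Q)ᴴ = TT L Q := by
    rw [← TT_star]; congr 1; ext1 z; exact hQ z
  have h := norm_block (TT L Q - E)
  rw [Fin.sum_univ_two, Fin.sum_univ_two, Fin.sum_univ_two] at h
  have e01 : (TT L Q - E).submatrix (fun j : JJ L => ((0 : Fin 2), j)) (fun j : JJ L => ((1 : Fin 2), j)) =
      ((TT L Q - E).submatrix (fun j : JJ L => ((1 : Fin 2), j)) (fun j : JJ L => ((0 : Fin 2), j)))ᴴ := by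
    rw [conjTranspose_submatrix, conjTranspose_sub, hT, hE]
  rw [e01, l2_opNorm_conjTranspose] at h
  have g00 : ‖(TT L Q - E).submatrix (fun j : JJ L => ((0 : Fin 2), j)) (fun j : JJ L => ((0 : Fin 2), j))‖ ≤ a := h00
  have g10 : ‖(TT L Q - E).submatrix (fun j : JJ L => ((1 : Fin 2), j)) (fun j : JJ L => ((0 : Fin 2), j))‖ ≤ b := h10
  have g11 : ‖(TT L Q - E).submatrix (fun j : JJ L => ((1 : Fin 2), j)) (fun j : JJ L => ((1 : Fin 2), j))‖ ≤ c := h11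
  linarith

/-- real function on the circle as a complex function. -/
noncomputable def rC (φ : Circle → ℝ) (h : Continuous φ) : C(Circle, ℂ) := ⟨fun z => ((φ z : ℝ) : ℂ), by fun_prop⟩

lemma rC_apply (φ : Circle → ℝ) (h : Continuous φ) (z : Circle) : rC φ h z = ((φ z : ℝ) : ℂ) := rfl

/-- The limit projection. -/
noncomputable def E1 (L : ℕ) : Prj (Fin 2 × JJ L) := EP (dom L) nu (nu_inj L) ang
/-- The limit projection. -/
noncomputable def E0 (L : ℕ) : Prj (Fin 2 × JJ L) := EP Finset.univ id Function.injective_id.injOn ang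

lemma pi_tendsto (ε : ℝ) (hε : 0 < ε) : ∀ᶠ L : ℕ in atTop, Real.pi * ((L:ℝ) + 2)⁻¹ ≤ ε := by
  have h : Tendsto (fun L : ℕ => Real.pi * ((L:ℝ) + 2)⁻¹) atTop (𝓝 (Real.pi * 0)) := by
    refine Tendsto.const_mul _ (tendsto_inv_atTop_zero.comp ?_)
    exact tendsto_atTop_add_const_right _ _ tendsto_natCast_atTop_atTop
  rw [mul_zero] at h
  exact h.eventually (ge_mem_nhds hε)

lemma cos_off {L : ℕ} (j : JJ L) (hj : j ∉ dom L) : Real.cos (ang j) = 0 := by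
  have h1 : j.val = hh L := by by_contra h; exact hj (mem_dom.2 h)
  have h2 := ang_cos j
  rw [re_half j h1] at h2
  have : Real.cos (ang j) ^ 2 = 0 := by rw [h2]; ring
  exact pow_eq_zero_iff (two_ne_zero) |>.1 this

lemma E1_apx (ε : ℝ) (hε : 0 < ε) : ∀ᶠ L in atTop, ‖TT L QM - (E1 L).1‖ ≤ ε := by
  have c1 : Continuous fun z : Circle => (1 + (z : ℂ).re) / 2 := by fun_prop
  have c2 : Continuous fun z : Circle => (1 - (z : ℂ).re) / 2 := by fun_prop
  have c3 : Continuous fun z : Circle => yp z / 2 := by have := yp_continuous; fun_prop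
  have c4 : Continuous fun z : Circle => yn z / 2 := by have := yn_continuous; fun_prop
  filter_upwards [err_z1_tendsto (rC _ c1) (ε/16) (by positivity), err_z1_tendsto (rC _ c2) (ε/16) (by positivity),
    err_z1_tendsto (rC _ c3) (ε/16) (by positivity), err_z1_tendsto (rC _ c4) (ε/16) (by positivity),
    sqrt_tendsto (ε/16) (by positivity), pi_tendsto (ε/16) (by positivity)] with L h1 h2 h3 h4 h5 h6
  have hE := (E1 L).2.1
  have key := block4 L QM QM_star (E1 L).1 hE (ε/16) (3*ε/16) (ε/8) ?_ ?_ ?_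
  · linarith
  · refine le_trans ?_ ((tau_sub_le L _ _).trans h1)
    apply le_of_eq
    congr 2
    rw [E1, EP_00 _ _ cos_off]
    congr 1; ext1 j
    rw [ang_cos]; rfl
  · have e3 : err L (fun z => (z.2 : ℂ) * rC _ c3 z.1) (shiftM L * (Matrix.diagonal fun j => rC _ c3 (ee j) : Matrix _ _ ℂ))
        ≤ 1 * (ε/16) + ε/16 * 1 := by
      refine (err_mul L _ _ _ _ 1 zero_le_one (fun z => (Circle.norm_coe _).le)).trans ?_
      have hn : ‖(Matrix.diagonal fun j => rC _ c3 (ee j) : Matrix (JJ L) (JJ L) ℂ)‖ ≤ 1 := by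
        rw [l2_opNorm_diagonal]
        refine (pi_norm_le_iff_of_nonneg zero_le_one).2 (fun j => ?_)
        rw [rC_apply, Complex.norm_real, Real.norm_eq_abs, abs_le]
        have him : ((ee j : ℂ)).im ≤ 1 := by
          have := (abs_le.1 (Complex.abs_im_le_norm (ee j : ℂ))).2
          have h2 : ‖(ee j : ℂ)‖ = 1 := Circle.norm_coe _
          linarith
        have a1 : 0 ≤ yp (ee j) := le_max_right _ _
        have a2 : yp (ee j) ≤ 1 := max_le him zero_le_one
        constructor <;> linarith
      refine add_le_add (by linarith) ?_
      exact mul_le_mul ((err_z2 L).trans h5) hn (norm_nonneg _) (by positivity)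
    have e4 := (err_add L (fun z => (z.2 : ℂ) * rC _ c3 z.1) (fun z => rC _ c4 z.1) _ _).trans (add_le_add e3 h4)
    refine le_trans ?_ ((tau_sub_le L _ _).trans (e4.trans (by linarith)))
    apply le_of_eq
    congr 2
    · congr 1
      ext1 z
      simp only [QM, rC_apply, off, of_apply, cons_val', cons_val_zero, cons_val_one, cons_val_fin_one]
      ring
    · rw [E1, EP_10]
      ext k j
      rw [of_apply, Matrix.add_apply, Matrix.mul_diagonal, diagonal_apply, ang_sc]
      simp only [of_apply, shiftM, rC_apply, nu]
      have hdg : (if k = j then ((yn (ee k) / 2 : ℝ) : ℂ) else 0) = if k = j then ((yn (ee j) / 2 : ℝ) : ℂ) else 0 := by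
        split_ifs with h
        · rw [h]
        · rfl
      rw [hdg]
      by_cases hj : j.val < hh L
      · have hd : j ∈ dom L := mem_dom.2 (by omega)
        have := yn_zero j hj.le
        by_cases hk : k = j + 1 <;> simp [hj, hd, hk, this]
      · have h8 := yp_zero j (by omega)
        by_cases hd : j ∈ dom L
        · simp [hj, hd, h8]
        · have h7 : yn (ee j) = 0 := yn_zero j (by
            have : j.val = hh L := by by_contra h; exact hd (mem_dom.2 h)
            omega)
          simp [hd, h7, h8]
  · have e5 := (tau_sub_le L _ _).trans h2
    have e6 : ‖(Matrix.diagonal fun j => rC _ c2 (ee j) : Matrix (JJ L) (JJ L) ℂ) -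
        (E1 L).1.submatrix (fun j => ((1 : Fin 2), j)) (fun j => ((1 : Fin 2), j))‖ ≤ ε/16 := by
      rw [E1, EP_11, diagonal_sub, l2_opNorm_diagonal]
      refine (pi_norm_le_iff_of_nonneg (by positivity)).2 (fun k => ?_)
      rw [rC_apply, ← Complex.ofReal_sub, Complex.norm_real, Real.norm_eq_abs]
      rcases nu_fiber k with ⟨h0, hn⟩ | ⟨j, hj, hk, hd⟩
      · rw [Finset.sum_eq_zero (fun j hj => if_neg (hn j hj)), h0, ee_zero]
        simp; positivity
      · rw [Finset.sum_eq_single j, if_pos hk, ang_sin]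
        · have : |(ee k : ℂ).re - (ee j : ℂ).re| ≤ dist (ee k) (ee j) := by
            rw [← Complex.sub_re]; exact (Complex.abs_re_le_norm ((ee k : ℂ) - (ee j : ℂ))).trans (le_of_eq (dist_eq_norm _ _).symm)
          have e : (1 - (ee k : ℂ).re) / 2 - (1 - (ee j : ℂ).re) / 2 = -(((ee k : ℂ).re - (ee j : ℂ).re) / 2) := by ring
          rw [e, abs_neg, abs_div, abs_of_pos (two_pos : (0:ℝ) < 2)]
          have := abs_nonneg ((ee k : ℂ).re - (ee j : ℂ).re)
          linarith
        · intro j' hj' hne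
          exact if_neg fun e => hne (nu_inj L hj' hj (e.symm.trans hk))
        · exact fun h => absurd hj h
    have e7 : tau L (fun z => QM z 1 1) - (E1 L).1.submatrix (fun j => ((1 : Fin 2), j)) (fun j => ((1 : Fin 2), j)) =
      (tau L (fun z => rC _ c2 z.1) - (Matrix.diagonal fun j => rC _ c2 (ee j) : Matrix (JJ L) (JJ L) ℂ)) +
      ((Matrix.diagonal fun j => rC _ c2 (ee j) : Matrix (JJ L) (JJ L) ℂ) -
        (E1 L).1.submatrix (fun j => ((1 : Fin 2), j)) (fun j => ((1 : Fin 2), j))) := by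
      rw [sub_add_sub_cancel]; rfl
    rw [e7]
    refine (norm_add_le _ _).trans ?_
    linarith

lemma E0_apx (ε : ℝ) (hε : 0 < ε) : ∀ᶠ L in atTop, ‖TT L (fun z => QM (z.1, 1)) - (E0 L).1‖ ≤ ε := by
  have c1 : Continuous fun z : Circle => (1 + (z : ℂ).re) / 2 := by fun_prop
  have c2 : Continuous fun z : Circle => (1 - (z : ℂ).re) / 2 := by fun_prop
  have c3 : Continuous fun z : Circle => (yp z + yn z) / 2 := by
    have := yp_continuous; have := yn_continuous; fun_prop
  filter_upwards [err_z1_tendsto (rC _ c1) (ε/4) (by positivity), err_z1_tendsto (rC _ c2) (ε/4) (by positivity),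
    err_z1_tendsto (rC _ c3) (ε/4) (by positivity)] with L h1 h2 h3
  have hE := (E0 L).2.1
  have key := block4 L (fun z => QM (z.1, 1)) (fun z => QM_star _) (E0 L).1 hE (ε/4) (ε/4) (ε/4) ?_ ?_ ?_
  · linarith
  · refine le_trans ?_ ((tau_sub_le L _ _).trans h1)
    apply le_of_eq
    congr 2
    rw [E0, EP_00 _ _ (fun j hj => absurd (Finset.mem_univ j) hj)]
    congr 1; ext1 j
    rw [ang_cos]; rfl
  · refine le_trans ?_ ((tau_sub_le L _ _).trans h3)
    apply le_of_eq
    congr 2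
    · congr 1
      ext1 z
      simp only [QM, rC_apply, off, of_apply, cons_val', cons_val_zero, cons_val_one, cons_val_fin_one]
      push_cast; simp; ring
    · rw [E0, EP_10]
      ext k j
      rw [diagonal_apply]
      by_cases hk : k = j
      · subst hk; simp [ang_sc, rC_apply, -Complex.ofReal_cos, -Complex.ofReal_sin, -Complex.ofReal_mul]
      · simp [hk]
  · refine le_trans ?_ ((tau_sub_le L _ _).trans h2)
    apply le_of_eq
    congr 2
    rw [E0, EP_11]
    congr 1; ext1 k
    rw [Finset.sum_eq_single k, id, if_pos rfl, ang_sin]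
    · rfl
    · intro j _ hj; exact if_neg hj.symm
    · simp

end QB
end BottPf

namespace BottPf
set_option linter.unusedSectionVars false
set_option linter.unusedSimpArgs false
open scoped unitInterval Topology.Homotopy

/-! ### The composite of quantization and the Bott map -/
section AB
variable {ι τ κ : Type} [Fintype ι] [DecidableEq ι] [Fintype τ] [DecidableEq τ] [Fintype κ] [DecidableEq κ]

lemma embP_equiv_mul (e : ι ≃ κ) (A : Matrix ι ι ℂ) : stabM (embP e.toEmbedding) A = A.submatrix e.symm e.symm := by
  have h1 : embP e.toEmbedding * (embP e.toEmbedding)ᴴ = 1 := by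
    ext a b
    rw [embP_mul_star_apply, Matrix.one_apply]
    have : a ∈ Set.range e.toEmbedding := ⟨e.symm a, by simp⟩
    simp [this]
  rw [stabM, h1, sub_self, add_zero]
  ext a b
  rw [Matrix.mul_apply, Finset.sum_eq_single (e.symm b)]
  · rw [Matrix.mul_apply, Finset.sum_eq_single (e.symm a)]
    · simp [embP_apply]
    · intro i _ hi
      rw [embP_apply, if_neg, zero_mul]
      rintro rfl; simp at hi
    · simp
  · intro i _ hi
    rw [conjTranspose_apply, embP_apply, if_neg, star_zero, mul_zero]
    rintro rfl; simp at hi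
  · simp

/-- Slot embedding. -/
def slotR (ι : Type) {τ : Type} (a : τ) : ι ↪ ι × τ := ⟨fun i => (i, a), fun _ _ h => (Prod.ext_iff.1 h).1⟩

lemma slotR_apply (a : τ) (i : ι) : slotR ι a i = (i, a) := rfl

lemma stabM_eq (P : Matrix κ ι ℂ) (A : Matrix ι ι ℂ) : stabM P A = P * (A - 1) * Pᴴ + 1 := by
  rw [stabM, Matrix.mul_sub, Matrix.sub_mul, Matrix.mul_one]; abel

lemma amp_single (a : τ) (A : Matrix ι ι ℂ) :
    amp A (Matrix.diagonal fun x => if x = a then 1 else 0) = stabM (embP (slotR ι a)) A := by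
  rw [amp_eq, stabM_eq]
  congr 1
  ext ⟨i, b⟩ ⟨j, c⟩
  rw [Matrix.mul_apply, Finset.sum_eq_single j]
  · rw [Matrix.mul_apply, Finset.sum_eq_single i]
    · simp only [kroneckerMap_apply, diagonal_apply, conjTranspose_apply, embP_apply, slotR_apply, Prod.mk.injEq,
        true_and]
      by_cases h : b = a <;> by_cases h2 : c = a <;> simp [h, h2]
      · intro h3; exact absurd h3.symm h2
    · intro k _ hk
      rw [embP_apply, if_neg, zero_mul]
      simp only [slotR_apply, Prod.mk.injEq]
      exact fun h => hk h.1.symm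
    · simp
  · intro k _ hk
    rw [conjTranspose_apply, embP_apply, if_neg, star_zero, mul_zero]
    simp only [slotR_apply, Prod.mk.injEq]
    exact fun h => hk h.1.symm
  · simp

lemma amp_add (A : Matrix ι ι ℂ) {P Q : Matrix τ τ ℂ} (h : P * Q = 0) : amp A (P + Q) = amp A P * amp A Q := by
  rw [amp_eq, amp_eq, amp_eq, add_mul, mul_add, ← mul_kronecker_mul, h]
  simp only [kronecker_zero, mul_one, one_mul, kronecker_add]
  abel

lemma stabE_refl (A : U ι) : stabE (Function.Embedding.refl ι) A = A := by
  apply Subtype.ext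
  have := embP_equiv_mul (Equiv.refl ι) (A : Matrix ι ι ℂ)
  rw [stabE_coe]
  exact this

lemma stabL_refl {N : Type} (f : Ω^ N (U ι) (1 : U ι)) : stabL (Function.Embedding.refl ι) f = f :=
  GenLoop.ext _ _ fun y => by rw [stabL_apply, stabE_refl]

open scoped Matrix.Norms.L2Operator
open Filter

lemma mul_close {X Y X' Y' : Matrix ι ι ℂ} {δ δ' : ℝ} (hX : ‖X'‖ ≤ 1) (hY : ‖Y'‖ ≤ 1) (h1 : ‖X - X'‖ ≤ δ)
    (h2 : ‖Y - Y'‖ ≤ δ') (h3 : δ' ≤ 1) : ‖X * Y - X' * Y'‖ ≤ 2 * δ + δ' := by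
  have e : X * Y - X' * Y' = (X - X') * (Y - Y') + (X - X') * Y' + X' * (Y - Y') := by
    simp only [sub_mul, mul_sub]; abel
  rw [e]
  have a0 := norm_nonneg (X - X')
  have a1 : ‖(X - X') * (Y - Y')‖ ≤ δ * 1 := (l2_opNorm_mul _ _).trans
    (mul_le_mul h1 (h2.trans h3) (norm_nonneg _) (a0.trans h1))
  have a2 : ‖(X - X') * Y'‖ ≤ δ * 1 := (l2_opNorm_mul _ _).trans
    (mul_le_mul h1 hY (norm_nonneg _) (a0.trans h1))
  have a3 : ‖X' * (Y - Y')‖ ≤ 1 * δ' := (l2_opNorm_mul _ _).trans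
    (mul_le_mul hX h2 (norm_nonneg _) zero_le_one)
  have := norm_add_le ((X - X') * (Y - Y') + (X - X') * Y') (X' * (Y - Y'))
  have := norm_add_le ((X - X') * (Y - Y')) ((X - X') * Y')
  linarith

variable {N : Type}

lemma betaF_coe (z : TT2) (u : U ι) : (betaF z u : Matrix (ι × Fin 2) (ι × Fin 2) ℂ) =
    amp (u : Matrix ι ι ℂ) (QM z) * (amp (u : Matrix ι ι ℂ) (QM (z.1, 1)))ᴴ := by
  unfold betaF
  rw [U_coe_mul, ampU_inv_coe, ampU_coe]; rfl

lemma TL_beta (L : ℕ) (u : Ω^ N (U ι) (1 : U ι)) (x : N → I) : TL L (beta u) x =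
    TT L (fun z => amp (u x : Matrix ι ι ℂ) (QM z) * (amp (u x : Matrix ι ι ℂ) (QM (z.1, 1)))ᴴ) := by
  unfold TL
  congr 1
  ext1 z
  rw [beta_apply, betaF_coe]
  simp only [joinY_inl, joinY_zero, joinY_one, eT_secT]

/-- The deformation. -/
noncomputable def E1t (L : ℕ) (t : I) : Prj (Fin 2 × JJ L) := EP (dom L) nu (nu_inj L) (fun j => (1 - (t : ℝ)) * ang j)
/-- The deformation. -/
noncomputable def E0t (L : ℕ) (t : I) : Prj (Fin 2 × JJ L) :=
  EP Finset.univ id Function.injective_id.injOn (fun j => (1 - (t : ℝ)) * ang j)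

lemma E1t_cont (L : ℕ) : Continuous (E1t L) := EP_continuous _ _ _ _
lemma E0t_cont (L : ℕ) : Continuous (E0t L) := EP_continuous _ _ _ _
lemma E1t_zero (L : ℕ) : E1t L 0 = E1 L := by simp [E1t, E1]
lemma E0t_zero (L : ℕ) : E0t L 0 = E0 L := by simp [E0t, E0]
lemma E1t_one (L : ℕ) : (E1t L 1).1 = Matrix.diagonal fun x => if x.1 = 0 ∧ x.2 ∈ dom L then 1 else 0 := by
  rw [← EP_zero _ _ (nu_inj L)]; simp [E1t]
lemma E0t_one (L : ℕ) : (E0t L 1).1 = Matrix.diagonal fun x => if x.1 = 0 ∧ x.2 ∈ Finset.univ then 1 else 0 := by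
  rw [← EP_zero _ _ Function.injective_id.injOn]; simp [E0t]
attribute [irreducible] E1t E0t

/-- The half point. -/
def hp (L : ℕ) : JJ L := (hh L : ℕ)

lemma hp_val (L : ℕ) : (hp L).val = hh L := by
  have h1 : mm L = 2 * hh L := rfl
  have := one_lt_hh L
  rw [hp, ZMod.val_natCast, Nat.mod_eq_of_lt (by omega)]

lemma not_dom {L : ℕ} (j : JJ L) : j ∉ dom L ↔ j = hp L := by
  rw [mem_dom, not_not]
  constructor
  · intro h; exact ZMod.val_injective _ (h.trans (hp_val L).symm)
  · rintro rfl; exact hp_val L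

lemma amp_final (L : ℕ) (u : U ι) : ampU (E1t L 1) u * (ampU (E0t L 1) u)⁻¹ =
    (stabE (slotR ι ((0 : Fin 2), hp L)) u)⁻¹ := by
  have h : ampU (E0t L 1) u = stabE (slotR ι ((0 : Fin 2), hp L)) u * ampU (E1t L 1) u := by
    apply Subtype.ext
    rw [U_coe_mul, ampU_coe, ampU_coe, stabE_coe, ← amp_single, ← amp_add]
    · congr 1
      rw [E0t_one, E1t_one, diagonal_add]
      congr 1; ext1 ⟨p, j⟩
      by_cases hp0 : p = 0
      · by_cases hj : j ∈ dom L
        · have : j ≠ hp L := fun h => (not_dom j).2 h hj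
          simp [hp0, hj, this]
        · have := (not_dom j).1 hj
          simp [hp0, hj, this]
          exact fun h => hj (this ▸ h)
      · simp [hp0]
    · rw [E1t_one, diagonal_mul_diagonal, ← diagonal_zero]
      congr 1; ext1 ⟨p, j⟩
      by_cases hj : j ∈ dom L
      · have : j ≠ hp L := fun h => (not_dom j).2 h hj
        simp [this]
      · simp [hj]
  rw [h, _root_.mul_inv_rev]; group

theorem alpha_beta (u : Ω^ N (U ι) (1 : U ι)) : ∀ᶠ L in atTop, ∀ e : ι ↪ (ι × Fin 2) × JJ L,
    GenLoop.Homotopic (alpha L (beta u)) (stabL e u⁻¹) := by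
  set C : ℝ := (Fintype.card ι : ℝ) ^ 2 * 2 with hC
  have hC0 : 0 ≤ C := by positivity
  have hu : Continuous fun p : (N → I) × TT2 => (u p.1 : Matrix ι ι ℂ) :=
    continuous_subtype_val.comp ((contL u).comp continuous_fst)
  have hF : Continuous fun p : (N → I) × TT2 => amp (u p.1 : Matrix ι ι ℂ) (QM p.2) :=
    amp_continuous _ _ (QM_continuous.comp continuous_snd) hu
  have hG : Continuous fun p : (N → I) × TT2 => (amp (u p.1 : Matrix ι ι ℂ) (QM (p.2.1, 1)))ᴴ := by
    have h1 : Continuous fun p : (N → I) × TT2 => QM (p.2.1, 1) := QM_continuous.comp (by fun_prop)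
    exact (amp_continuous _ _ h1 hu).matrix_conjTranspose
  have hδ : 0 < 1 / (8 * (C + 1)) := by positivity
  filter_upwards [TT_mul (Y := N → I) (fun x z => amp (u x : Matrix ι ι ℂ) (QM z))
    (fun x z => (amp (u x : Matrix ι ι ℂ) (QM (z.1, 1)))ᴴ) hF hG (1/4) (by norm_num),
    E1_apx _ hδ, E0_apx _ hδ] with L h1 h2 h3 e
  have hCδ : C * (1 / (8 * (C + 1))) ≤ 1/8 := by
    rw [mul_one_div, div_le_div_iff₀ (by positivity) (by norm_num)]; linarith
  set pa := Equiv.prodAssoc ι (Fin 2) (JJ L) with hpa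
  -- the model loop
  let G : I × (N → I) → U ((ι × Fin 2) × JJ L) := fun p =>
    stabE pa.symm.toEmbedding (ampU (E1t L p.1) (u p.2) * (ampU (E0t L p.1) (u p.2))⁻¹)
  have hGc : Continuous G := by
    have c1 : Continuous fun p : I × (N → I) => ampU (E1t L p.1) (u p.2) :=
      ampU_continuous _ _ ((E1t_cont L).comp continuous_fst) ((contL u).comp continuous_snd)
    have c0 : Continuous fun p : I × (N → I) => ampU (E0t L p.1) (u p.2) :=
      ampU_continuous _ _ ((E0t_cont L).comp continuous_fst) ((contL u).comp continuous_snd)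
    exact (continuous_stabE _).comp (c1.mul c0.inv)
  have hGb : ∀ t, ∀ x ∈ Cube.boundary N, G (t, x) = 1 := by
    intro t x hx
    simp only [G, GenLoop.boundary u x hx, ampU_one, mul_one, inv_one, map_one]
  let g0 : Ω^ N (U ((ι × Fin 2) × JJ L)) (1 : U ((ι × Fin 2) × JJ L)) :=
    mkL (fun x => G (0, x)) (hGc.comp (by fun_prop)) (hGb 0)
  have k1 : GenLoop.Homotopic (alpha L (beta u)) g0 := by
    refine alpha_close L _ _ fun x => ?_
    have b1 := h1 x
    rw [TL_beta]
    have hg : (g0 x : Matrix ((ι × Fin 2) × JJ L) ((ι × Fin 2) × JJ L) ℂ) =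
        (amp (u x : Matrix ι ι ℂ) (E1 L).1 * (amp (u x : Matrix ι ι ℂ) (E0 L).1)ᴴ).submatrix pa pa := by
      simp only [g0, mkL_apply, G]
      rw [stabE_coe, embP_equiv_mul, U_coe_mul, ampU_coe, ampU_inv_coe, E1t_zero, E0t_zero]
      rfl
    have e1 : TT L (fun z => amp (u x : Matrix ι ι ℂ) (QM z)) * TT L (fun z => (amp (u x : Matrix ι ι ℂ) (QM (z.1, 1)))ᴴ) =
        (amp (u x : Matrix ι ι ℂ) (TT L QM) * (amp (u x : Matrix ι ι ℂ) (TT L fun z => QM (z.1, 1)))ᴴ).submatrix pa pa := by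
      rw [TT_star, TT_amp_P, TT_amp_P, conjTranspose_submatrix, submatrix_mul_equiv]
    have n1 : ‖amp (u x : Matrix ι ι ℂ) (E1 L).1‖ ≤ 1 := by rw [← ampU_coe]; exact U_norm_le _
    have n0 : ‖(amp (u x : Matrix ι ι ℂ) (E0 L).1)ᴴ‖ ≤ 1 := by
      rw [l2_opNorm_conjTranspose, ← ampU_coe]; exact U_norm_le _
    have m1 : ‖amp (u x : Matrix ι ι ℂ) (TT L QM) - amp (u x : Matrix ι ι ℂ) (E1 L).1‖ ≤ 1/8 :=
      (amp_norm_P (u x) _ _).trans ((mul_le_mul_of_nonneg_left h2 hC0).trans hCδ)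
    have m0 : ‖(amp (u x : Matrix ι ι ℂ) (TT L fun z => QM (z.1, 1)))ᴴ - (amp (u x : Matrix ι ι ℂ) (E0 L).1)ᴴ‖ ≤ 1/8 := by
      rw [← conjTranspose_sub, l2_opNorm_conjTranspose]
      exact (amp_norm_P (u x) _ _).trans ((mul_le_mul_of_nonneg_left h3 hC0).trans hCδ)
    have q := mul_close n1 n0 m1 m0 (by norm_num)
    have q2 := (norm_submatrix_le pa _).trans q
    rw [submatrix_sub, Pi.sub_apply] at q2
    rw [hg]
    rw [e1] at b1
    have := norm_sub_le_norm_sub_add_norm_sub (TT L (fun z => amp (u x : Matrix ι ι ℂ) (QM z) *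
      (amp (u x : Matrix ι ι ℂ) (QM (z.1, 1)))ᴴ))
      ((amp (u x : Matrix ι ι ℂ) (TT L QM) * (amp (u x : Matrix ι ι ℂ) (TT L fun z => QM (z.1, 1)))ᴴ).submatrix pa pa)
      ((amp (u x : Matrix ι ι ℂ) (E1 L).1 * (amp (u x : Matrix ι ι ℂ) (E0 L).1)ᴴ).submatrix pa pa)
    refine this.trans_lt ?_
    have q3 := add_le_add b1 q2
    refine lt_of_le_of_lt q3 (by norm_num)
  have k2 : GenLoop.Homotopic g0 (stabL ((slotR ι ((0 : Fin 2), hp L)).trans pa.symm.toEmbedding) u⁻¹) := by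
    refine mkH G hGc (fun x => rfl) (fun x => ?_) hGb
    simp only [G]
    rw [amp_final, ← map_inv, stabE_trans, stabL_apply, invL_apply]
  exact (k1.trans k2).trans (stabL_indep _ _ _)

lemma swap_join (y : N ⊕ Fin 2 → I) (s t : I) : swapY I (joinY y s t) =
    joinY (joinY (fun n => y (.inl n)) s t) (y (.inr 0)) (y (.inr 1)) := by
  funext i
  rcases i with (i | i) | i
  · rfl
  · fin_cases i <;> rfl
  · fin_cases i <;> rfl

theorem beta_alpha (f : Ω^ (N ⊕ Fin 2) (U ι) (1 : U ι)) : ∀ᶠ L in atTop, ∀ e : ι ↪ (ι × JJ L) × Fin 2,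
    GenLoop.Homotopic (beta (alpha L f)) (stabL e f⁻¹) := by
  have hswc : Continuous fun y : (N ⊕ Fin 2) ⊕ Fin 2 → I => swapY I y := by
    refine continuous_pi fun i => ?_
    rcases i with (i | i) | i <;> exact continuous_apply _
  have hswb : ∀ y ∈ Cube.boundary ((N ⊕ Fin 2) ⊕ Fin 2), swapY I y ∈ Cube.boundary ((N ⊕ Fin 2) ⊕ Fin 2) := by
    rintro y ⟨i, hi⟩
    rcases i with (i | i) | i
    · exact ⟨.inl (.inl i), hi⟩
    · exact ⟨.inr i, hi⟩
    · exact ⟨.inl (.inr i), hi⟩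
  let g : Ω^ ((N ⊕ Fin 2) ⊕ Fin 2) (U (ι × Fin 2)) (1 : U (ι × Fin 2)) :=
    mkL (fun y => beta f (swapY I y)) ((contL (beta f)).comp hswc) fun y hy => GenLoop.boundary (beta f) _ (hswb y hy)
  have hg : GenLoop.Homotopic (beta f) g := swap_homotopic _ _ fun y => rfl
  have hf : Continuous fun p : (N ⊕ Fin 2 → I) × TT2 =>
      (f (joinY (fun n => p.1 (.inl n)) (secT p.2.1) (secT p.2.2)) : Matrix ι ι ℂ) := by
    have h := desc_continuous (Y := Unit) (fun _ => f) ((contL f).comp continuous_snd)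
      (fun _ v hv => GenLoop.boundary f v hv)
    have h2 : Continuous fun p : (N ⊕ Fin 2 → I) × TT2 => (((), (fun n => p.1 (.inl n))), p.2) := by fun_prop
    exact continuous_subtype_val.comp (h.comp h2)
  have hF : Continuous fun p : (N ⊕ Fin 2 → I) × TT2 =>
      amp (f (joinY (fun n => p.1 (.inl n)) (secT p.2.1) (secT p.2.2)) : Matrix ι ι ℂ)
        (QM (eT (p.1 (.inr 0)), eT (p.1 (.inr 1)))) := by
    have h1 : Continuous fun p : (N ⊕ Fin 2 → I) × TT2 => QM (eT (p.1 (.inr 0)), eT (p.1 (.inr 1))) :=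
      QM_continuous.comp (coord_continuous.comp continuous_fst)
    exact amp_continuous _ _ h1 hf
  have hG : Continuous fun p : (N ⊕ Fin 2 → I) × TT2 =>
      (amp (f (joinY (fun n => p.1 (.inl n)) (secT p.2.1) (secT p.2.2)) : Matrix ι ι ℂ)
        (QM (eT (p.1 (.inr 0)), 1)))ᴴ := by
    have h1 : Continuous fun p : (N ⊕ Fin 2 → I) × TT2 => QM (eT (p.1 (.inr 0)), 1) :=
      QM_continuous.comp ((eT_continuous.comp ((continuous_apply (Sum.inr 0)).comp continuous_fst)).prodMk continuous_const)
    exact (amp_continuous _ _ h1 hf).matrix_conjTranspose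
  filter_upwards [TT_mul (Y := N ⊕ Fin 2 → I)
    (fun y z => amp (f (joinY (fun n => y (.inl n)) (secT z.1) (secT z.2)) : Matrix ι ι ℂ)
        (QM (eT (y (.inr 0)), eT (y (.inr 1)))))
    (fun y z => (amp (f (joinY (fun n => y (.inl n)) (secT z.1) (secT z.2)) : Matrix ι ι ℂ)
        (QM (eT (y (.inr 0)), 1)))ᴴ) hF hG (1/4) (by norm_num),
    alpha_good f (1/32) (by norm_num), alpha_beta f, alpha_homotopic hg] with L h1 h2 h3 h4 e
  set ex := exch ι (JJ L) (Fin 2) with hex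
  have k1 : GenLoop.Homotopic (alpha L g) (stabL ex.symm.toEmbedding (beta (alpha L f))) := by
    refine alpha_close L _ _ fun y => ?_
    have b1 := h1 y
    set x : N → I := fun n => y (.inl n) with hx
    set Q := QM (eT (y (.inr 0)), eT (y (.inr 1))) with hQ
    set Q0 := QM (eT (y (.inr 0)), 1) with hQ0
    have e0 : TL L g y = TT L (fun z => amp (f (joinY x (secT z.1) (secT z.2)) : Matrix ι ι ℂ) Q *
        (amp (f (joinY x (secT z.1) (secT z.2)) : Matrix ι ι ℂ) Q0)ᴴ) := by
      unfold TL
      congr 1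
      ext1 z
      simp only [g, mkL_apply]
      rw [swap_join, beta_apply, betaF_coe]
      simp only [joinY_inl, joinY_zero, joinY_one, hQ, hQ0, hx]
    have hgg : (stabL ex.symm.toEmbedding (beta (alpha L f)) y : Matrix ((ι × Fin 2) × JJ L) ((ι × Fin 2) × JJ L) ℂ) =
        (amp (alpha L f x : Matrix (ι × JJ L) (ι × JJ L) ℂ) Q *
          (amp (alpha L f x : Matrix (ι × JJ L) (ι × JJ L) ℂ) Q0)ᴴ).submatrix ex ex := by
      rw [stabL_apply, stabE_coe, embP_equiv_mul, beta_apply, betaF_coe]; rfl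
    have e1 : TT L (fun z => amp (f (joinY x (secT z.1) (secT z.2)) : Matrix ι ι ℂ) Q) *
        TT L (fun z => (amp (f (joinY x (secT z.1) (secT z.2)) : Matrix ι ι ℂ) Q0)ᴴ) =
        (amp (TL L f x) Q * (amp (TL L f x) Q0)ᴴ).submatrix ex ex := by
      rw [TT_star, TT_amp_A, TT_amp_A, conjTranspose_submatrix, submatrix_mul_equiv]; rfl
    have hQ1 : Q = (QP (eT (y (.inr 0)), eT (y (.inr 1)))).1 := rfl
    have hQ2 : Q0 = (QP (eT (y (.inr 0)), 1)).1 := rfl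
    have n1 : ‖amp (alpha L f x : Matrix (ι × JJ L) (ι × JJ L) ℂ) Q‖ ≤ 1 := by
      rw [hQ1, ← ampU_coe]; exact U_norm_le _
    have n0 : ‖(amp (alpha L f x : Matrix (ι × JJ L) (ι × JJ L) ℂ) Q0)ᴴ‖ ≤ 1 := by
      rw [l2_opNorm_conjTranspose, hQ2, ← ampU_coe]; exact U_norm_le _
    have m1 : ‖amp (TL L f x) Q - amp (alpha L f x : Matrix (ι × JJ L) (ι × JJ L) ℂ) Q‖ ≤ 1/8 := by
      have := amp_norm_A (TL L f x) (alpha L f x : Matrix (ι × JJ L) (ι × JJ L) ℂ) Q 1 (QM_entry _)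
      have h5 := h2.2 x
      simp only [Fintype.card_fin] at this
      refine this.trans ?_
      push_cast; linarith
    have m0 : ‖(amp (TL L f x) Q0)ᴴ - (amp (alpha L f x : Matrix (ι × JJ L) (ι × JJ L) ℂ) Q0)ᴴ‖ ≤ 1/8 := by
      rw [← conjTranspose_sub, l2_opNorm_conjTranspose]
      have := amp_norm_A (TL L f x) (alpha L f x : Matrix (ι × JJ L) (ι × JJ L) ℂ) Q0 1 (QM_entry _)
      have h5 := h2.2 x
      simp only [Fintype.card_fin] at this
      refine this.trans ?_
      push_cast; linarith
    have q := mul_close n1 n0 m1 m0 (by norm_num)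
    have q2 := (norm_submatrix_le ex _).trans q
    rw [submatrix_sub, Pi.sub_apply] at q2
    rw [hgg, e0]
    rw [e1] at b1
    have := norm_sub_le_norm_sub_add_norm_sub (TT L (fun z => amp (f (joinY x (secT z.1) (secT z.2)) : Matrix ι ι ℂ) Q *
        (amp (f (joinY x (secT z.1) (secT z.2)) : Matrix ι ι ℂ) Q0)ᴴ))
      ((amp (TL L f x) Q * (amp (TL L f x) Q0)ᴴ).submatrix ex ex)
      ((amp (alpha L f x : Matrix (ι × JJ L) (ι × JJ L) ℂ) Q *
          (amp (alpha L f x : Matrix (ι × JJ L) (ι × JJ L) ℂ) Q0)ᴴ).submatrix ex ex)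
    refine this.trans_lt ?_
    exact lt_of_le_of_lt (add_le_add b1 q2) (by norm_num)
  let e' : ι ↪ (ι × Fin 2) × JJ L := e.trans ex.symm.toEmbedding
  have k2 : GenLoop.Homotopic (stabL ex.symm.toEmbedding (beta (alpha L f))) (stabL e' f⁻¹) :=
    k1.symm.trans (h4.symm.trans (h3 e'))
  have k3 := stabL_homotopic ex.toEmbedding k2
  rw [stabL_trans, stabL_trans] at k3
  have r1 : ex.symm.toEmbedding.trans ex.toEmbedding = Function.Embedding.refl _ := by ext i <;> simp
  have r2 : e'.trans ex.toEmbedding = e := by ext i <;> simp [e']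
  rw [r1, r2, stabL_refl] at k3
  exact k3

end AB
end BottPf

namespace BottPf
set_option linter.unusedSectionVars false
set_option linter.unusedSimpArgs false
open scoped unitInterval Topology.Homotopy
open Filter

section stepI
variable {N : Type} {G : Type} [TopologicalSpace G] [Group G] [IsTopologicalGroup G]

lemma hrefl {X : Type} [TopologicalSpace X] {x : X} (f : Ω^ N X x) : GenLoop.Homotopic f f :=
  GenLoop.Homotopic.refl f

lemma hnpow {f f' : Ω^ N G (1 : G)} (h : GenLoop.Homotopic f f') (k : ℕ) :
    GenLoop.Homotopic (f ^ k) (f' ^ k) := by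
  induction k with
  | zero => simpa using hrefl (1 : Ω^ N G (1 : G))
  | succ k ih => rw [pow_succ, pow_succ]; exact hmul ih h

lemma hzpow {f f' : Ω^ N G (1 : G)} (h : GenLoop.Homotopic f f') (k : ℤ) :
    GenLoop.Homotopic (f ^ k) (f' ^ k) := by
  cases k with
  | ofNat k => simpa using hnpow h k
  | negSucc k => simpa [zpow_negSucc] using hinv (hnpow h (k+1))

variable {ι τ κ : Type} [Fintype ι] [DecidableEq ι] [Fintype τ] [DecidableEq τ]
  [Fintype κ] [DecidableEq κ]

lemma embP_prod (s : ι ↪ κ) :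
    embP (s.prodMap (Function.Embedding.refl τ)) = embP s ⊗ₖ (1 : Matrix τ τ ℂ) := by
  ext ⟨a, b⟩ ⟨c, d⟩
  simp only [embP_apply, kroneckerMap_apply, Matrix.one_apply, Function.Embedding.coe_prodMap,
    Prod.map, Function.Embedding.refl_apply, Prod.mk.injEq]
  by_cases h1 : a = s c <;> by_cases h2 : b = d <;> simp [h1, h2]

lemma amp_stabM (s : ι ↪ κ) (A : Matrix ι ι ℂ) (P : Matrix τ τ ℂ) :
    amp (stabM (embP s) A) P = stabM (embP (s.prodMap (Function.Embedding.refl τ))) (amp A P) := by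
  rw [amp_eq, stabM_eq, stabM_eq, amp_eq, embP_prod, conjTranspose_kronecker]
  simp [← mul_kronecker_mul]

lemma beta_stab (s : ι ↪ κ) (u : Ω^ N (U ι) (1 : U ι)) :
    beta (stabL s u) = stabL (s.prodMap (Function.Embedding.refl (Fin 2))) (beta u) := by
  refine GenLoop.ext _ _ fun y => ?_
  rw [stabL_apply, beta_apply, beta_apply, stabL_apply]
  apply Subtype.ext
  rw [betaF_coe, stabE_coe, stabE_coe, betaF_coe, amp_stabM, amp_stabM, stabM_mul, stabM_star]
  exact embP_star_mul _

def Zlike (N ι : Type) [Fintype ι] [DecidableEq ι] : Prop :=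
  ∃ g : Ω^ N (U ι) (1 : U ι), (∀ f : Ω^ N (U ι) (1 : U ι), ∃ k : ℤ, GenLoop.Homotopic f (g ^ k)) ∧
    ∀ k : ℤ, GenLoop.Homotopic (g ^ k) 1 → k = 0

def StZ (N : Type) [Fintype N] : Prop :=
  ∀ (ι : Type) [Fintype ι] [DecidableEq ι], Fintype.card N + 1 ≤ 2 * Fintype.card ι → Zlike N ι

def StN (N : Type) [Fintype N] : Prop :=
  ∀ (ι : Type) [Fintype ι] [DecidableEq ι], Fintype.card N + 2 ≤ 2 * Fintype.card ι →
    ∀ f : Ω^ N (U ι) (1 : U ι), GenLoop.Homotopic f 1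

lemma hinv_iff {f g : Ω^ N G (1 : G)} (h : GenLoop.Homotopic f⁻¹ g) : GenLoop.Homotopic f g⁻¹ := by
  simpa using hinv h

lemma stab_inj2 [Fintype N] (e : ι ↪ κ) (hd : Fintype.card N + 1 ≤ 2 * Fintype.card ι)
    (f g : Ω^ N (U ι) (1 : U ι)) (h : GenLoop.Homotopic (stabL e f) (stabL e g)) :
    GenLoop.Homotopic f g := by
  rw [homotopic_iff_mul_inv] at h ⊢
  apply stab_inj e hd
  rwa [map_mul, map_inv]

/-- transfer of the infinite cyclic property along a stabilisation -/
lemma Zlike_up [Fintype N] (e : ι ↪ κ) (hd : Fintype.card N + 1 ≤ 2 * Fintype.card ι)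
    (h : Zlike N ι) : Zlike N κ := by
  obtain ⟨g, h1, h2⟩ := h
  refine ⟨stabL e g, fun f => ?_, fun k hk => ?_⟩
  · obtain ⟨f', hf'⟩ := stab_surj e (by omega) f
    obtain ⟨k, hk⟩ := h1 f'
    refine ⟨k, hf'.trans ?_⟩
    rw [← map_zpow]
    exact stabL_homotopic e hk
  · rw [← map_zpow] at hk
    exact h2 k (stab_inj e hd _ hk)

noncomputable def emb_of_pos (h : 0 < Fintype.card τ) : ι ↪ ι × τ :=
  slotR ι (Classical.choice (Fintype.card_pos_iff.1 h))

lemma beta_zpow [DecidableEq N] [Nonempty N] (g : Ω^ N (U ι) (1 : U ι)) (k : ℤ) :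
    GenLoop.Homotopic (beta (g ^ k)) (beta g ^ k) := by
  have : Nonempty (N ⊕ Fin 2) := ⟨.inr 0⟩
  rw [← cls_eq]
  rw [map_zpow]
  exact map_zpow (betaHom (N := N) (ι := ι)) g k

lemma StZ_step [Fintype N] [DecidableEq N] [Nonempty N] (h : StZ N) : StZ (N ⊕ Fin 2) := by
  intro ι _ _ hc
  have hc' : Fintype.card (N ⊕ Fin 2) = Fintype.card N + 2 := by simp
  obtain ⟨g, h1, h2⟩ := h ι (by omega)
  obtain ⟨g', hg'⟩ := stab_surj (slotR ι (0 : Fin 2)) (by omega) (beta g)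
  refine ⟨g', fun f => ?_, fun k hk => ?_⟩
  · obtain ⟨L, hL⟩ := (beta_alpha f).exists
    let s : ι ↪ ι × JJ L := slotR ι 0
    obtain ⟨a, ha⟩ := stab_surj s (by omega) (alpha L f)
    obtain ⟨k, hk⟩ := h1 a
    refine ⟨-k, ?_⟩
    let s' := s.prodMap (Function.Embedding.refl (Fin 2))
    let e := (slotR ι (0 : Fin 2)).trans s'
    have h3 := hL e
    have h4 : GenLoop.Homotopic (beta (alpha L f)) (stabL e (g' ^ k)) := by
      refine (beta_homotopic (ha.trans (stabL_homotopic s hk))).trans ?_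
      rw [beta_stab, ← stabL_trans]
      refine stabL_homotopic _ ((beta_zpow g k).trans ?_)
      rw [map_zpow]
      exact hzpow hg' k
    have h5 := stab_inj2 e (by omega) _ _ (h3.symm.trans h4)
    rw [_root_.zpow_neg]
    exact hinv_iff h5
  · have h3 : GenLoop.Homotopic (beta (g ^ k)) (beta 1) := by
      rw [beta_one]
      refine (beta_zpow g k).trans ((hzpow hg' k).trans ?_)
      rw [← map_zpow]
      have := stabL_homotopic (slotR ι (0 : Fin 2)) hk
      rwa [map_one] at this
    obtain ⟨L, hL1, hL2, hL3⟩ := ((alpha_homotopic h3).and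
      ((alpha_beta (g ^ k)).and (alpha_beta (1 : Ω^ N (U ι) (1 : U ι))))).exists
    let e : ι ↪ (ι × Fin 2) × JJ L := (slotR ι (0 : Fin 2)).trans (slotR _ 0)
    have h4 := (hL2 e).symm.trans (hL1.trans (hL3 e))
    have h5 := stab_inj2 e (by omega) _ _ h4
    apply h2
    simpa using hinv h5

lemma StN_step [Fintype N] (h : StN N) : StN (N ⊕ Fin 2) := by
  intro ι _ _ hc f
  have hc' : Fintype.card (N ⊕ Fin 2) = Fintype.card N + 2 := by simp
  obtain ⟨L, hL⟩ := (beta_alpha f).exists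
  have h1 : Fintype.card (ι × JJ L) = Fintype.card ι * Fintype.card (JJ L) := by simp
  have h2 : 0 < Fintype.card (JJ L) := Fintype.card_pos
  have h3 : GenLoop.Homotopic (alpha L f) 1 := by
    apply h; rw [h1]; nlinarith
  let e : ι ↪ (ι × JJ L) × Fin 2 := (slotR ι (0 : JJ L)).trans (slotR _ 0)
  have h4 := beta_homotopic h3
  rw [beta_one] at h4
  have h5 := (hL e).symm.trans h4
  have h6 := hinv (stab_inj e (by omega) _ h5)
  simpa using h6

end stepI
end BottPf

namespace BottPf
set_option linter.unusedSectionVars false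
set_option linter.unusedSimpArgs false
open scoped unitInterval Topology.Homotopy

section circ

lemma circle_lift {Y : Type} [TopologicalSpace Y] (c : I × Y → Y) (hc : Continuous c) (y0 : Y)
    (h0 : ∀ y, c (0, y) = y0) (h1 : ∀ y, c (1, y) = y) (F : Y → Circle) (hF : Continuous F) :
    ∃ Φ : Y → ℝ, Continuous Φ ∧ ∀ y, Circle.exp (Φ y) = F y := by
  obtain ⟨x0, hx0⟩ : ∃ x, Circle.exp x = F y0 := ⟨Complex.arg (F y0 : ℂ), Circle.exp_arg _⟩
  let H : C(I × Y, Circle) := ⟨fun p => F (c p), hF.comp hc⟩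
  let f : C(Y, ℝ) := ⟨fun _ => x0, continuous_const⟩
  have H0 : ∀ a, H (0, a) = Circle.exp (f a) := fun a => by
    change F (c (0, a)) = _
    rw [h0]; exact hx0.symm
  let Ψ := Circle.isCoveringMap_exp.liftHomotopy H f H0
  refine ⟨fun y => Ψ (1, y), by fun_prop, fun y => ?_⟩
  have := congrFun (Circle.isCoveringMap_exp.liftHomotopy_lifts H f H0) (1, y)
  change Circle.exp (Ψ (1, y)) = F (c (1, y)) at this
  rw [this, h1]

lemma circle_const {Y : Type} [TopologicalSpace Y] [PreconnectedSpace Y] (Φ Ψ : Y → ℝ)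
    (h : Continuous Φ) (h' : Continuous Ψ) (he : ∀ y, Circle.exp (Φ y) = Circle.exp (Ψ y))
    (y0 : Y) (h0 : Φ y0 = Ψ y0) : Φ = Ψ :=
  Circle.isCoveringMap_exp.eq_of_comp_eq h h' (funext he) y0 h0

/-- contraction of a cube -/
def cubeC {N : Type} (p : I × (N → I)) : N → I := fun n => p.1 * p.2 n
lemma cubeC_cont {N : Type} : Continuous (cubeC (N := N)) := by unfold cubeC; fun_prop

lemma cube_lift {N : Type} (F : (N → I) → Circle) (hF : Continuous F) :
    ∃ Φ : (N → I) → ℝ, Continuous Φ ∧ ∀ y, Circle.exp (Φ y) = F y :=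
  circle_lift cubeC cubeC_cont (fun _ => 0) (fun y => by ext; simp [cubeC])
    (fun y => by ext; simp [cubeC]) F hF

/-- scalars -/
noncomputable def scalU {ι : Type} [Fintype ι] [DecidableEq ι] (z : Circle) : U ι :=
  ⟨(z : ℂ) • (1 : Matrix ι ι ℂ), by
    rw [Matrix.mem_unitaryGroup_iff, star_eq_conjTranspose, conjTranspose_smul]
    have : ‖(z : ℂ)‖ = 1 := Circle.norm_coe _
    simp [smul_smul, Complex.conj_mul', Complex.mul_conj', this]⟩

variable {ι κ : Type} [Fintype ι] [DecidableEq ι] [Fintype κ] [DecidableEq κ]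
@[simp] lemma scalU_coe (z : Circle) : (scalU (ι := ι) z : Matrix ι ι ℂ) = (z : ℂ) • 1 := rfl
lemma scalU_mul (z w : Circle) : scalU (ι := ι) (z * w) = scalU z * scalU w := by
  apply Subtype.ext; simp [smul_smul, mul_comm]
lemma scalU_one : scalU (ι := ι) 1 = 1 := by
  apply Subtype.ext; simp
lemma scalU_continuous : Continuous (scalU (ι := ι)) := by
  refine Continuous.subtype_mk ?_ _
  exact Continuous.smul continuous_subtype_val continuous_const
lemma scalU_inj [Nonempty ι] {z w : Circle} (h : scalU (ι := ι) z = scalU w) : z = w := by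
  have h1 := congrArg (fun A : U ι => (A : Matrix ι ι ℂ) (Classical.arbitrary ι)
    (Classical.arbitrary ι)) h
  apply Circle.ext
  simpa using h1

noncomputable def scalHom : Circle →* U ι where
  toFun := scalU
  map_one' := scalU_one
  map_mul' := scalU_mul

lemma eU_norm (A : U Unit) : (A : Matrix Unit Unit ℂ) () () ∈ Submonoid.unitSphere ℂ := by
  have h := A.2
  rw [Matrix.mem_unitaryGroup_iff] at h
  have h1 := congrFun (congrFun h ()) ()
  simp [Matrix.mul_apply, star_apply] at h1
  rw [Complex.mul_conj'] at h1
  have h2 : ‖(A : Matrix Unit Unit ℂ) () ()‖ ^ 2 = 1 := by exact_mod_cast h1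
  have h3 : ‖(A : Matrix Unit Unit ℂ) () ()‖ = 1 := by
    nlinarith [norm_nonneg ((A : Matrix Unit Unit ℂ) () ())]
  simpa [Submonoid.unitSphere] using h3

noncomputable def entU (A : U Unit) : Circle := ⟨(A : Matrix Unit Unit ℂ) () (), eU_norm A⟩
lemma entU_continuous : Continuous entU := by
  refine Continuous.subtype_mk ?_ _
  have h : Continuous fun A : U Unit => (A : Matrix Unit Unit ℂ) := continuous_subtype_val
  exact h.matrix_elem () ()
lemma scal_entU (A : U Unit) : scalU (entU A) = A := by
  apply Subtype.ext
  ext ⟨⟩ ⟨⟩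
  rw [scalU_coe]
  simp [entU]
lemma entU_scal (z : Circle) : entU (scalU z) = z := by
  apply Circle.ext; simp [entU]
lemma entU_one : entU 1 = 1 := by rw [← scalU_one, entU_scal]

lemma one_base : Zlike (Fin 1) Unit := by
  have hb : ∀ y ∈ Cube.boundary (Fin 1), y 0 = 0 ∨ y 0 = 1 := by
    rintro y ⟨i, hi⟩
    rwa [Subsingleton.elim i 0] at hi
  let g : Ω^ (Fin 1) (U Unit) (1 : U Unit) := mkL (fun y => scalU (eT (y 0)))
    (scalU_continuous.comp (eT_continuous.comp (by fun_prop))) (fun y hy => by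
      rcases hb y hy with h | h <;> rw [h]
      · rw [eT_zero, scalU_one]
      · rw [eT_one, scalU_one])
  have gk : ∀ (k : ℤ) y, (g ^ k) y = scalU (Circle.exp (2 * Real.pi * (k * (y 0 : ℝ)))) := by
    intro k y
    have h1 : ∀ k : ℕ, (g ^ k) y = scalU (Circle.exp (2 * Real.pi * (k * (y 0 : ℝ)))) := by
      intro k
      induction k with
      | zero => simp [scalU_one]
      | succ k ih =>
        rw [pow_succ, mulL_apply, ih]
        change _ * scalU (eT (y 0)) = _
        rw [← scalU_mul]
        congr 1
        unfold eT
        rw [← Circle.exp_add]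
        congr 1
        push_cast
        ring
    have h2 : ∀ z : Circle, (scalU z)⁻¹ = scalU (ι := Unit) z⁻¹ := fun z => (map_inv scalHom z).symm
    cases k with
    | ofNat k => simpa using h1 k
    | negSucc k =>
      rw [zpow_negSucc, invL_apply, h1, h2, ← Circle.exp_neg]
      congr 2
      push_cast
      ring
  have hpt : ∀ y : Fin 1 → I, y = fun _ => y 0 := fun y => by
    funext i; rw [Subsingleton.elim i 0]
  have b0 : (fun _ => (0 : I)) ∈ Cube.boundary (Fin 1) := ⟨0, Or.inl rfl⟩
  have b1 : (fun _ => (1 : I)) ∈ Cube.boundary (Fin 1) := ⟨0, Or.inr rfl⟩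
  refine ⟨g, fun f => ?_, fun k hk => ?_⟩
  · obtain ⟨Φ, hΦ, h⟩ := cube_lift (fun y => entU (f y)) (entU_continuous.comp (contL f))
    have e0 : Circle.exp (Φ fun _ => 0) = 1 := by
      rw [h, GenLoop.boundary f _ b0, entU_one]
    have e1 : Circle.exp (Φ fun _ => 1) = 1 := by
      rw [h, GenLoop.boundary f _ b1, entU_one]
    rw [Circle.exp_eq_one] at e0 e1
    obtain ⟨m, hm⟩ := e0
    obtain ⟨n, hn⟩ := e1
    refine ⟨n - m, mkH (fun p => scalU (Circle.exp ((1 - (p.1 : ℝ)) * Φ p.2 +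
      (p.1 : ℝ) * (2 * Real.pi * (((n - m : ℤ) : ℝ) * (p.2 0 : ℝ) + m))))) ?_ ?_ ?_ ?_⟩
    · exact scalU_continuous.comp (Circle.exp.continuous.comp (by fun_prop))
    · intro y
      simp [h, scal_entU]
    · intro y
      rw [gk]
      congr 1
      simp only [Set.Icc.coe_one, sub_self, zero_mul, one_mul, zero_add, mul_add]
      rw [Circle.exp_add, mul_comm _ (m : ℝ), Circle.exp_int_mul_two_pi]
      simp
    · intro t y hy
      rw [← scalU_one]
      congr 1
      rw [Circle.exp_eq_one]
      dsimp only
      rcases hb y hy with hh | hh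
      · refine ⟨m, ?_⟩
        rw [hpt y, hh, hm]
        simp only [Set.Icc.coe_zero]
        ring
      · refine ⟨n, ?_⟩
        rw [hpt y, hh, hn]
        simp only [Set.Icc.coe_one]
        push_cast
        ring
  · obtain ⟨H, hc, h0, h1, hbd⟩ := exH hk
    obtain ⟨Φ, hΦ, h⟩ := circle_lift (Y := I × (Fin 1 → I)) (fun p => (p.1 * p.2.1, cubeC (p.1, p.2.2)))
      (by have := cubeC_cont (N := Fin 1); fun_prop) (0, fun _ => 0) (fun y => by ext <;> simp [cubeC])
      (fun y => by ext <;> simp [cubeC]) (fun p => entU (H p)) (entU_continuous.comp hc)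
    have A : (fun s : I => Φ (s, fun _ => 0)) = fun s : I => Φ (0, fun _ => 0) := by
      refine circle_const _ _ (by fun_prop) (by fun_prop) (fun s => ?_) 0 rfl
      rw [h, h, hbd _ _ b0, hbd _ _ b0]
    have A' : (fun s : I => Φ (s, fun _ => 1)) = fun s : I => Φ (0, fun _ => 1) := by
      refine circle_const _ _ (by fun_prop) (by fun_prop) (fun s => ?_) 0 rfl
      rw [h, h, hbd _ _ b1, hbd _ _ b1]
    have B : (fun t : I => Φ (1, fun _ => t)) = fun t : I => Φ (1, fun _ => 0) := by
      refine circle_const _ _ (by fun_prop) (by fun_prop) (fun s => ?_) 0 rfl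
      rw [h, h, h1, h1]; rfl
    have C : (fun t : I => Φ (0, fun _ => t)) =
        fun t : I => Φ (0, fun _ => 0) + 2 * Real.pi * (k * (t : ℝ)) := by
      refine circle_const _ _ (by fun_prop) (by fun_prop) (fun s => ?_) 0 (by simp)
      rw [Circle.exp_add, h, h, h0, h0, gk, gk, entU_scal, entU_scal, ← Circle.exp_add]
      simp
    have a := congrFun A 1
    have a' := congrFun A' 1
    have b := congrFun B 1
    have c := congrFun C 1
    simp only [Set.Icc.coe_one, mul_one] at a a' b c
    have : 2 * Real.pi * (k : ℝ) = 0 := by linarith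
    have hp := Real.pi_pos
    have : (k : ℝ) = 0 := by
      rcases mul_eq_zero.1 this with h | h
      · linarith
      · exact h
    exact_mod_cast this

lemma StZ_one : StZ (Fin 1) := by
  intro ι _ _ hc
  have : 0 < Fintype.card ι := by omega
  obtain ⟨i⟩ := Fintype.card_pos_iff.1 this
  exact Zlike_up (⟨fun _ => i, fun _ _ _ => rfl⟩ : Unit ↪ ι) (by simp) one_base

lemma StN_zero : StN (Fin 0) := by
  intro ι _ _ hc f
  obtain ⟨p⟩ := PathConnectedSpace.joined (f default) (1 : U ι)
  refine mkH (fun q => p q.1) (by fun_prop) (fun y => ?_) (fun y => ?_) ?_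
  · rw [Subsingleton.elim y default]; simp
  · simp
  · rintro t y ⟨i, _⟩
    exact i.elim0

lemma congr_zpow {M N G : Type} [TopologicalSpace G] [Group G] [IsTopologicalGroup G]
    (e : M ≃ N) (f : Ω^ M G (1 : G)) (k : ℤ) :
    GenLoop.congr 1 e (f ^ k) = (GenLoop.congr 1 e f) ^ k :=
  map_zpow (⟨⟨GenLoop.congr 1 e, rfl⟩, congr_mul e⟩ : Ω^ M G (1 : G) →* Ω^ N G (1 : G)) f k

lemma Zlike_congr {M N : Type} (e : M ≃ N) (h : Zlike M ι) : Zlike N ι := by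
  obtain ⟨g, h1, h2⟩ := h
  refine ⟨GenLoop.congr 1 e g, fun f => ?_, fun k hk => ?_⟩
  · obtain ⟨k, hk⟩ := h1 ((GenLoop.congr 1 e).symm f)
    refine ⟨k, ?_⟩
    have := congr_homotopic e hk
    rwa [Homeomorph.apply_symm_apply, congr_zpow] at this
  · apply h2
    rw [← congr_zpow] at hk
    have h3 := congr_homotopic e.symm hk
    have h4 : ∀ u : Ω^ M (U ι) (1 : U ι), GenLoop.congr 1 e.symm (GenLoop.congr 1 e u) = u :=
      fun u => GenLoop.ext _ _ fun y => by
        change u _ = u _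
        congr 1
        funext i
        simp
    rw [h4] at h3
    exact h3

lemma Null_congr {M N X : Type} [TopologicalSpace X] {x : X} (e : M ≃ N)
    (h : ∀ f : Ω^ M X x, GenLoop.Homotopic f GenLoop.const) (f : Ω^ N X x) :
    GenLoop.Homotopic f GenLoop.const := by
  have := congr_homotopic e (h ((GenLoop.congr x e).symm f))
  rwa [Homeomorph.apply_symm_apply] at this

lemma StZ_all (r : ℕ) : StZ (Fin (2 * r + 1)) := by
  induction r with
  | zero => exact StZ_one
  | succ r ih =>
    intro ι _ _ hc
    refine Zlike_congr (finSumFinEquiv (m := 2 * r + 1) (n := 2)) (StZ_step ih ι ?_)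
    simp only [Fintype.card_sum, Fintype.card_fin] at hc ⊢
    omega

lemma StN_all (r : ℕ) : StN (Fin (2 * r)) := by
  induction r with
  | zero => exact StN_zero
  | succ r ih =>
    intro ι _ _ hc
    refine Null_congr (finSumFinEquiv (m := 2 * r) (n := 2)) (StN_step ih ι ?_)
    simp only [Fintype.card_sum, Fintype.card_fin] at hc ⊢
    omega

end circ
end BottPf

namespace BottPf
set_option linter.unusedSectionVars false
set_option linter.unusedSimpArgs false
open scoped unitInterval Topology.Homotopy

section hlift
variable {α β : Type} [Fintype α] [DecidableEq α] [Fintype β] [DecidableEq β]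

/-- partial traces -/
def trB (M : Matrix (α × β) (α × β) ℂ) : Matrix α α ℂ := fun i i' => ∑ j, M (i, j) (i', j)
def trA (M : Matrix (α × β) (α × β) ℂ) : Matrix β β ℂ := fun j j' => ∑ i, M (i, j) (i, j')

lemma trB_kron (A : Matrix α α ℂ) (B : Matrix β β ℂ) : trB (A ⊗ₖ B) = B.trace • A := by
  ext i i'
  simp [trB, Matrix.trace, ← Finset.mul_sum, mul_comm]
lemma trA_kron (A : Matrix α α ℂ) (B : Matrix β β ℂ) : trA (A ⊗ₖ B) = A.trace • B := by
  ext i i'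
  simp [trA, Matrix.trace, ← Finset.sum_mul]

lemma trB_continuous : Continuous (trB (α := α) (β := β)) := by
  refine continuous_pi fun i => continuous_pi fun i' => ?_
  unfold trB
  exact continuous_finsetSum _ fun j _ => continuous_id.matrix_elem _ _
lemma trA_continuous : Continuous (trA (α := α) (β := β)) := by
  refine continuous_pi fun i => continuous_pi fun i' => ?_
  unfold trA
  exact continuous_finsetSum _ fun j _ => continuous_id.matrix_elem _ _

lemma U_smul_mul (z : Circle) (A : U α) :
    ((scalU z * A : U α) : Matrix α α ℂ) = (z : ℂ) • (A : Matrix α α ℂ) := by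
  simp

open scoped ComplexOrder in
lemma pol_smul (z : Circle) (c : ℝ) (hc : 0 < c) (A : U α) :
    pol ((((z : ℂ) * c) : ℂ) • (A : Matrix α α ℂ)) = scalU z * A := by
  refine pol_eq (P := (c : ℂ) • (1 : Matrix α α ℂ)) _ ?_ ?_
  · exact PosDef.one.smul (by exact_mod_cast hc)
  · rw [U_smul_mul]
    rw [mul_smul_comm, mul_one, smul_smul, mul_comm]

lemma isUnit_smulU (c : ℂ) (hc : c ≠ 0) (A : U α) : IsUnit (c • (A : Matrix α α ℂ)) := by
  have := (isUnit_smul_iff (Units.mk0 c hc) (A : Matrix α α ℂ)).2 (U_isUnit A)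
  simpa [Units.smul_def] using this

lemma exists_phase (w : ℂ) : ∃ z : Circle, w = z * (‖w‖ : ℝ) := by
  refine ⟨Circle.exp (Complex.arg w), ?_⟩
  rw [Circle.coe_exp, mul_comm]
  exact (Complex.norm_mul_exp_arg_mul_I w).symm

noncomputable def secA (M : Matrix (α × β) (α × β) ℂ) : U α := pol (trB M)
noncomputable def secBm (M : Matrix (α × β) (α × β) ℂ) : Matrix β β ℂ :=
  trA (((secA M : Matrix α α ℂ)ᴴ ⊗ₖ (1 : Matrix β β ℂ)) * M)
noncomputable def secB (M : Matrix (α × β) (α × β) ℂ) : U β := pol (secBm M)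

lemma kron_scal (z : Circle) (A : U α) (B : U β) :
    kronU (scalU z * A) (scalU z⁻¹ * B) = kronU A B := by
  apply Subtype.ext
  rw [kronU_coe, kronU_coe, U_smul_mul, U_smul_mul, smul_kronecker, kronecker_smul, smul_smul,
    ← Circle.coe_mul, mul_inv_cancel, Circle.coe_one, one_smul]

lemma sec_spec [Nonempty α] (A : U α) (B : U β) (h : (B : Matrix β β ℂ).trace ≠ 0) :
    ∃ z : Circle, (B : Matrix β β ℂ).trace = z * (‖(B : Matrix β β ℂ).trace‖ : ℝ) ∧
      secA ((A : Matrix α α ℂ) ⊗ₖ (B : Matrix β β ℂ)) = scalU z * A ∧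
      secBm ((A : Matrix α α ℂ) ⊗ₖ (B : Matrix β β ℂ)) =
        (((z⁻¹ : Circle) : ℂ) * ((Fintype.card α : ℝ) : ℂ)) • (B : Matrix β β ℂ) ∧
      secB ((A : Matrix α α ℂ) ⊗ₖ (B : Matrix β β ℂ)) = scalU z⁻¹ * B := by
  obtain ⟨z, hz⟩ := exists_phase ((B : Matrix β β ℂ).trace)
  have hA : secA ((A : Matrix α α ℂ) ⊗ₖ (B : Matrix β β ℂ)) = scalU z * A := by
    unfold secA
    rw [trB_kron, hz, pol_smul _ _ (norm_pos_iff.2 h)]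
  have hB : secBm ((A : Matrix α α ℂ) ⊗ₖ (B : Matrix β β ℂ)) =
        (((z⁻¹ : Circle) : ℂ) * ((Fintype.card α : ℝ) : ℂ)) • (B : Matrix β β ℂ) := by
    unfold secBm
    rw [hA, ← mul_kronecker_mul, one_mul, trA_kron, U_smul_mul, conjTranspose_smul, smul_mul_assoc,
      U_star_mul, trace_smul, trace_one, Circle.coe_inv_eq_conj]
    simp
  refine ⟨z, hz, hA, hB, ?_⟩
  unfold secB
  rw [hB, pol_smul _ _ (by exact_mod_cast Fintype.card_pos)]

lemma kron_eq_one [Nonempty α] [Nonempty β] {A : U α} {B : U β} (h : kronU A B = 1) :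
    ∃ z : Circle, A = scalU z := by
  have h1 : (A : Matrix α α ℂ) ⊗ₖ (B : Matrix β β ℂ) = 1 := by rw [← kronU_coe, h]; rfl
  have h2 := congrArg trB h1
  rw [trB_kron, ← one_kronecker_one, trB_kron, trace_one] at h2
  have hB : (B : Matrix β β ℂ).trace ≠ 0 := by
    intro h0
    rw [h0, zero_smul] at h2
    have h3 := congrFun (congrFun h2 (Classical.arbitrary α)) (Classical.arbitrary α)
    simp at h3
    exact Fintype.card_ne_zero (by exact_mod_cast h3.symm)
  obtain ⟨z, hz⟩ := exists_phase ((B : Matrix β β ℂ).trace)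
  have h4 : pol ((B : Matrix β β ℂ).trace • (A : Matrix α α ℂ)) = scalU z * A := by
    rw [hz, pol_smul _ _ (norm_pos_iff.2 hB)]
  have h5 : pol ((Fintype.card β : ℂ) • (1 : Matrix α α ℂ)) = 1 := by
    have := pol_smul 1 (Fintype.card β : ℝ) (by exact_mod_cast Fintype.card_pos) (1 : U α)
    simpa [scalU_one] using this
  rw [h2, h5] at h4
  refine ⟨z⁻¹, ?_⟩
  have h6 : scalU (ι := α) z⁻¹ * scalU z = 1 := by rw [← scalU_mul, inv_mul_cancel, scalU_one]
  calc A = (scalU z⁻¹ * scalU z) * A := by rw [h6, one_mul]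
    _ = scalU z⁻¹ := by rw [mul_assoc, ← h4, mul_one]

lemma kronU_left_inj [Nonempty α] {A : U α} {B B' : U β} (h : kronU A B = kronU A B') : B = B' := by
  have h1 : (A : Matrix α α ℂ) ⊗ₖ (B : Matrix β β ℂ) = (A : Matrix α α ℂ) ⊗ₖ (B' : Matrix β β ℂ) := by
    rw [← kronU_coe, ← kronU_coe, h]
  have h2 := congrArg (fun M => trA (((A : Matrix α α ℂ)ᴴ ⊗ₖ (1 : Matrix β β ℂ)) * M)) h1
  simp only [← mul_kronecker_mul, one_mul, trA_kron, U_star_mul,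
    trace_one] at h2
  apply Subtype.ext
  have hne : (Fintype.card α : ℂ) ≠ 0 := by exact_mod_cast Fintype.card_ne_zero
  exact smul_right_injective _ hne h2

lemma kronU_mul (A A' : U α) (B B' : U β) : kronU A B * kronU A' B' = kronU (A * A') (B * B') := by
  apply Subtype.ext
  rw [U_coe_mul, kronU_coe, kronU_coe, kronU_coe, U_coe_mul, U_coe_mul, mul_kronecker_mul]
lemma kronU_one : kronU (1 : U α) (1 : U β) = 1 := by
  apply Subtype.ext
  rw [kronU_coe, U_coe_one, U_coe_one, U_coe_one, one_kronecker_one]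
lemma kronU_inv (A : U α) (B : U β) : (kronU A B)⁻¹ = kronU A⁻¹ B⁻¹ := by
  rw [inv_eq_iff_mul_eq_one, kronU_mul, mul_inv_cancel, mul_inv_cancel, kronU_one]
lemma kronU_cont {Y : Type} [TopologicalSpace Y] {F : Y → U α} {G : Y → U β} (hF : Continuous F)
    (hG : Continuous G) : Continuous fun y => kronU (F y) (G y) := by
  refine Continuous.subtype_mk ?_ _
  have h1 : Continuous fun y => (F y : Matrix α α ℂ) := continuous_subtype_val.comp hF
  have h2 : Continuous fun y => (G y : Matrix β β ℂ) := continuous_subtype_val.comp hG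
  refine continuous_pi fun i => continuous_pi fun j => ?_
  exact (h1.matrix_elem _ _).mul (h2.matrix_elem _ _)

/-- lifting a homotopy through `U α × U β → U (α × β)` -/
lemma kron_HLP [Nonempty α] [Nonempty β] {Y : Type} [TopologicalSpace Y] [CompactSpace Y]
    (H : Y × I → U (α × β)) (hH : Continuous H) (hk : ∀ p, ∃ A B, H p = kronU A B)
    (h0 : ∀ y, H (y, 0) = 1) :
    ∃ F : Y × I → U α × U β, Continuous F ∧ (∀ y, F (y, 0) = 1) ∧
      (∀ p, kronU (F p).1 (F p).2 = H p) ∧ ∀ y, (∀ t, H (y, t) = 1) → ∀ t, F (y, t) = 1 := by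
  let V : Set (Matrix (α × β) (α × β) ℂ) := {M | IsUnit (trB M)}
  let O : Set (Matrix (α × β) (α × β) ℂ) := {M | ∃ (A : U α) (B : U β), M = (kronU A B : Matrix _ _ ℂ)}
  have hOV : ∀ v ∈ V ∩ O, ∃ (A : U α) (B : U β), v = (A : Matrix α α ℂ) ⊗ₖ (B : Matrix β β ℂ) ∧
      (B : Matrix β β ℂ).trace ≠ 0 := by
    rintro v ⟨hv, A, B, rfl⟩
    refine ⟨A, B, rfl, fun h0 => ?_⟩
    change IsUnit (trB ((A : Matrix α α ℂ) ⊗ₖ (B : Matrix β β ℂ))) at hv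
    rw [trB_kron, h0, zero_smul] at hv
    exact not_isUnit_zero hv
  have hVo : IsOpen V := by
    have : V = (fun M => (trB M).det) ⁻¹' {0}ᶜ := by
      ext M
      simp [V, Matrix.isUnit_iff_isUnit_det]
    rw [this]
    exact isOpen_compl_singleton.preimage (Continuous.matrix_det trB_continuous)
  have hone : (1 : Matrix (α × β) (α × β) ℂ) = ((1 : U α) : Matrix α α ℂ) ⊗ₖ ((1 : U β) : Matrix β β ℂ) := by
    rw [U_coe_one, U_coe_one, one_kronecker_one]
  have htr1 : ((1 : U β) : Matrix β β ℂ).trace = Fintype.card β := by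
    rw [U_coe_one, trace_one]
  have htr1' : ((1 : U β) : Matrix β β ℂ).trace ≠ 0 := by
    rw [htr1]; exact_mod_cast Fintype.card_ne_zero
  have hs : ContinuousOn (fun M => ((secA M, secB M) : U α × U β)) (V ∩ O) := by
    rw [continuousOn_iff_continuous_domRestrict]
    have hA : Continuous fun M : ↥(V ∩ O) => secA (M : Matrix (α × β) (α × β) ℂ) :=
      pol_continuous _ (trB_continuous.comp continuous_subtype_val) (fun M => M.2.1)
    have hB : Continuous fun M : ↥(V ∩ O) => secB (M : Matrix (α × β) (α × β) ℂ) := by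
      refine pol_continuous _ ?_ (fun M => ?_)
      · refine trA_continuous.comp (Continuous.mul ?_ continuous_subtype_val)
        have h1 : Continuous fun M : ↥(V ∩ O) => (secA (M : Matrix (α × β) (α × β) ℂ) : Matrix α α ℂ) :=
          continuous_subtype_val.comp hA
        refine continuous_pi fun i => continuous_pi fun j => ?_
        exact (h1.matrix_conjTranspose.matrix_elem _ _).mul continuous_const
      · obtain ⟨A, B, hM, ht⟩ := hOV M M.2
        obtain ⟨z, -, -, h3, -⟩ := sec_spec A B ht
        rw [hM, h3]
        exact isUnit_smulU _ (mul_ne_zero (Circle.coe_ne_zero _) (by exact_mod_cast Fintype.card_ne_zero)) B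
    exact hA.prodMk hB
  obtain ⟨F, hF, hF0, hFH, -, hst⟩ := HLP (G := U α × U β) (B := Matrix (α × β) (α × β) ℂ) (Y := Y)
    (fun g M => (kronU g.1 g.2 : Matrix (α × β) (α × β) ℂ) * M)
    (by
      have h1 : Continuous fun p : (U α × U β) × Matrix (α × β) (α × β) ℂ =>
        (kronU p.1.1 p.1.2 : Matrix (α × β) (α × β) ℂ) := 
        continuous_subtype_val.comp (kronU_cont (by fun_prop) (by fun_prop))
      exact h1.mul continuous_snd)
    (fun x => by
      change (kronU (1 : U α) (1 : U β) : Matrix (α × β) (α × β) ℂ) * x = x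
      rw [kronU_one, U_coe_one, one_mul])
    (fun g h x => by
      change (kronU (g.1 * h.1) (g.2 * h.2) : Matrix (α × β) (α × β) ℂ) * x = _
      rw [← kronU_mul, U_coe_mul, mul_assoc])
    1 V O hVo
    (by
      change IsUnit (trB (1 : Matrix (α × β) (α × β) ℂ))
      rw [hone, trB_kron, htr1]
      exact isUnit_smulU _ (by exact_mod_cast Fintype.card_ne_zero) _)
    (fun M => (secA M, secB M)) hs
    (by
      obtain ⟨z, hz, h1, -, h2⟩ := sec_spec (1 : U α) (1 : U β) htr1'
      have hz1 : z = 1 := by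
        rw [htr1] at hz
        simp only [Complex.norm_natCast] at hz
        apply Circle.ext
        have hne : (Fintype.card β : ℂ) ≠ 0 := by exact_mod_cast Fintype.card_ne_zero
        have : (z : ℂ) * (Fintype.card β : ℂ) = 1 * (Fintype.card β : ℂ) := by
          rw [one_mul]; exact_mod_cast hz.symm
        rw [Circle.coe_one]
        exact mul_right_cancel₀ hne this
      rw [hone, h1, h2, hz1]
      simp [scalU_one])
    (fun v hv => by
      obtain ⟨A, B, hM, ht⟩ := hOV v hv
      obtain ⟨z, -, h1, -, h2⟩ := sec_spec A B ht
      dsimp only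
      rw [mul_one, hM, h1, h2, kron_scal, kronU_coe])
    ⊤ (fun _ _ => trivial)
    (by
      rintro g - v ⟨A, B, rfl⟩
      exact ⟨g.1 * A, g.2 * B, by rw [← kronU_mul, U_coe_mul]⟩)
    (fun _ => 1) continuous_const (fun _ => trivial)
    (fun p => (H p : Matrix (α × β) (α × β) ℂ)) (continuous_subtype_val.comp hH)
    (fun p => by
      obtain ⟨A, B, h⟩ := hk p
      exact ⟨A, B, by rw [h]⟩)
    (fun y => by
      change _ = (kronU (1 : U α) (1 : U β) : Matrix (α × β) (α × β) ℂ) * 1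
      rw [h0, kronU_one, mul_one])
  refine ⟨F, hF, hF0, fun p => ?_, fun y hy t => ?_⟩
  · apply Subtype.ext
    have := hFH p
    rwa [mul_one] at this
  · refine hst y (fun t => ?_) t
    rw [hy, hy]
end hlift
end BottPf

namespace BottPf
set_option linter.unusedSectionVars false
set_option linter.unusedSimpArgs false
open scoped unitInterval Topology.Homotopy

section hlift2
variable {α β : Type} [Fintype α] [DecidableEq α] [Fintype β] [DecidableEq β]

/-- coordinates on the cube `Fin (n+1) → I` -/
def tl {n : ℕ} (z : Fin (n + 1) → I) : Fin n → I := fun i => z i.succ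
def cn {n : ℕ} (t : I) (y : Fin n → I) : Fin (n + 1) → I := Fin.cons t y
lemma tl_cont {n : ℕ} : Continuous (tl (n := n)) := by unfold tl; fun_prop
lemma cn_cont {n : ℕ} : Continuous (fun p : I × (Fin n → I) => cn p.1 p.2) := by
  refine continuous_pi fun i => ?_
  refine Fin.cases ?_ (fun j => ?_) i
  · simpa [cn] using continuous_fst
  · simp only [cn, Fin.cons_succ]; fun_prop
@[simp] lemma cn_zero {n : ℕ} (t : I) (y : Fin n → I) : cn t y 0 = t := rfl
@[simp] lemma tl_cn {n : ℕ} (t : I) (y : Fin n → I) : tl (cn t y) = y := rfl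
@[simp] lemma cn_tl {n : ℕ} (z : Fin (n + 1) → I) : cn (z 0) (tl z) = z := Fin.cons_self_tail z
lemma bd_iff {n : ℕ} (z : Fin (n + 1) → I) :
    z ∈ Cube.boundary (Fin (n + 1)) ↔ z 0 = 0 ∨ z 0 = 1 ∨ tl z ∈ Cube.boundary (Fin n) := by
  constructor
  · rintro ⟨i, hi⟩
    rcases Fin.eq_zero_or_eq_succ i with rfl | ⟨j, rfl⟩
    · tauto
    · exact Or.inr (Or.inr ⟨j, hi⟩)
  · rintro (h | h | ⟨j, hj⟩)
    · exact ⟨0, Or.inl h⟩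
    · exact ⟨0, Or.inr h⟩
    · exact ⟨j.succ, hj⟩
lemma bd_cn {n : ℕ} (t : I) (y : Fin n → I) (h : y ∈ Cube.boundary (Fin n)) :
    cn t y ∈ Cube.boundary (Fin (n + 1)) := by rw [bd_iff]; simp [h]
lemma bd_cn0 {n : ℕ} (y : Fin n → I) : cn 0 y ∈ Cube.boundary (Fin (n + 1)) := by
  rw [bd_iff]; simp
lemma bd_cn1 {n : ℕ} (y : Fin n → I) : cn 1 y ∈ Cube.boundary (Fin (n + 1)) := by
  rw [bd_iff]; simp

noncomputable def detC (A : U α) : Circle := ⟨(A : Matrix α α ℂ).det, by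
  have h := Matrix.det_of_mem_unitary A.2
  have h1 : ‖(A : Matrix α α ℂ).det‖ = 1 := by
    simpa using CStarRing.norm_of_mem_unitary h
  simpa [Submonoid.unitSphere] using h1⟩
lemma detC_coe (A : U α) : (detC A : ℂ) = (A : Matrix α α ℂ).det := rfl
lemma detC_cont : Continuous (detC (α := α)) :=
  Continuous.subtype_mk (Continuous.matrix_det continuous_subtype_val) _
lemma detC_mul (A B : U α) : detC (A * B) = detC A * detC B := by
  apply Circle.ext; simp [detC_coe]
lemma detC_one : detC (1 : U α) = 1 := by
  apply Circle.ext; simp [detC_coe]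
lemma detC_scal (z : Circle) : detC (scalU (ι := α) z) = z ^ Fintype.card α := by
  apply Circle.ext; simp [detC_coe, Matrix.det_smul]

lemma exp_pow (x : ℝ) (k : ℕ) : Circle.exp x ^ k = Circle.exp (k * x) := by
  induction k with
  | zero => simp
  | succ k ih => rw [pow_succ, ih, ← Circle.exp_add]; congr 1; push_cast; ring

theorem kron_lift [Nonempty α] [Nonempty β] {n : ℕ} (h : Ω^ (Fin (n + 1)) (U (α × β)) (1 : U (α × β)))
    (hk : ∀ z, ∃ A B, h z = kronU A B) :
    ∃ (A : Ω^ (Fin (n + 1)) (U α) (1 : U α)) (B : Ω^ (Fin (n + 1)) (U β) (1 : U β)),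
      ∀ z, h z = kronU (A z) (B z) := by
  obtain ⟨F, hF, hF0, hFH, hst⟩ := kron_HLP (fun p : (Fin n → I) × I => h (cn p.2 p.1))
    ((contL h).comp (cn_cont.comp continuous_swap)) (fun p => hk _)
    (fun y => GenLoop.boundary h _ (bd_cn0 y))
  have hst' : ∀ y ∈ Cube.boundary (Fin n), ∀ t, F (y, t) = 1 := fun y hy =>
    hst y (fun t => GenLoop.boundary h _ (bd_cn t y hy))
  let A0 : (Fin (n + 1) → I) → U α := fun z => (F (tl z, z 0)).1
  let B0 : (Fin (n + 1) → I) → U β := fun z => (F (tl z, z 0)).2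
  have hFz : Continuous fun z : Fin (n + 1) → I => F (tl z, z 0) :=
    hF.comp (tl_cont.prodMk (continuous_apply 0))
  have cA0 : Continuous A0 := continuous_fst.comp hFz
  have cB0 : Continuous B0 := continuous_snd.comp hFz
  have hAB : ∀ z, kronU (A0 z) (B0 z) = h z := fun z => by
    have := hFH (tl z, z 0)
    simpa only [cn_tl] using this
  -- the determinant
  obtain ⟨Φ, hΦ, hd⟩ := cube_lift (fun z => detC (A0 z)) (detC_cont.comp cA0)
  have A00 : ∀ y, A0 (cn 0 y) = 1 := fun y => by
    change (F (y, 0)).1 = 1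
    rw [hF0]; rfl
  have A0b : ∀ t, ∀ y ∈ Cube.boundary (Fin n), A0 (cn t y) = 1 := fun t y hy => by
    change (F (y, t)).1 = 1
    rw [hst' y hy]; rfl
  let c0 := Φ (cn 0 fun _ => 0)
  have Φ0 : ∀ y, Φ (cn 0 y) = c0 := by
    have : (fun y : Fin n → I => Φ (cn 0 y)) = fun _ => c0 := by
      refine circle_const _ _ (hΦ.comp (cn_cont.comp (by fun_prop : Continuous fun y => ((0 : I), y))))
        continuous_const (fun y => ?_) (fun _ => 0) rfl
      rw [hd, hd, A00, A00]
    exact congrFun this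
  have Φb : ∀ t, ∀ y ∈ Cube.boundary (Fin n), Φ (cn t y) = c0 := fun t y hy => by
    have : (fun t : I => Φ (cn t y)) = fun _ => c0 := by
      refine circle_const _ _ (hΦ.comp (cn_cont.comp (by fun_prop : Continuous fun t => (t, y))))
        continuous_const (fun t => ?_) 0 (Φ0 y)
      rw [hd, hd, A0b t y hy, A00]
    exact congrFun this t
  have hc0 : Circle.exp c0 = 1 := by
    change Circle.exp (Φ (cn 0 fun _ => 0)) = 1
    rw [hd, A00, detC_one]
  set k := Fintype.card α with hkd
  have hk0 : (k : ℝ) ≠ 0 := by exact_mod_cast Fintype.card_ne_zero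
  let w : (Fin (n + 1) → I) → Circle := fun z => Circle.exp (-((Φ z - c0) / k))
  have hw : Continuous w := Circle.exp.continuous.comp (by fun_prop)
  let A1 : (Fin (n + 1) → I) → U α := fun z => scalU (w z) * A0 z
  have cA1 : Continuous A1 := (scalU_continuous.comp hw).mul cA0
  have detA1 : ∀ z, detC (A1 z) = 1 := fun z => by
    change detC (scalU (w z) * A0 z) = 1
    rw [detC_mul, detC_scal, ← hd, exp_pow, ← Circle.exp_add, ← hc0]
    congr 1
    field_simp
    ring
  have A10 : ∀ y, A1 (cn 0 y) = 1 := fun y => by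
    change scalU (Circle.exp (-((Φ _ - c0) / k))) * A0 _ = 1
    rw [A00, Φ0]; simp [scalU_one]
  have A1b : ∀ t, ∀ y ∈ Cube.boundary (Fin n), A1 (cn t y) = 1 := fun t y hy => by
    change scalU (Circle.exp (-((Φ _ - c0) / k))) * A0 _ = 1
    rw [A0b t y hy, Φb t y hy]; simp [scalU_one]
  have A11 : ∀ y, ∃ μ : Circle, A1 (cn 1 y) = scalU μ := fun y => by
    have h1 := hAB (cn 1 y)
    rw [GenLoop.boundary h _ (bd_cn1 y)] at h1
    obtain ⟨z, hz⟩ := kron_eq_one h1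
    refine ⟨w (cn 1 y) * z, ?_⟩
    change scalU _ * A0 _ = _
    rw [hz, scalU_mul]
  choose μ hμ using A11
  have cμ : Continuous μ := by
    let i0 := Classical.arbitrary α
    have h1 : Continuous fun y => (A1 (cn 1 y) : Matrix α α ℂ) i0 i0 :=
      (continuous_subtype_val.comp (cA1.comp (cn_cont.comp
        (by fun_prop : Continuous fun y => ((1 : I), y))))).matrix_elem _ _
    refine (continuous_induced_rng (f := fun z : Circle => (z : ℂ))).2 (h1.congr fun y => ?_)
    rw [hμ]
    change ((μ y : ℂ) • (1 : Matrix α α ℂ)) i0 i0 = (μ y : ℂ)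
    simp
  obtain ⟨ψ, hψ, hψe⟩ := cube_lift μ cμ
  have hψc : ∀ y, ψ y = ψ (fun _ => 0) := by
    have : (fun y => (k : ℝ) * ψ y) = fun _ => (k : ℝ) * ψ (fun _ => 0) := by
      refine circle_const _ _ (by fun_prop) continuous_const (fun y => ?_) (fun _ => 0) rfl
      have h1 : ∀ y, Circle.exp (k * ψ y) = 1 := fun y => by
        rw [← exp_pow, hψe, ← detA1 (cn 1 y), hμ, detC_scal]
      rw [h1, h1]
    intro y
    exact mul_left_cancel₀ hk0 (congrFun this y)
  obtain ⟨φ, hφ, hφb⟩ : ∃ φ : ℝ, (∀ y, A1 (cn 1 y) = scalU (Circle.exp φ)) ∧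
      ∀ y ∈ Cube.boundary (Fin n), φ = 0 := by
    by_cases hc : Circle.exp (ψ fun _ => 0) = 1
    · refine ⟨0, fun y => ?_, fun _ _ => rfl⟩
      rw [hμ, ← hψe, hψc, hc]; simp
    · refine ⟨_, fun y => by rw [hμ, ← hψe, hψc], fun y hy => (hc ?_).elim⟩
      rw [← hψc y, hψe]
      apply scalU_inj (ι := α)
      rw [← hμ, A1b 1 y hy, scalU_one]
  -- final correction
  let v : (Fin (n + 1) → I) → Circle := fun z => Circle.exp (-(φ * (z 0 : ℝ)))
  have hv : Continuous v := Circle.exp.continuous.comp (by fun_prop)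
  let A2 : (Fin (n + 1) → I) → U α := fun z => scalU (v z * w z) * A0 z
  let B2 : (Fin (n + 1) → I) → U β := fun z => scalU (v z * w z)⁻¹ * B0 z
  have hA2 : ∀ z, A2 z = scalU (v z) * A1 z := fun z => by
    change scalU (v z * w z) * A0 z = scalU (v z) * (scalU (w z) * A0 z)
    rw [scalU_mul, mul_assoc]
  have cA2 : Continuous A2 := (scalU_continuous.comp (hv.mul hw)).mul cA0
  have cB2 : Continuous B2 := (scalU_continuous.comp (hv.mul hw).inv).mul cB0
  have h2 : ∀ z, kronU (A2 z) (B2 z) = h z := fun z => by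
    rw [← hAB]
    exact kron_scal _ _ _
  have bA : ∀ z ∈ Cube.boundary (Fin (n + 1)), A2 z = 1 := by
    intro z hz
    rw [hA2]
    rw [← cn_tl z]
    rcases (bd_iff z).1 hz with h | h | h
    · rw [h, A10]; simp [v, scalU_one]
    · rw [h, hφ, ← scalU_mul]
      have : v (cn 1 (tl z)) * Circle.exp φ = 1 := by
        change Circle.exp (-(φ * ((1 : I) : ℝ))) * _ = 1
        rw [← Circle.exp_add]; simp
      rw [this, scalU_one]
    · rw [A1b _ _ h]; simp [v, hφb _ h, scalU_one]
  have bB : ∀ z ∈ Cube.boundary (Fin (n + 1)), B2 z = 1 := by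
    intro z hz
    have h3 := h2 z
    rw [bA z hz, GenLoop.boundary h z hz, ← kronU_one] at h3
    exact kronU_left_inj h3
  exact ⟨mkL A2 cA2 bA, mkL B2 cB2 bB, fun z => (h2 z).symm⟩
end hlift2
end BottPf

namespace BottPf
set_option linter.unusedSectionVars false
set_option linter.unusedSimpArgs false
open scoped unitInterval Topology.Homotopy
open scoped ComplexOrder MatrixOrder

section retr
variable {α β ι : Type} [Fintype α] [DecidableEq α] [Fintype β] [DecidableEq β]
  [Fintype ι] [DecidableEq ι]

lemma posP_unique {A P : Matrix ι ι ℂ} (hP : P.PosSemidef) (h : P * P = Aᴴ * A) : posP A = P :=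
  CFC.sqrt_unique h hP.nonneg
lemma posP_psd (A : Matrix ι ι ℂ) : (posP A).PosSemidef := by
  rw [← nonneg_iff_posSemidef]; exact CFC.sqrt_nonneg _
lemma posP_conj (W : U ι) (A : Matrix ι ι ℂ) :
    posP ((W : Matrix ι ι ℂ) * A * (W : Matrix ι ι ℂ)ᴴ) =
      (W : Matrix ι ι ℂ) * posP A * (W : Matrix ι ι ℂ)ᴴ := by
  apply posP_unique ((posP_psd A).mul_mul_conjTranspose_same _)
  have h : ∀ X Y : Matrix ι ι ℂ, ((W : Matrix ι ι ℂ) * X * (W : Matrix ι ι ℂ)ᴴ) *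
      ((W : Matrix ι ι ℂ) * Y * (W : Matrix ι ι ℂ)ᴴ) =
      (W : Matrix ι ι ℂ) * (X * Y) * (W : Matrix ι ι ℂ)ᴴ := fun X Y => by
    calc _ = (W : Matrix ι ι ℂ) * X * ((W : Matrix ι ι ℂ)ᴴ * (W : Matrix ι ι ℂ)) * Y *
        (W : Matrix ι ι ℂ)ᴴ := by simp only [Matrix.mul_assoc]
      _ = _ := by rw [U_star_mul, Matrix.mul_one]; simp only [Matrix.mul_assoc]
  rw [h, posP_mul_self, conjTranspose_mul, conjTranspose_mul, conjTranspose_conjTranspose,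
    ← Matrix.mul_assoc (W : Matrix ι ι ℂ) Aᴴ (W : Matrix ι ι ℂ)ᴴ, h]

/-- realignment -/
def ral (g : Matrix (α × β) (α × β) ℂ) : Matrix (α × α) (β × β) ℂ :=
  fun a b => g (a.1, b.1) (a.2, b.2)
def unral (R : Matrix (α × α) (β × β) ℂ) : Matrix (α × β) (α × β) ℂ :=
  fun x y => R (x.1, y.1) (x.2, y.2)
lemma unral_ral (g : Matrix (α × β) (α × β) ℂ) : unral (ral g) = g := rfl
lemma ral_unral (R : Matrix (α × α) (β × β) ℂ) : ral (unral R) = R := rfl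
lemma ral_mul_kron (g : Matrix (α × β) (α × β) ℂ) (C : Matrix α α ℂ) (D : Matrix β β ℂ) :
    ral (g * (C ⊗ₖ D)) = ((1 : Matrix α α ℂ) ⊗ₖ Cᵀ) * ral g * ((1 : Matrix β β ℂ) ⊗ₖ D) := by
  ext ⟨a, a'⟩ ⟨b, b'⟩
  have h1 : ∀ y, (((1 : Matrix α α ℂ) ⊗ₖ Cᵀ) * ral g) (a, a') y = ∑ c, C c a' * ral g (a, c) y := by
    intro y
    rw [Matrix.mul_apply, Fintype.sum_prod_type, Finset.sum_eq_single a]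
    · simp
    · intro x _ hx
      simp [Matrix.one_apply_ne (Ne.symm hx)]
    · simp
  have h2 : ral (g * (C ⊗ₖ D)) (a, a') (b, b') = ∑ c, ∑ d, g (a, b) (c, d) * (C c a' * D d b') := by
    change (g * (C ⊗ₖ D)) (a, b) (a', b') = _
    rw [Matrix.mul_apply, Fintype.sum_prod_type]
    rfl
  rw [h2, Matrix.mul_apply, Fintype.sum_prod_type, Finset.sum_eq_single b]
  · simp only [h1, kroneckerMap_apply, Matrix.one_apply_eq, one_mul, Finset.sum_mul]
    rw [Finset.sum_comm]
    refine Finset.sum_congr rfl fun d _ => Finset.sum_congr rfl fun c _ => ?_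
    change _ = C c a' * g (a, b) (c, d) * D d b'
    ring
  · intro x _ hx
    simp [Matrix.one_apply_ne hx]
  · simp
lemma unral_mul (R : Matrix (α × α) (β × β) ℂ) (C : Matrix α α ℂ) (D : Matrix β β ℂ) :
    unral (((1 : Matrix α α ℂ) ⊗ₖ Cᵀ) * R * ((1 : Matrix β β ℂ) ⊗ₖ D)) = unral R * (C ⊗ₖ D) := by
  have := congrArg unral (ral_mul_kron (unral R) C D)
  rw [ral_unral, unral_ral] at this
  exact this.symm

def kap (g : Matrix (α × β) (α × β) ℂ) : Matrix (α × α) (α × α) ℂ := ral g * (ral g)ᴴ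
variable (α β) in
noncomputable def mO : ℝ := Fintype.card α * Fintype.card β
noncomputable def kapM (g : Matrix (α × β) (α × β) ℂ) : Matrix (α × α) (α × α) ℂ :=
  kap g - ((mO α β / 2 : ℝ) : ℂ) • 1
noncomputable def MM (g : Matrix (α × β) (α × β) ℂ) : Matrix (α × α) (α × α) ℂ :=
  posP (kapM g) + kapM g
noncomputable def r0 (g : Matrix (α × β) (α × β) ℂ) : Matrix (α × β) (α × β) ℂ :=
  unral (MM g * ral g)

lemma ral_cont : Continuous (ral (α := α) (β := β)) :=
  continuous_pi fun _ => continuous_pi fun _ => continuous_id.matrix_elem _ _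
lemma unral_cont : Continuous (unral (α := α) (β := β)) :=
  continuous_pi fun _ => continuous_pi fun _ => continuous_id.matrix_elem _ _
lemma kapM_cont : Continuous (kapM (α := α) (β := β)) := by
  have := ral_cont (α := α) (β := β)
  unfold kapM kap
  fun_prop
lemma r0_cont : Continuous (r0 (α := α) (β := β)) := by
  have h1 := ral_cont (α := α) (β := β)
  have h2 := kapM_cont (α := α) (β := β)
  have h3 : Continuous fun g : Matrix (α × β) (α × β) ℂ => posP (kapM g) :=
    sqrt_continuous _ (by fun_prop) (fun y => posSemidef_conjTranspose_mul_self _)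
  have h4 : Continuous fun g : Matrix (α × β) (α × β) ℂ => MM g * ral g := by
    unfold MM; fun_prop
  exact unral_cont.comp h4

lemma trans_mem (C : U α) : (C : Matrix α α ℂ)ᵀ ∈ Matrix.unitaryGroup α ℂ := by
  apply mem_U
  have h2 := congrArg transpose (U_mul_star C)
  rw [transpose_mul, transpose_one] at h2
  exact h2

lemma r0_mul (g : Matrix (α × β) (α × β) ℂ) (C : U α) (D : U β) :
    r0 (g * ((C : Matrix α α ℂ) ⊗ₖ (D : Matrix β β ℂ))) =
      r0 g * ((C : Matrix α α ℂ) ⊗ₖ (D : Matrix β β ℂ)) := by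
  let P : U (α × α) := kronU 1 ⟨_, trans_mem C⟩
  have hP : (P : Matrix (α × α) (α × α) ℂ) = (1 : Matrix α α ℂ) ⊗ₖ (C : Matrix α α ℂ)ᵀ := rfl
  let Q : U (β × β) := kronU 1 D
  have hQ : (Q : Matrix (β × β) (β × β) ℂ) = (1 : Matrix β β ℂ) ⊗ₖ (D : Matrix β β ℂ) := rfl
  have hr : ral (g * ((C : Matrix α α ℂ) ⊗ₖ (D : Matrix β β ℂ))) = (P : Matrix (α × α) (α × α) ℂ) *
    ral g * (Q : Matrix (β × β) (β × β) ℂ) := by rw [ral_mul_kron, hP, hQ]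
  have hk : kap (g * ((C : Matrix α α ℂ) ⊗ₖ (D : Matrix β β ℂ))) =
      (P : Matrix (α × α) (α × α) ℂ) * kap g * (P : Matrix (α × α) (α × α) ℂ)ᴴ := by
    unfold kap
    rw [hr, conjTranspose_mul, conjTranspose_mul]
    calc _ = (P : Matrix (α × α) (α × α) ℂ) * ral g * ((Q : Matrix (β × β) (β × β) ℂ) *
          (Q : Matrix (β × β) (β × β) ℂ)ᴴ) * (ral g)ᴴ * (P : Matrix (α × α) (α × α) ℂ)ᴴ := by
            simp only [Matrix.mul_assoc]
      _ = _ := by rw [U_mul_star, Matrix.mul_one]; simp only [Matrix.mul_assoc]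
  have hkM : kapM (g * ((C : Matrix α α ℂ) ⊗ₖ (D : Matrix β β ℂ))) =
      (P : Matrix (α × α) (α × α) ℂ) * kapM g * (P : Matrix (α × α) (α × α) ℂ)ᴴ := by
    unfold kapM
    rw [hk, Matrix.mul_sub, Matrix.sub_mul, mul_smul_comm, smul_mul_assoc, Matrix.mul_one, U_mul_star]
  unfold r0
  rw [← unral_mul, ← hP, ← hQ]
  congr 1
  unfold MM
  rw [hkM, posP_conj, ← Matrix.add_mul, ← Matrix.mul_add, hr]
  calc _ = (P : Matrix (α × α) (α × α) ℂ) * (posP (kapM g) + kapM g) *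
        ((P : Matrix (α × α) (α × α) ℂ)ᴴ * (P : Matrix (α × α) (α × α) ℂ)) * ral g *
          (Q : Matrix (β × β) (β × β) ℂ) := by simp only [Matrix.mul_assoc]
    _ = _ := by rw [U_star_mul, Matrix.mul_one]; simp only [Matrix.mul_assoc]

lemma kap_trace (g : U (α × β)) : (kap (g : Matrix (α × β) (α × β) ℂ)).trace = (mO α β : ℝ) := by
  have h1 : (kap (g : Matrix (α × β) (α × β) ℂ)).trace =
      ((g : Matrix (α × β) (α × β) ℂ) * (g : Matrix (α × β) (α × β) ℂ)ᴴ).trace := by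
    simp only [kap, Matrix.trace, diag_apply, Matrix.mul_apply, conjTranspose_apply, ral,
      Fintype.sum_prod_type]
    refine Finset.sum_congr rfl fun a _ => ?_
    rw [Finset.sum_comm]
  rw [h1, U_mul_star, trace_one]
  simp [mO]

lemma r0_rank [Nonempty α] (g : U (α × β)) : ∃ (X : Matrix α α ℂ) (Y : Matrix β β ℂ),
    r0 (g : Matrix (α × β) (α × β) ℂ) = X ⊗ₖ Y := by
  set G := (g : Matrix (α × β) (α × β) ℂ) with hG
  have hpsd : (kap G).PosSemidef := posSemidef_self_mul_conjTranspose _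
  have hh := hpsd.isHermitian
  let lam := hh.eigenvalues
  let W : U (α × α) := hh.eigenvectorUnitary
  have hsp : kap G = (W : Matrix (α × α) (α × α) ℂ) * Matrix.diagonal (fun i => (lam i : ℂ)) *
      (W : Matrix (α × α) (α × α) ℂ)ᴴ := by
    have := hh.spectral_theorem
    rw [Unitary.conjStarAlgAut_apply] at this
    exact this
  have hnn : ∀ i, 0 ≤ lam i := hpsd.eigenvalues_nonneg
  have hsum : ∑ i, lam i = mO α β := by
    have := hh.trace_eq_sum_eigenvalues
    rw [kap_trace] at this
    have h2 : ((∑ i, lam i : ℝ) : ℂ) = (mO α β : ℝ) := by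
      rw [this]; push_cast; rfl
    exact Complex.ofReal_injective h2
  set m := mO α β with hm
  have hex : ∃ i0, ∀ i, i ≠ i0 → lam i ≤ m / 2 := by
    by_cases h : ∃ i0, m / 2 < lam i0
    · obtain ⟨i0, hi0⟩ := h
      refine ⟨i0, fun i hi => ?_⟩
      have h1 : lam i + lam i0 ≤ ∑ j, lam j := by
        rw [← Finset.sum_pair hi]
        exact Finset.sum_le_sum_of_subset_of_nonneg (Finset.subset_univ _) fun j _ _ => hnn j
      linarith
    · push Not at h
      exact ⟨Classical.arbitrary _, fun i _ => h i⟩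
  obtain ⟨i0, hi0⟩ := hex
  have hkM : kapM G = (W : Matrix (α × α) (α × α) ℂ) * Matrix.diagonal (fun i => ((lam i - m / 2 : ℝ) : ℂ)) *
      (W : Matrix (α × α) (α × α) ℂ)ᴴ := by
    have h1 : Matrix.diagonal (fun i => ((lam i - m / 2 : ℝ) : ℂ)) =
        Matrix.diagonal (fun i => (lam i : ℂ)) - ((m / 2 : ℝ) : ℂ) • 1 := by
      rw [← Matrix.diagonal_one, ← Matrix.diagonal_smul, Matrix.diagonal_sub]
      congr 1
      funext i
      simp
    unfold kapM
    rw [h1, Matrix.mul_sub, Matrix.sub_mul, mul_smul_comm, smul_mul_assoc, Matrix.mul_one, U_mul_star,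
      ← hsp]
  have hpos : posP (Matrix.diagonal (fun i => ((lam i - m / 2 : ℝ) : ℂ))) =
      Matrix.diagonal (fun i => ((|lam i - m / 2| : ℝ) : ℂ)) := by
    apply posP_unique
    · rw [posSemidef_diagonal_iff]
      intro i
      exact_mod_cast abs_nonneg _
    · rw [diagonal_conjTranspose, diagonal_mul_diagonal, diagonal_mul_diagonal]
      congr 1
      funext i
      simp only [Pi.star_apply, RCLike.star_def, Complex.conj_ofReal]
      rw [← Complex.ofReal_mul, ← Complex.ofReal_mul, abs_mul_abs_self]
  let c : ℂ := ((|lam i0 - m / 2| + (lam i0 - m / 2) : ℝ) : ℂ)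
  have hMM : MM G = (W : Matrix (α × α) (α × α) ℂ) * Matrix.diagonal (fun i => if i = i0 then c else 0) *
      (W : Matrix (α × α) (α × α) ℂ)ᴴ := by
    unfold MM
    rw [hkM, posP_conj, hpos, ← Matrix.add_mul, ← Matrix.mul_add, diagonal_add]
    congr 3
    funext i
    split_ifs with h
    · rw [h]; simp [c]
    · have := hi0 i h
      rw [← Complex.ofReal_add, abs_of_nonpos (by linarith)]
      simp
  let S := (W : Matrix (α × α) (α × α) ℂ)ᴴ * ral G
  have hMR : ∀ x y, (MM G * ral G) x y = (W : Matrix (α × α) (α × α) ℂ) x i0 * c * S i0 y := by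
    intro x y
    rw [hMM, Matrix.mul_assoc, Matrix.mul_assoc]
    change ((W : Matrix (α × α) (α × α) ℂ) * (Matrix.diagonal (fun i => if i = i0 then c else 0) * S)) x y = _
    rw [Matrix.mul_apply]
    simp only [diagonal_mul, ite_mul, mul_ite, zero_mul, mul_zero]
    rw [Finset.sum_ite_eq']
    simp [mul_assoc]
  refine ⟨fun a a' => (W : Matrix (α × α) (α × α) ℂ) (a, a') i0 * c, fun b b' => S i0 (b, b'), ?_⟩
  ext ⟨a, b⟩ ⟨a', b'⟩
  exact hMR (a, a') (b, b')

lemma r0_one : r0 (1 : Matrix (α × β) (α × β) ℂ) = ((mO α β : ℝ) : ℂ) • 1 := by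
  set R := ral (1 : Matrix (α × β) (α × β) ℂ) with hR
  have hRR : kap (1 : Matrix (α × β) (α × β) ℂ) * R = ((mO α β : ℝ) : ℂ) • R := by
    have e : ∀ x y, R x y = (if x.1 = x.2 then 1 else 0) * (if y.1 = y.2 then 1 else 0) := by
      rintro ⟨a, a'⟩ ⟨b, b'⟩
      simp only [hR, ral, Matrix.one_apply, Prod.mk.injEq]
      by_cases h1 : a = a' <;> by_cases h2 : b = b' <;> simp [h1, h2]
    unfold kap
    rw [← hR]
    ext x y
    simp only [Matrix.mul_apply, conjTranspose_apply, e, Matrix.smul_apply]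
    by_cases h1 : x.1 = x.2 <;> by_cases h2 : y.1 = y.2 <;>
      simp [h1, h2, Fintype.sum_prod_type, mO, mul_comm]
  have hkk : kap (1 : Matrix (α × β) (α × β) ℂ) * kap (1 : Matrix (α × β) (α × β) ℂ) = ((mO α β : ℝ) : ℂ) • kap (1 : Matrix (α × β) (α × β) ℂ) := by
    calc _ = (kap (1 : Matrix (α × β) (α × β) ℂ) * R) * Rᴴ := (Matrix.mul_assoc _ _ _).symm
      _ = _ := by rw [hRR, Matrix.smul_mul]; rfl
  have hm : 0 ≤ mO α β := by unfold mO; positivity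
  have hH : (kapM (1 : Matrix (α × β) (α × β) ℂ))ᴴ = kapM (1 : Matrix (α × β) (α × β) ℂ) := by
    unfold kapM kap
    rw [conjTranspose_sub, conjTranspose_smul, conjTranspose_mul]
    simp
  have hpos : posP (kapM (1 : Matrix (α × β) (α × β) ℂ)) = ((mO α β / 2 : ℝ) : ℂ) • 1 := by
    apply posP_unique
    · exact PosSemidef.one.smul (by exact_mod_cast (by positivity : 0 ≤ mO α β / 2))
    · rw [hH]
      unfold kapM
      rw [Matrix.mul_sub, Matrix.sub_mul, hkk]
      simp only [mul_smul_comm, smul_mul_assoc, Matrix.mul_one, Matrix.one_mul, smul_smul, smul_sub,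
        Matrix.sub_mul]
      rw [show ((mO α β : ℝ) : ℂ) = ((mO α β / 2 : ℝ) : ℂ) + ((mO α β / 2 : ℝ) : ℂ) by push_cast; ring]
      rw [add_smul]
      abel
  unfold r0 MM
  rw [hpos]
  unfold kapM
  rw [add_sub_cancel, ← hR, hRR]
  ext x y
  simp [unral, hR, ral]
end retr
end BottPf

namespace BottPf
set_option linter.unusedSectionVars false
set_option linter.unusedSimpArgs false
open scoped unitInterval Topology.Homotopy

section fibr
variable (α β : Type) [Fintype α] [DecidableEq α] [Fintype β] [DecidableEq β]

/-- the subgroup of Kronecker products -/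
noncomputable def HS : Subgroup (U (α × β)) where
  carrier := {g | ∃ (A : U α) (B : U β), g = kronU A B}
  mul_mem' := by
    rintro _ _ ⟨A, B, rfl⟩ ⟨A', B', rfl⟩
    exact ⟨A * A', B * B', by rw [kronU_mul]⟩
  one_mem' := ⟨1, 1, by rw [kronU_one]⟩
  inv_mem' := by
    rintro _ ⟨A, B, rfl⟩
    exact ⟨A⁻¹, B⁻¹, by rw [kronU_inv]⟩

lemma mem_HS {g : U (α × β)} : g ∈ HS α β ↔ ∃ (A : U α) (B : U β), g = kronU A B := Iff.rfl

lemma HS_closed : IsClosed (HS α β : Set (U (α × β))) := by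
  have h : (HS α β : Set (U (α × β))) = Set.range (fun p : U α × U β => kronU p.1 p.2) := by
    ext g
    constructor
    · rintro ⟨A, B, rfl⟩; exact ⟨(A, B), rfl⟩
    · rintro ⟨p, rfl⟩; exact ⟨p.1, p.2, rfl⟩
  rw [h]
  have hc : Continuous (fun p : U α × U β => kronU p.1 p.2) := kronU_cont continuous_fst continuous_snd
  exact (isCompact_range hc).isClosed

abbrev BB : Type := U (α × β) ⧸ HS α β

instance instT2BB : T2Space (BB α β) := by
  rw [t2Space_iff_of_isOpenQuotientMap (QuotientGroup.isOpenQuotientMap_mk (N := HS α β))]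
  have : {q : U (α × β) × U (α × β) | (QuotientGroup.mk q.1 : BB α β) = QuotientGroup.mk q.2} =
      (fun q : U (α × β) × U (α × β) => q.1⁻¹ * q.2) ⁻¹' (HS α β : Set (U (α × β))) := by
    ext q
    exact QuotientGroup.eq
  rw [this]
  exact (HS_closed α β).preimage (by fun_prop)

variable {α β}

noncomputable def rr (g : U (α × β)) : U (α × β) := pol (r0 (g : Matrix (α × β) (α × β) ℂ))
def VGr : Set (U (α × β)) := {g | IsUnit (r0 (g : Matrix (α × β) (α × β) ℂ))}

lemma VGr_open : IsOpen (VGr : Set (U (α × β))) := by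
  have : (VGr : Set (U (α × β))) = (fun g : U (α × β) => (r0 (g : Matrix (α × β) (α × β) ℂ)).det) ⁻¹' {0}ᶜ := by
    ext M
    simp [VGr, Matrix.isUnit_iff_isUnit_det]
  rw [this]
  exact isOpen_compl_singleton.preimage
    (Continuous.matrix_det (r0_cont.comp continuous_subtype_val))

lemma rr_contOn : ContinuousOn (rr : U (α × β) → U (α × β)) VGr := by
  rw [continuousOn_iff_continuous_domRestrict]
  exact pol_continuous _ (r0_cont.comp (continuous_subtype_val.comp continuous_subtype_val))
    (fun g => g.2)

lemma r0_mulH {g h : U (α × β)} (hh : h ∈ HS α β) :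
    r0 ((g * h : U (α × β)) : Matrix (α × β) (α × β) ℂ) =
      r0 (g : Matrix (α × β) (α × β) ℂ) * (h : Matrix (α × β) (α × β) ℂ) := by
  obtain ⟨A, B, rfl⟩ := hh
  rw [U_coe_mul, kronU_coe, r0_mul]

lemma VGr_mul {g h : U (α × β)} (hg : g ∈ VGr) (hh : h ∈ HS α β) : g * h ∈ VGr := by
  change IsUnit _
  rw [r0_mulH hh]
  exact IsUnit.mul hg (U_isUnit h)

lemma rr_mul {g h : U (α × β)} (hg : g ∈ VGr) (hh : h ∈ HS α β) : rr (g * h) = rr g * h := by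
  unfold rr
  rw [r0_mulH hh, pol_mul_right hg]

lemma rr_mem [Nonempty α] [Nonempty β] {g : U (α × β)} (hg : g ∈ VGr) : rr g ∈ HS α β := by
  obtain ⟨X, Y, h⟩ := r0_rank g
  have hg' : IsUnit (r0 (g : Matrix (α × β) (α × β) ℂ)) := hg
  rw [h, Matrix.isUnit_iff_isUnit_det, det_kronecker, isUnit_iff_ne_zero] at hg'
  have hX : IsUnit X := by
    rw [Matrix.isUnit_iff_isUnit_det, isUnit_iff_ne_zero]
    intro h0
    rw [h0, zero_pow Fintype.card_ne_zero, zero_mul] at hg'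
    exact hg' rfl
  have hY : IsUnit Y := by
    rw [Matrix.isUnit_iff_isUnit_det, isUnit_iff_ne_zero]
    intro h0
    rw [h0, zero_pow Fintype.card_ne_zero, mul_zero] at hg'
    exact hg' rfl
  refine ⟨pol X, pol Y, ?_⟩
  unfold rr
  rw [h, pol_kron hX hY]

lemma mO_pos [Nonempty α] [Nonempty β] : 0 < mO α β := by
  unfold mO
  have h1 : (0 : ℝ) < Fintype.card α := by exact_mod_cast Fintype.card_pos
  have h2 : (0 : ℝ) < Fintype.card β := by exact_mod_cast Fintype.card_pos
  positivity

lemma one_mem_VGr [Nonempty α] [Nonempty β] : (1 : U (α × β)) ∈ VGr := by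
  change IsUnit _
  rw [U_coe_one, r0_one, ← U_coe_one]
  exact isUnit_smulU _ (by exact_mod_cast (mO_pos (α := α) (β := β)).ne') _

lemma rr_one [Nonempty α] [Nonempty β] : rr (1 : U (α × β)) = 1 := by
  unfold rr
  rw [U_coe_one, r0_one, ← U_coe_one]
  have := pol_smul 1 (mO α β) mO_pos (1 : U (α × β))
  rw [Circle.coe_one, one_mul] at this
  rw [this, scalU_one, one_mul]

noncomputable def SGr (b : BB α β) : U (α × β) := b.out * (rr b.out)⁻¹

lemma SGr_mk {g : U (α × β)} (hg : g ∈ VGr) : SGr (QuotientGroup.mk g : BB α β) = g * (rr g)⁻¹ := by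
  obtain ⟨h, hh⟩ := QuotientGroup.mk_out_eq_mul (HS α β) g
  unfold SGr
  rw [hh, rr_mul hg h.2]
  group

lemma SGr_cont : ContinuousOn (SGr : BB α β → _) (QuotientGroup.mk '' (VGr : Set (U (α × β)))) := by
  rintro _ ⟨g, hg, rfl⟩
  apply ContinuousAt.continuousWithinAt
  have e := (QuotientGroup.isOpenQuotientMap_mk (N := HS α β)).map_nhds_eq g
  unfold ContinuousAt
  rw [← e, Filter.tendsto_map'_iff]
  have h1 : ContinuousAt (fun g : U (α × β) => g * (rr g)⁻¹) g :=
    continuousAt_id.mul ((rr_contOn.continuousAt (VGr_open.mem_nhds hg)).inv)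
  rw [SGr_mk hg]
  refine h1.congr' ?_
  filter_upwards [VGr_open.mem_nhds hg] with x hx
  exact (SGr_mk hx).symm

lemma BB_HLP [Nonempty α] [Nonempty β] {Y : Type} [TopologicalSpace Y] [CompactSpace Y]
    (F : Y → U (α × β)) (hF : Continuous F) (H : Y × I → BB α β) (hH : Continuous H)
    (hH0 : ∀ y, H (y, 0) = QuotientGroup.mk (F y)) :
    ∃ F' : Y × I → U (α × β), Continuous F' ∧ (∀ y, F' (y, 0) = F y) ∧
      (∀ p, QuotientGroup.mk (F' p) = H p) ∧
      (∀ y, (∀ t, H (y, t) = H (y, 0)) → ∀ t, F' (y, t) = F y) := by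
  have hact : ∀ g : U (α × β), g • (QuotientGroup.mk 1 : BB α β) = QuotientGroup.mk g := fun g => by
    rw [MulAction.Quotient.smul_mk, smul_eq_mul, mul_one]
  obtain ⟨F', h1, h2, h3, -, h5⟩ := HLP (G := U (α × β)) (B := BB α β) (Y := Y)
    (fun g b => g • b) continuous_smul (fun x => one_smul _ x) (fun g h x => mul_smul g h x)
    (QuotientGroup.mk 1) (QuotientGroup.mk '' VGr) Set.univ
    ((QuotientGroup.isOpenQuotientMap_mk (N := HS α β)).isOpenMap _ VGr_open)
    ⟨1, one_mem_VGr, rfl⟩ SGr (SGr_cont.mono Set.inter_subset_left)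
    (by rw [SGr_mk one_mem_VGr, rr_one]; simp)
    (by
      rintro _ ⟨⟨g, hg, rfl⟩, -⟩
      rw [hact, SGr_mk hg, QuotientGroup.eq]
      simpa using rr_mem hg)
    ⊤ (fun _ _ => Subgroup.mem_top _) (fun _ _ _ _ => trivial) F hF (fun _ => Subgroup.mem_top _)
    H hH (fun _ => trivial) (fun y => by rw [hH0, hact])
  exact ⟨F', h1, h2, fun p => by rw [← hact]; exact h3 p, h5⟩

noncomputable abbrev pB (g : U (α × β)) : BB α β := QuotientGroup.mk g
lemma pB_cont : Continuous (pB : U (α × β) → BB α β) := QuotientGroup.continuous_mk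
lemma pB_one {g : U (α × β)} : pB g = pB (1 : U (α × β)) ↔ g ∈ HS α β := by
  rw [eq_comm]
  change (QuotientGroup.mk _ : BB α β) = QuotientGroup.mk _ ↔ _
  rw [QuotientGroup.eq]; simp

/-- loops in `U (α × β)` becoming trivial in the quotient -/
theorem ker_lift [Nonempty α] [Nonempty β] {n : ℕ}
    (g : Ω^ (Fin (n + 1)) (U (α × β)) (1 : U (α × β)))
    (h : GenLoop.Homotopic (mapL pB pB_cont rfl g) (GenLoop.const : Ω^ (Fin (n + 1)) (BB α β) (pB 1))) :
    ∃ (A : Ω^ (Fin (n + 1)) (U α) (1 : U α)) (B : Ω^ (Fin (n + 1)) (U β) (1 : U β))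
      (g' : Ω^ (Fin (n + 1)) (U (α × β)) (1 : U (α × β))),
      GenLoop.Homotopic g g' ∧ ∀ z, g' z = kronU (A z) (B z) := by
  obtain ⟨H, hc, h0, h1, hb⟩ := exH h
  obtain ⟨F, f1, f2, f3, f4⟩ := BB_HLP g (contL g) (fun p => H (p.2, p.1)) (hc.comp continuous_swap)
    (fun y => h0 y)
  have fb : ∀ t, ∀ y ∈ Cube.boundary (Fin (n + 1)), F (y, t) = 1 := fun t y hy => by
    rw [f4 y (fun t => by simp only [hb _ y hy]) t, GenLoop.boundary g y hy]
  let g' : Ω^ (Fin (n + 1)) (U (α × β)) (1 : U (α × β)) :=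
    mkL (fun y => F (y, 1)) (by fun_prop) (fb 1)
  obtain ⟨A, B, hAB⟩ := kron_lift g' (fun z => by
    apply pB_one.1
    change (QuotientGroup.mk (F (z, 1)) : BB α β) = _
    rw [f3]
    exact h1 z)
  exact ⟨A, B, g', mkH (fun p => F (p.2, p.1)) (f1.comp continuous_swap) f2 (fun y => rfl) fb, hAB⟩

theorem ker_of [Nonempty α] [Nonempty β] {N : Type} (g : Ω^ N (U (α × β)) (1 : U (α × β)))
    (h : ∀ z, g z ∈ HS α β) : mapL pB pB_cont rfl g = (GenLoop.const : Ω^ N (BB α β) (pB 1)) :=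
  GenLoop.ext _ _ fun z => pB_one.2 (h z)

/-- null homotopy inside `HS` -/
def NullH (α β : Type) [Fintype α] [DecidableEq α] [Fintype β] [DecidableEq β] (n : ℕ) : Prop :=
  ∀ f : Ω^ (Fin n) (U (α × β)) (1 : U (α × β)), (∀ z, f z ∈ HS α β) →
    ∃ K : I × (Fin n → I) → U (α × β), Continuous K ∧ (∀ y, K (0, y) = 1) ∧ (∀ y, K (1, y) = f y) ∧
      (∀ t, ∀ y ∈ Cube.boundary (Fin n), K (t, y) = 1) ∧ ∀ p, K p ∈ HS α β

lemma null_lift [Nonempty α] [Nonempty β] {n : ℕ} (f : Ω^ (Fin n) (U (α × β)) (1 : U (α × β)))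
    (hf : ∀ z, f z ∈ HS α β) :
    ∃ (A : Ω^ (Fin n) (U α) (1 : U α)) (B : Ω^ (Fin n) (U β) (1 : U β)),
      ∀ z, f z = kronU (A z) (B z) := by
  cases n with
  | succ n => exact kron_lift f hf
  | zero =>
    obtain ⟨A, B, h⟩ := hf 0
    have hb : ∀ y : Fin 0 → I, y ∉ Cube.boundary (Fin 0) := fun y ⟨i, _⟩ => i.elim0
    refine ⟨mkL (fun _ => A) continuous_const (fun y hy => (hb y hy).elim),
      mkL (fun _ => B) continuous_const (fun y hy => (hb y hy).elim), fun z => ?_⟩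
    rw [Subsingleton.elim z 0, h]; rfl

lemma nullH_even [Nonempty α] [Nonempty β] (r : ℕ) (ha : r + 1 ≤ Fintype.card α)
    (hb : r + 1 ≤ Fintype.card β) : NullH α β (2 * r) := by
  intro f hf
  obtain ⟨A, B, h⟩ := null_lift f hf
  obtain ⟨HA, a1, a2, a3, a4⟩ := exH (StN_all r α (by simp; omega) A)
  obtain ⟨HB, b1, b2, b3, b4⟩ := exH (StN_all r β (by simp; omega) B)
  refine ⟨fun p => kronU (HA (unitInterval.symm p.1, p.2)) (HB (unitInterval.symm p.1, p.2)), kronU_cont (by fun_prop) (by fun_prop),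
    fun y => ?_, fun y => ?_, fun t y hy => ?_, fun p => ⟨_, _, rfl⟩⟩
  · simp only [unitInterval.symm_zero, a3, b3, oneL_apply, kronU_one]
  · simp only [unitInterval.symm_one, a2, b2, h]
  · simp only [a4 _ y hy, b4 _ y hy, kronU_one]

theorem surj_lift [Nonempty α] [Nonempty β] {n : ℕ} (hN : NullH α β n)
    (f : Ω^ (Fin (n + 1)) (BB α β) (pB 1)) :
    ∃ g : Ω^ (Fin (n + 1)) (U (α × β)) (1 : U (α × β)), mapL pB pB_cont rfl g = f := by
  obtain ⟨F, f1, f2, f3, f4⟩ := BB_HLP (fun _ : Fin n → I => (1 : U (α × β))) continuous_const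
    (fun p => f (cn p.2 p.1)) ((contL f).comp (cn_cont.comp continuous_swap))
    (fun y => GenLoop.boundary f _ (bd_cn0 y))
  have fb : ∀ t, ∀ y ∈ Cube.boundary (Fin n), F (y, t) = 1 := fun t y hy =>
    f4 y (fun t => by
      simp only [GenLoop.boundary f _ (bd_cn _ y hy)]) t
  obtain ⟨K, k1, k2, k3, k4, k5⟩ := hN (mkL (fun y => F (y, 1)) (by fun_prop) (fb 1)) (fun z => by
    apply pB_one.1
    change (QuotientGroup.mk (F (z, 1)) : BB α β) = _
    rw [f3]
    exact GenLoop.boundary f _ (bd_cn1 z))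
  refine ⟨mkL (fun z => F (tl z, z 0) * (K (z 0, tl z))⁻¹) ?_ ?_, GenLoop.ext _ _ fun z => ?_⟩
  · have := tl_cont (n := n)
    fun_prop
  · intro z hz
    rcases (bd_iff z).1 hz with h | h | h
    · rw [h, f2, k2]; simp
    · rw [h, k3]; simp
    · rw [fb _ _ h, k4 _ _ h]; simp
  · change (QuotientGroup.mk (F (tl z, z 0) * (K (z 0, tl z))⁻¹) : BB α β) = f z
    have : (QuotientGroup.mk (F (tl z, z 0) * (K (z 0, tl z))⁻¹) : BB α β) = 
        QuotientGroup.mk (F (tl z, z 0)) := by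
      rw [QuotientGroup.eq]
      simpa using k5 (z 0, tl z)
    rw [this, f3]
    simp
end fibr
end BottPf

namespace BottPf
set_option linter.unusedSectionVars false
set_option linter.unusedSimpArgs false
open scoped unitInterval Topology.Homotopy

section tens
variable {α β N : Type} [Fintype α] [DecidableEq α] [Fintype β] [DecidableEq β]

noncomputable def tensA : U α →* U (α × β) where
  toFun A := kronU A 1
  map_one' := kronU_one
  map_mul' A B := by rw [kronU_mul, mul_one]
noncomputable def tensB : U β →* U (α × β) where
  toFun A := kronU 1 A
  map_one' := kronU_one
  map_mul' A B := by rw [kronU_mul, mul_one]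
lemma tensA_cont : Continuous (tensA : U α →* U (α × β)) :=
  kronU_cont continuous_id continuous_const
lemma tensB_cont : Continuous (tensB : U β →* U (α × β)) :=
  kronU_cont continuous_const continuous_id

lemma tens_fin (b0 : β) (f : Ω^ N (U α) (1 : U α)) (s : Finset β) :
    ∃ h : Ω^ N (U (α × β)) (1 : U (α × β)),
      (∀ z, (h z : Matrix (α × β) (α × β) ℂ) =
        amp (f z : Matrix α α ℂ) (Matrix.diagonal fun x => if x ∈ s then 1 else 0)) ∧
      GenLoop.Homotopic h ((stabL (slotR α b0) f) ^ s.card) := by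
  induction s using Finset.induction_on with
  | empty =>
    refine ⟨1, fun z => ?_, by simpa using hrefl (1 : Ω^ N (U (α × β)) (1 : U (α × β)))⟩
    rw [oneL_apply, U_coe_one]
    have : (Matrix.diagonal fun x : β => if x ∈ (∅ : Finset β) then (1 : ℂ) else 0) = 0 := by
      simp
    rw [this, amp_eq]; simp
  | insert b s hb ih =>
    obtain ⟨h, h1, h2⟩ := ih
    refine ⟨h * stabL (slotR α b) f, fun z => ?_, ?_⟩
    · rw [mulL_apply, U_coe_mul, h1, stabL_apply, stabE_coe, ← amp_single, ← amp_add]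
      · rw [diagonal_add]
        congr 2
        funext x
        by_cases hx : x = b
        · subst hx; simp [hb]
        · simp [hx]
      · rw [diagonal_mul_diagonal, ← diagonal_zero]
        congr 1
        funext x
        by_cases hx : x = b
        · subst hx; simp [hb]
        · simp [hx]
    · rw [Finset.card_insert_of_notMem hb, pow_succ]
      exact hmul h2 (stabL_indep _ _ _)

lemma tensA_homotopic (b0 : β) (f : Ω^ N (U α) (1 : U α)) :
    GenLoop.Homotopic (homL (tensA : U α →* U (α × β)) tensA_cont f)
      ((stabL (slotR α b0) f) ^ Fintype.card β) := by
  obtain ⟨h, h1, h2⟩ := tens_fin b0 f Finset.univ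
  have : homL (tensA : U α →* U (α × β)) tensA_cont f = h := by
    refine GenLoop.ext _ _ fun z => Subtype.ext ?_
    rw [h1]
    simp only [Finset.mem_univ, if_true, diagonal_one]
    change (f z : Matrix α α ℂ) ⊗ₖ ((1 : U β) : Matrix β β ℂ) = _
    rw [U_coe_one, amp]
    simp
  rw [this]
  exact h2

lemma tensB_homotopic (a0 : α) (f : Ω^ N (U β) (1 : U β)) :
    GenLoop.Homotopic (homL (tensB : U β →* U (α × β)) tensB_cont f)
      ((stabL ((slotR β a0).trans (Equiv.prodComm β α).toEmbedding) f) ^ Fintype.card α) := by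
  have h := stabL_homotopic (Equiv.prodComm β α).toEmbedding (tensA_homotopic a0 f)
  rw [map_pow, stabL_trans] at h
  have : stabL (Equiv.prodComm β α).toEmbedding (homL (tensA : U β →* U (β × α)) tensA_cont f) =
      homL (tensB : U β →* U (α × β)) tensB_cont f := by
    refine GenLoop.ext _ _ fun z => Subtype.ext ?_
    rw [stabL_apply, stabE_coe, embP_equiv_mul]
    change ((f z : Matrix β β ℂ) ⊗ₖ ((1 : U α) : Matrix α α ℂ)).submatrix _ _ =
      ((1 : U α) : Matrix α α ℂ) ⊗ₖ (f z : Matrix β β ℂ)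
    ext ⟨a, b⟩ ⟨a', b'⟩
    simp [mul_comm]
  rwa [this] at h
end tens

lemma cyc {G : Type} [Group G] (c : G) (d : ℕ) (h1 : ∀ x, ∃ j : ℤ, x = c ^ j)
    (h2 : c ^ d = 1) (h3 : ∀ j : ℤ, c ^ j = 1 → (d : ℤ) ∣ j) :
    Nonempty (G ≃* Multiplicative (ZMod d)) := by
  have hg : ∀ x, x ∈ Subgroup.zpowers c := fun x => by
    obtain ⟨j, rfl⟩ := h1 x
    exact ⟨j, rfl⟩
  have ho : orderOf c = d := by
    apply Nat.dvd_antisymm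
    · exact orderOf_dvd_of_pow_eq_one h2
    · have := h3 (orderOf c) (by rw [zpow_natCast, pow_orderOf_eq_one])
      exact_mod_cast this
  have hc : Nat.card G = d := by rw [← orderOf_eq_card_of_forall_mem_zpowers hg, ho]
  subst hc
  exact ⟨(zmodCyclicMulEquiv ⟨c, hg⟩).symm⟩

theorem pi_BB (α β : Type) [Fintype α] [DecidableEq α] [Fintype β] [DecidableEq β] (r : ℕ)
    (ha : r + 1 ≤ Fintype.card α) (hb : r + 1 ≤ Fintype.card β) :
    Nonempty (HomotopyGroup (Fin (2 * r + 1)) (BB α β) (pB 1) ≃*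
      Multiplicative (ZMod (Nat.gcd (Fintype.card α) (Fintype.card β)))) := by
  have : Nonempty α := Fintype.card_pos_iff.1 (by omega)
  have : Nonempty β := Fintype.card_pos_iff.1 (by omega)
  obtain ⟨a0⟩ := ‹Nonempty α›
  obtain ⟨b0⟩ := ‹Nonempty β›
  have : Nonempty α := ⟨a0⟩
  have : Nonempty β := ⟨b0⟩
  have hab : r + 1 ≤ Fintype.card (α × β) := by
    rw [Fintype.card_prod]
    exact ha.trans (Nat.le_mul_of_pos_right _ Fintype.card_pos)
  obtain ⟨g, g1, g2⟩ := StZ_all r (α × β) (by rw [Fintype.card_fin]; omega)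
  have ginj : ∀ i j : ℤ, GenLoop.Homotopic (g ^ i) (g ^ j) → i = j := fun i j h => by
    rw [homotopic_iff_mul_inv, ← _root_.zpow_sub] at h
    have := g2 _ h
    omega
  let P : HomotopyGroup (Fin (2 * r + 1)) (U (α × β)) (1 : U (α × β)) →*
    HomotopyGroup (Fin (2 * r + 1)) (BB α β) (pB 1) := mapPi pB pB_cont rfl
  have hP : ∀ f : Ω^ (Fin (2 * r + 1)) (U (α × β)) (1 : U (α × β)), (∀ z, f z ∈ HS α β) →
      P (cls f) = 1 := fun f hf => by
    have := ker_of f hf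
    change mkPi (mapL pB pB_cont rfl f) = _
    rw [this]; rfl
  have hpow : ∀ j : ℤ, (P (cls g)) ^ j = P (cls (g ^ j)) := fun j => by rw [map_zpow, map_zpow]
  have hA : (P (cls g)) ^ Fintype.card β = 1 := by
    obtain ⟨A, hA⟩ := stab_surj (slotR α b0) (by rw [Fintype.card_fin]; omega) g
    rw [← map_pow, ← map_pow,
      cls_eq.2 ((hnpow hA (Fintype.card β)).trans (tensA_homotopic b0 A).symm)]
    exact hP _ fun z => ⟨_, _, rfl⟩
  have hB : (P (cls g)) ^ Fintype.card α = 1 := by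
    obtain ⟨A, hA⟩ := stab_surj ((slotR β a0).trans (Equiv.prodComm β α).toEmbedding)
      (by rw [Fintype.card_fin]; omega) g
    rw [← map_pow, ← map_pow,
      cls_eq.2 ((hnpow hA (Fintype.card α)).trans (tensB_homotopic a0 A).symm)]
    exact hP _ fun z => ⟨_, _, rfl⟩
  refine cyc (P (cls g)) _ (fun x => ?_) ?_ (fun j hj => ?_)
  · obtain ⟨f, rfl⟩ := mkPi_surj x
    obtain ⟨f', rfl⟩ := surj_lift (nullH_even r ha hb) f
    obtain ⟨k, hk⟩ := g1 f'
    refine ⟨k, ?_⟩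
    rw [hpow, ← cls_eq.2 hk]; rfl
  · rw [← orderOf_dvd_iff_pow_eq_one] at hA hB ⊢
    exact Nat.dvd_gcd hB hA
  · rw [hpow] at hj
    obtain ⟨A, B, g', e1, e2⟩ := ker_lift (g ^ j) (mkPi_eq.1 hj)
    have e3 : g' = homL (tensA : U α →* U (α × β)) tensA_cont A *
        homL (tensB : U β →* U (α × β)) tensB_cont B := by
      refine GenLoop.ext _ _ fun z => ?_
      rw [e2, mulL_apply, homL_apply, homL_apply]
      change _ = kronU _ 1 * kronU 1 _
      rw [kronU_mul, mul_one, one_mul]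
    obtain ⟨m, hm⟩ := g1 (stabL (slotR α b0) A)
    obtain ⟨n, hn⟩ := g1 (stabL ((slotR β a0).trans (Equiv.prodComm β α).toEmbedding) B)
    have e4 := e1.trans (e3 ▸ hmul ((tensA_homotopic b0 A).trans (hnpow hm _))
      ((tensB_homotopic a0 B).trans (hnpow hn _)))
    rw [← zpow_natCast, ← zpow_natCast, ← _root_.zpow_mul, ← _root_.zpow_mul, ← _root_.zpow_add] at e4
    rw [ginj _ _ e4]
    apply dvd_add
    · exact Dvd.dvd.mul_left (by exact_mod_cast Nat.gcd_dvd_right _ _) _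
    · exact Dvd.dvd.mul_left (by exact_mod_cast Nat.gcd_dvd_left _ _) _

noncomputable def piEquiv {N X Y : Type} [DecidableEq N] [Nonempty N] [TopologicalSpace X] [TopologicalSpace Y]
    (e : X ≃ₜ Y) {x : X} {y : Y} (h : e x = y) : HomotopyGroup N X x ≃* HomotopyGroup N Y y :=
  MonoidHom.toMulEquiv (mapPi e e.continuous h) (mapPi e.symm e.symm.continuous (by rw [← h]; simp))
    (by
      ext q
      obtain ⟨f, rfl⟩ := mkPi_surj q
      rw [MonoidHom.comp_apply, mapPi_mk, mapPi_mk]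
      exact congrArg mkPi (GenLoop.ext _ _ fun z => by simp))
    (by
      ext q
      obtain ⟨f, rfl⟩ := mkPi_surj q
      rw [MonoidHom.comp_apply, mapPi_mk, mapPi_mk]
      exact congrArg mkPi (GenLoop.ext _ _ fun z => by simp))
end BottPf

namespace BottPf
theorem GrU_rel (k l : ℕ) (x y : U (Fin k × Fin l)) :
    kroneckerCosetRel k l x y ↔ x⁻¹ * y ∈ HS (Fin k) (Fin l) := by
  constructor
  · rintro ⟨A, hA, B, hB, h⟩
    refine ⟨⟨A, hA⟩, ⟨B, hB⟩, ?_⟩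
    rw [inv_mul_eq_iff_eq_mul]
    exact Subtype.ext h
  · rintro ⟨A, B, h⟩
    rw [inv_mul_eq_iff_eq_mul] at h
    exact ⟨A.1, A.2, B.1, B.2, congrArg Subtype.val h⟩

noncomputable def GrU_homeo (k l : ℕ) : BB (Fin k) (Fin l) ≃ₜ GrU k l where
  toFun := Quotient.lift (fun g => (Quot.mk _ g : GrU k l)) (fun x y h => Quot.sound
    ((GrU_rel k l x y).2 (QuotientGroup.leftRel_apply.1 h)))
  invFun := Quot.lift (fun g => (QuotientGroup.mk g : BB (Fin k) (Fin l)))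
    (fun x y h => QuotientGroup.eq.2 ((GrU_rel k l x y).1 h))
  left_inv := by rintro ⟨g⟩; rfl
  right_inv := by rintro ⟨g⟩; rfl
  continuous_toFun := Continuous.quotient_lift (continuous_quot_mk) _
  continuous_invFun := continuous_quot_lift _ QuotientGroup.continuous_mk
end BottPf

/-- π_{2r-1}(Gr^U_{k,l}) ≅ ℤ/dℤ for 1 ≤ r ≤ min(k,l), where d = gcd(k,l). -/
theorem stmt_1 (k l : ℕ) (hk : 1 < k) (hl : 1 < l) (d : ℕ) (hd : d = Nat.gcd k l) :
    ∀ r : ℕ, (hr : 1 ≤ r) → r ≤ min k l →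
      letI : Nonempty (Fin (2 * r - 1)) := ⟨⟨0, by omega⟩⟩
      Nonempty (HomotopyGroup (Fin (2 * r - 1)) (GrU k l) (GrU.pt k l) ≃*
        Multiplicative (ZMod d)) := by
  intro r hr hrm
  obtain ⟨r, rfl⟩ : ∃ s, r = s + 1 := ⟨r - 1, by omega⟩
  obtain ⟨e⟩ := BottPf.pi_BB (Fin k) (Fin l) r (by rw [Fintype.card_fin]; omega)
    (by rw [Fintype.card_fin]; omega)
  rw [Fintype.card_fin, Fintype.card_fin, ← hd] at e
  exact ⟨(BottPf.piEquiv (N := Fin (2 * r + 1)) (BottPf.GrU_homeo k l) rfl).symm.trans e⟩
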